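/- If M is a countable transitive set such that (M,∈) satisfies all axioms of ZFC, then there exists a countable transitive set N with M ⊆ N, containing exactly the same ordinals as M (for every ordinal α, α ∈ M iff α ∈ N), such that (N,∈) satisfies ZFC together with the Continuum Hypothesis. -/

import Mathlib

namespace CtmForcing

open FirstOrder FirstOrder.Language

/-! ### The first-order language of set theory -/

/-- The relation symbols of the language of set theory: a single binary relation `∈`. -/
inductive memRel : ℕ → Type
  | mem : memRel 2

/-- The first-order language `L` of set theory, with a single binary relation symbol `∈`. -/
def SetLang : Language := ⟨fun _ => Empty, memRel⟩

/-- The membership relation symbol. -/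
abbrev memSymb : SetLang.Relations 2 := .mem

/-- `L`-formulas (with no free "unbounded" variables) whose free variables are among
`v₀, …, v_{n-1}`. -/
abbrev BF (n : ℕ) := SetLang.BoundedFormula Empty n

/-- The atomic formula `vᵢ ∈ vⱼ`. -/
def memf {n : ℕ} (i j : Fin n) : BF n :=
  memSymb.boundedFormula₂ (Term.var (Sum.inr i)) (Term.var (Sum.inr j))

/-- The atomic formula `vᵢ = vⱼ`. -/
def eqf {n : ℕ} (i j : Fin n) : BF n :=
  Term.bdEqual (Term.var (Sum.inr i)) (Term.var (Sum.inr j))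

/-- Rename the free variables of a formula along `f`. -/
def reindex {m k : ℕ} (f : Fin m → Fin k) (φ : BF m) : BF k :=
  (BoundedFormula.relabel (Sum.map id f) φ.toFormula : SetLang.BoundedFormula Empty (k + 0))

/-- Conjunction. -/
def andF {n : ℕ} (φ ψ : BF n) : BF n := (φ.imp ψ.not).not

/-- Disjunction. -/
def orF {n : ℕ} (φ ψ : BF n) : BF n := (φ.not).imp ψ

/-- Biimplication. -/
def iffF {n : ℕ} (φ ψ : BF n) : BF n := andF (φ.imp ψ) (ψ.imp φ)

/-! ### Basic set-theoretic formulas -/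

/-- `v₀ ⊆ v₁`. -/
def subF : BF 2 := ((memf 2 0).imp (memf 2 1)).all

/-- `v₀ = ∅`. -/
def emptyF : BF 1 := ((memf 1 0).not).all

/-- `v₂ = {v₀, v₁}`. -/
def pairSetF : BF 3 := (iffF (memf 3 2) (orF (eqf 3 0) (eqf 3 1))).all

/-- `v₁ = {v₀}`. -/
def singF : BF 2 := reindex ![0, 0, 1] pairSetF

/-- `v₂ = ⟨v₀, v₁⟩` (Kuratowski ordered pair). -/
def opF : BF 3 :=
  (iffF (memf 3 2) (orF (reindex ![0, 3] singF) (reindex ![0, 1, 3] pairSetF))).all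

/-- `v₁ = v₀ ∪ {v₀}`. -/
def succF : BF 2 := (iffF (memf 2 1) (orF (memf 2 0) (eqf 2 0))).all

/-- `v₀` is transitive. -/
def transF : BF 1 := ((memf 1 0).imp (reindex ![1, 0] subF)).all

/-- `v₀` is an ordinal (a transitive set of transitive sets). -/
def ordF : BF 1 := andF transF (((memf 1 0).imp (reindex ![1] transF)).all)

/-- `⟨v₀, v₁⟩ ∈ v₂`. -/
def relMemF : BF 3 := (andF (reindex ![0, 1, 3] opF) (memf 3 2)).ex

/-- `v₂` is a function with domain `v₀` mapping onto `v₁` (a surjection from `v₀` onto `v₁`). -/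
def isFuncF : BF 3 :=
  andF
    (andF
      -- v₂ ⊆ v₀ × v₁
      (((memf 3 2).imp
        (((andF (andF (memf 4 0) (memf 5 1)) (reindex ![4, 5, 3] opF)).ex).ex)).all)
      -- total on v₀
      (((memf 3 0).imp ((andF (memf 4 1) (reindex ![3, 4, 2] relMemF)).ex)).all))
    (andF
      -- functional
      ((((andF (reindex ![3, 4, 2] relMemF) (reindex ![3, 5, 2] relMemF)).imp
          (eqf 4 5)).all).all.all)
      -- onto v₁
      (((memf 3 1).imp ((andF (memf 4 0) (reindex ![4, 3, 2] relMemF)).ex)).all))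

/-- `v₂` is injective (as a set of ordered pairs). -/
def injF : BF 3 :=
  ((((andF (reindex ![3, 5, 2] relMemF) (reindex ![4, 5, 2] relMemF)).imp
      (eqf 3 4)).all).all).all

/-- `v₂` is a bijection from `v₀` onto `v₁`. -/
def bijF : BF 3 := andF isFuncF injF

/-! ### The axioms of set theory as `L`-sentences -/

/-- Extensionality. -/
def extAx : SetLang.Sentence :=
  ((((andF subF (reindex ![1, 0] subF)).imp (eqf 0 1)).all).all : BF 0)

/-- Foundation. -/
def foundAx : SetLang.Sentence :=
  (((((memf 1 0).ex).imp
    ((andF (memf 1 0) (((memf 2 0).imp ((memf 2 1).not)).all)).ex)).all) : BF 0)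

/-- Pairing. -/
def pairAx : SetLang.Sentence := (((pairSetF.ex).all).all : BF 0)

/-- Union. -/
def unionAx : SetLang.Sentence :=
  (((((iffF (memf 2 1) ((andF (memf 3 0) (memf 2 3)).ex)).all).ex).all : BF 0))

/-- Powerset. -/
def powF : BF 2 := (iffF (memf 2 1) (reindex ![2, 0] subF)).all

/-- Powerset axiom. -/
def powAx : SetLang.Sentence := (((powF.ex).all) : BF 0)

/-- Infinity. -/
def infAx : SetLang.Sentence :=
  (((andF ((andF (memf 1 0) (reindex ![1] emptyF)).ex)
    (((memf 1 0).imp ((andF (memf 2 0) (reindex ![1, 2] succF)).ex)).all)).ex) : BF 0)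

/-- The instance of the Separation scheme given by `φ`, whose free variables are among
`v₀, …, vₙ`: the parameters are `v₀, …, v_{n-1}` and the tested element is `vₙ`.  It is the
universal closure of `∀A ∃B ∀x (x ∈ B ↔ x ∈ A ∧ φ(params, x))`. -/
def sepAx {n : ℕ} (φ : BF (n + 1)) : SetLang.Sentence :=
  -- context `n+3`: parameters `0,…,n-1`, `A = n`, `B = n+1`, `x = n+2`
  let A : Fin (n + 3) := ⟨n, by omega⟩
  let B : Fin (n + 3) := ⟨n + 1, by omega⟩
  let x : Fin (n + 3) := ⟨n + 2, by omega⟩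
  let φ' : BF (n + 3) := reindex (fun i => if h : (i : ℕ) < n then ⟨i, by omega⟩ else x) φ
  ((((iffF (memf x B) (andF (memf x A) φ')).all).ex).all).alls

/-- The instance of the Replacement scheme given by `φ`, whose free variables are among
`v₀, …, v_{n+1}`: the parameters are `v₀, …, v_{n-1}`, the argument is `x = vₙ`, and the
value is `y = v_{n+1}`.  It is the universal closure of
`∀A [(∀x∈A ∀y ∀y' (φ(x,y) ∧ φ(x,y') → y = y')) → ∃B ∀y (y ∈ B ↔ ∃x∈A φ(x,y))]`. -/
def replAx {n : ℕ} (φ : BF (n + 2)) : SetLang.Sentence :=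
  -- functionality context `n+4`: parameters, `A = n`, `x = n+1`, `y = n+2`, `y' = n+3`
  let A : Fin (n + 4) := ⟨n, by omega⟩
  let x : Fin (n + 4) := ⟨n + 1, by omega⟩
  let y : Fin (n + 4) := ⟨n + 2, by omega⟩
  let y' : Fin (n + 4) := ⟨n + 3, by omega⟩
  let φ₁ : BF (n + 4) :=
    reindex (fun i => if h : (i : ℕ) < n then ⟨i, by omega⟩ else if (i : ℕ) = n then x else y) φ
  let φ₂ : BF (n + 4) :=
    reindex (fun i => if h : (i : ℕ) < n then ⟨i, by omega⟩ else if (i : ℕ) = n then x else y') φ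
  let funcl : BF (n + 1) :=
    ((((andF (memf x A) (andF φ₁ φ₂)).imp (eqf y y')).all).all).all
  -- image context `n+4`: parameters, `A = n`, `B = n+1`, `y = n+2`, `x = n+3`
  let xi : Fin (n + 4) := ⟨n + 3, by omega⟩
  let yi : Fin (n + 4) := ⟨n + 2, by omega⟩
  let B3 : Fin (n + 3) := ⟨n + 1, by omega⟩
  let y3 : Fin (n + 3) := ⟨n + 2, by omega⟩
  let φ₃ : BF (n + 4) :=
    reindex (fun i => if h : (i : ℕ) < n then ⟨i, by omega⟩ else if (i : ℕ) = n then xi else yi) φ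
  let image : BF (n + 1) :=
    (((iffF (memf y3 B3) ((andF (memf xi A) φ₃).ex)).all).ex)
  ((funcl.imp image).all).alls

/-- The Axiom of Choice: every set is the surjective image of an ordinal. -/
def acAx : SetLang.Sentence :=
  ((((andF (reindex ![1] ordF) (reindex ![1, 0, 2] isFuncF)).ex).ex).all : BF 0)

/-- `v₀ = ω`: `v₀` is an ordinal containing `∅`, closed under successors, each of whose
elements is `∅` or a successor. -/
def omegaF : BF 1 :=
  andF (andF ordF ((andF (memf 1 0) (reindex ![1] emptyF)).ex))
    (andF (((memf 1 0).imp ((andF (memf 2 0) (reindex ![1, 2] succF)).ex)).all)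
      (((memf 1 0).imp
        (orF (reindex ![1] emptyF) ((andF (memf 2 1) (reindex ![2, 1] succF)).ex))).all))

/-- Given `v₀ = ω`, `v₁ = ℵ₁`: `v₁` is an ordinal, there is no surjection from `ω` onto `v₁`,
and every element of `v₁` is empty or a surjective image of `ω`. -/
def alephOneF : BF 2 :=
  andF (andF (reindex ![1] ordF) (((reindex ![0, 1, 2] isFuncF).ex).not))
    (((memf 2 1).imp (orF (reindex ![2] emptyF) ((reindex ![0, 2, 3] isFuncF).ex))).all)

/-- The Continuum Hypothesis `ℵ₁ = 2^ℵ₀`: there is a bijection between `𝒫(ω)` and `ℵ₁`. -/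
def chSent : SetLang.Sentence :=
  (((((andF (andF (reindex ![0] omegaF) (reindex ![0, 1] powF))
      (andF (reindex ![0, 2] alephOneF) (reindex ![1, 2, 3] bijF))).ex).ex).ex).ex : BF 0)

/-! ### The theories `Z`, `ZF`, `ZC`, `ZFC` -/

/-- The finitely many non-scheme axioms of `ZF`. -/
def zfFin : SetLang.Theory := {extAx, foundAx, pairAx, unionAx, powAx, infAx}

/-- All instances of the Separation scheme. -/
def sepScheme : SetLang.Theory := Set.range fun p : Σ n, BF (n + 1) => sepAx p.2

/-- All instances of the Replacement scheme. -/
def replScheme : SetLang.Theory := Set.range fun p : Σ n, BF (n + 2) => replAx p.2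

/-- Zermelo set theory. -/
def Z : SetLang.Theory := zfFin ∪ sepScheme

/-- Zermelo–Fraenkel set theory. -/
def ZF : SetLang.Theory := Z ∪ replScheme

/-- Zermelo set theory with Choice. -/
def ZC : SetLang.Theory := Z ∪ {acAx}

/-- Zermelo–Fraenkel set theory with Choice. -/
def ZFC : SetLang.Theory := ZF ∪ {acAx}

/-! ### Satisfaction in a set with the true membership relation -/

/-- The `L`-structure on (the elements of) a `ZFSet` `M`, with `∈` interpreted as true
membership. -/
def zfStruct (M : ZFSet) : SetLang.Structure {x : ZFSet // x ∈ M} where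
  funMap := fun f _ => f.elim
  RelMap | .mem => fun v => ((v 0 : {x : ZFSet // x ∈ M}) : ZFSet) ∈ ((v 1 : {x : ZFSet // x ∈ M}) : ZFSet)

/-- `(M, ∈) ⊨ T`: the structure on `M` with true membership satisfies every sentence of `T`. -/
def ZModels (M : ZFSet) (T : SetLang.Theory) : Prop :=
  ∀ φ ∈ T, letI := zfStruct M; Sentence.Realize (M := {x : ZFSet // x ∈ M}) φ

/-- `(M, ∈) ⊨ φ[v₀, …, v_{k-1}]`: satisfaction of the formula `φ` in `M`, with the
(membership-checked) valuation `v` of its free variables. -/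
def ZRealize (M : ZFSet) {k : ℕ} (φ : BF k) (v : Fin k → ZFSet) : Prop :=
  ∀ h : ∀ i, v i ∈ M,
    letI := zfStruct M
    BoundedFormula.Realize (M := {x : ZFSet // x ∈ M}) φ (fun e => e.elim) (fun i => ⟨v i, h i⟩)

/-- `x` is a (von Neumann) ordinal: a transitive set of transitive sets. -/
def IsOrd (x : ZFSet) : Prop := x.IsTransitive ∧ ∀ y ∈ x, ZFSet.IsTransitive y

end CtmForcing

namespace CtmForcing

open FirstOrder FirstOrder.Language

universe u

/-- elements of `M` -/
abbrev El (M : ZFSet.{u}) := {x : ZFSet.{u} // x ∈ M}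

def Rz (M : ZFSet.{u}) {n : ℕ} (φ : BF n) (v : Fin n → El M) : Prop :=
  letI := zfStruct M
  BoundedFormula.Realize (M := El M) φ (fun e => e.elim) v

section rz
variable {M : ZFSet.{u}} {n : ℕ} (φ ψ : BF n) (v : Fin n → El M)

theorem Rz_mem (i j : Fin n) : Rz M (memf i j) v ↔ (v i).1 ∈ (v j).1 := by
  let _ := zfStruct M
  unfold Rz memf
  rw [BoundedFormula.realize_rel₂]
  exact Iff.rfl

theorem Rz_eq (i j : Fin n) : Rz M (eqf i j) v ↔ (v i).1 = (v j).1 := by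
  let _ := zfStruct M
  unfold Rz eqf
  rw [BoundedFormula.realize_bdEqual]
  exact Subtype.ext_iff

theorem Rz_fls (v : Fin n → El M) : Rz M (BoundedFormula.falsum : BF n) v ↔ False := Iff.rfl

theorem Rz_imp : Rz M (φ.imp ψ) v ↔ (Rz M φ v → Rz M ψ v) := by
  let _ := zfStruct M
  exact BoundedFormula.realize_imp

theorem Rz_not : Rz M φ.not v ↔ ¬ Rz M φ v := by
  let _ := zfStruct M
  exact BoundedFormula.realize_not

theorem Rz_and : Rz M (andF φ ψ) v ↔ (Rz M φ v ∧ Rz M ψ v) := by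
  unfold andF; rw [Rz_not, Rz_imp, Rz_not]; tauto

theorem Rz_or : Rz M (orF φ ψ) v ↔ (Rz M φ v ∨ Rz M ψ v) := by
  unfold orF; rw [Rz_imp, Rz_not]; tauto

theorem Rz_iff : Rz M (iffF φ ψ) v ↔ (Rz M φ v ↔ Rz M ψ v) := by
  unfold iffF; rw [Rz_and, Rz_imp, Rz_imp]; tauto

theorem Rz_all (θ : BF (n+1)) : Rz M θ.all v ↔ ∀ x, ∀ h : x ∈ M, Rz M θ (Fin.snoc v ⟨x, h⟩) := by
  let _ := zfStruct M
  exact BoundedFormula.realize_all.trans Subtype.forall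

theorem Rz_ex (θ : BF (n+1)) : Rz M θ.ex v ↔ ∃ x, ∃ h : x ∈ M, Rz M θ (Fin.snoc v ⟨x, h⟩) := by
  let _ := zfStruct M
  exact BoundedFormula.realize_ex.trans Subtype.exists

theorem Rz_reindex {m k : ℕ} (f : Fin m → Fin k) (φ : BF m) (v : Fin k → El M) :
    Rz M (reindex f φ) v ↔ Rz M φ (fun i => v (f i)) := by
  let _ := zfStruct M
  unfold Rz reindex
  have h := @BoundedFormula.realize_relabel SetLang (El M) _ (Empty ⊕ Fin m) Empty k 0 φ.toFormula
    (Sum.map id f) (fun e => e.elim) v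
  refine h.trans ?_
  have h2 := BoundedFormula.realize_toFormula (M := El M) φ
    (Sum.elim (fun e : Empty => e.elim) (fun i => v (f i)))
  rw [Formula.Realize] at h2
  have e1 : (Sum.elim (fun e : Empty => (e.elim : El M)) (v ∘ Fin.castAdd 0) ∘ Sum.map id f) =
      Sum.elim (fun e : Empty => e.elim) (fun i => v (f i)) := by
    funext x
    rcases x with x | x
    · exact x.elim
    · rfl
  have e2 : (v ∘ Fin.natAdd k : Fin 0 → El M) = default := by
    funext x; exact x.elim0
  have e3 : ((Sum.elim (fun e : Empty => (e.elim : El M)) (fun i => v (f i))) ∘ Sum.inl) =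
      (fun e : Empty => e.elim) := by funext x; exact x.elim
  rw [e1, e2, h2, e3]
  rfl

theorem Rz_sent (φ : SetLang.Sentence) :
    (letI := zfStruct M; Sentence.Realize (M := El M) φ) ↔ Rz M (φ : BF 0) Fin.elim0 := by
  let _ := zfStruct M
  unfold Sentence.Realize Formula.Realize Rz
  rw [iff_eq_eq]
  congr 1
  funext x; exact x.elim

theorem Rz_alls (φ : BF n) :
    Rz M (φ.alls : BF 0) Fin.elim0 ↔ ∀ v : Fin n → El M, Rz M φ v := by
  let _ := zfStruct M
  rw [← Rz_sent]
  unfold Sentence.Realize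
  rw [BoundedFormula.realize_alls]
  unfold Rz
  have : (default : Empty → El M) = fun e => e.elim := by funext x; exact x.elim
  rw [this]

end rz

/-! ### definability -/

/-- definable (with parameters) relations over `M` -/
class Def (M : ZFSet.{u}) (R : (ℕ → ZFSet.{u}) → Prop) : Prop where
  out : ∃ (n : ℕ) (φ : BF n) (t : Fin n → ℕ ⊕ El M), ∀ e : ℕ → El M,
    R (fun i => (e i).1) ↔ Rz M φ (fun i => Sum.elim e id (t i))

section defs
variable {M : ZFSet.{u}}

/-- definability from a formula -/
theorem Def.ofRz {n : ℕ} (φ : BF n) {R : (ℕ → ZFSet.{u}) → Prop}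
    (h : ∀ e : ℕ → El M, R (fun i => (e i).1) ↔ Rz M φ (fun i => e i)) : Def M R :=
  ⟨n, φ, fun i => Sum.inl i, h⟩

theorem Def.ren {R : (ℕ → ZFSet.{u}) → Prop} (h : Def M R) (r : ℕ → ℕ) :
    Def M (fun e => R (fun n => e (r n))) := by
  obtain ⟨n, φ, t, h⟩ := h
  refine ⟨n, φ, fun i => Sum.map r id (t i), fun e => (h (fun n => e (r n))).trans ?_⟩
  rw [iff_eq_eq]; congr 1; funext i
  rcases hti : t i with j | c <;> simp [hti]

theorem Def.congr {R R' : (ℕ → ZFSet.{u}) → Prop} (h : Def M R)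
    (hh : ∀ e : ℕ → ZFSet.{u}, (∀ i, e i ∈ M) → (R' e ↔ R e)) : Def M R' := by
  obtain ⟨n, φ, t, H⟩ := h
  exact ⟨n, φ, t, fun e => (hh _ (fun i => (e i).2)).trans (H e)⟩

instance Def.imp {A B : (ℕ → ZFSet.{u}) → Prop} [hA : Def M A] [hB : Def M B] :
    Def M (fun e => A e → B e) := by
  obtain ⟨n, φ, t, h⟩ := hA
  obtain ⟨m, ψ, s, k⟩ := hB
  refine ⟨n + m, (reindex (Fin.castAdd m) φ).imp (reindex (Fin.natAdd n) ψ),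
    Fin.append t s, fun e => ?_⟩
  rw [Rz_imp, Rz_reindex, Rz_reindex, h, k]
  simp only [Fin.append_left, Fin.append_right]

instance Def.fls : Def M (fun _ => False) :=
  ⟨0, BoundedFormula.falsum, Fin.elim0, fun _ => Iff.rfl⟩

instance Def.not {A : (ℕ → ZFSet.{u}) → Prop} [hA : Def M A] : Def M (fun e => ¬ A e) :=
  Def.imp (B := fun _ => False)

instance Def.tru : Def M (fun _ => True) :=
  Def.congr (R := fun _ => ¬ False) inferInstance (by simp)

instance Def.and {A B : (ℕ → ZFSet.{u}) → Prop} [hA : Def M A] [hB : Def M B] :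
    Def M (fun e => A e ∧ B e) :=
  Def.congr (R := fun e => ¬ (A e → ¬ B e)) inferInstance (by intro e _; tauto)

instance Def.or {A B : (ℕ → ZFSet.{u}) → Prop} [hA : Def M A] [hB : Def M B] :
    Def M (fun e => A e ∨ B e) :=
  Def.congr (R := fun e => ¬ A e → B e) inferInstance (by intro e _; tauto)

instance Def.iff {A B : (ℕ → ZFSet.{u}) → Prop} [hA : Def M A] [hB : Def M B] :
    Def M (fun e => A e ↔ B e) :=
  Def.congr (R := fun e => (A e → B e) ∧ (B e → A e)) inferInstance (by intro e _; tauto)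

open Classical in
instance (priority := high) Def.all {R : (ℕ → ZFSet.{u}) → ZFSet.{u} → Prop}
    [h : Def M (fun e => R (fun n => e (n+1)) (e 0))] :
    Def M (fun e => ∀ x, x ∈ M → R e x) := by
  obtain ⟨n, φ, t, h⟩ := h
  refine ⟨n, (reindex (fun i => if t i = Sum.inl 0 then Fin.last n else Fin.castSucc i) φ).all,
    fun i => Sum.map Nat.pred id (t i), fun e => ?_⟩
  rw [Rz_all]
  refine forall_congr' fun x => forall_congr' fun hx => ?_
  rw [Rz_reindex]
  refine (h (fun i => Nat.casesOn i ⟨x, hx⟩ e)).trans ?_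
  rw [iff_eq_eq]; congr 1; funext i
  by_cases h0 : t i = Sum.inl 0
  · simp [h0]
  · rcases hti : t i with j | c
    · cases j with
      | zero => exact absurd hti h0
      | succ j => simp [hti]
    · simp [hti]

instance (priority := high) Def.ex {R : (ℕ → ZFSet.{u}) → ZFSet.{u} → Prop}
    [h : Def M (fun e => R (fun n => e (n+1)) (e 0))] :
    Def M (fun e => ∃ x, x ∈ M ∧ R e x) :=
  Def.congr (R := fun e => ¬ ∀ x, x ∈ M → ¬ R e x)
    (@Def.not _ _ (@Def.all _ (fun e x => ¬ R e x) (@Def.not _ _ h)))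
    (by intro e _; push Not; rfl)

/-- definable function terms -/
class Tm (M : ZFSet.{u}) (f : (ℕ → ZFSet.{u}) → ZFSet.{u}) : Prop where
  memM : ∀ e : ℕ → ZFSet.{u}, (∀ i, e i ∈ M) → f e ∈ M
  gr : Def M (fun e => e 0 = f (fun n => e (n+1)))

theorem Tm.mem {f : (ℕ → ZFSet.{u}) → ZFSet.{u}} (h : Tm M f) (e : ℕ → El M) :
    f (fun i => (e i).1) ∈ M := h.memM _ (fun i => (e i).2)

theorem Tm.ren {f : (ℕ → ZFSet.{u}) → ZFSet.{u}} (h : Tm M f) (r : ℕ → ℕ) :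
    Tm M (fun e => f (fun n => e (r n))) :=
  ⟨fun e he => h.memM _ (fun i => he (r i)),
    h.gr.ren (fun n => Nat.casesOn n 0 (fun n => r n + 1))⟩

theorem Tm.shift {f : (ℕ → ZFSet.{u}) → ZFSet.{u}} (h : Tm M f) :
    Tm M (fun e => f (fun n => e (n+1))) := h.ren (fun n => n+1)

theorem Def.eq0 (i j : ℕ) : Def M (fun e => e i = e j) :=
  ⟨2, eqf 0 1, ![Sum.inl i, Sum.inl j], fun e => by rw [Rz_eq]; rfl⟩

theorem Def.mem0 (i j : ℕ) : Def M (fun e => e i ∈ e j) :=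
  ⟨2, memf 0 1, ![Sum.inl i, Sum.inl j], fun e => by rw [Rz_mem]; rfl⟩

instance tmVar (i : ℕ) : Tm M (fun e => e i) := ⟨fun e he => he i, Def.eq0 _ _⟩

instance tmConst (c : ZFSet.{u}) [h : Fact (c ∈ M)] : Tm M (fun _ => c) :=
  ⟨fun _ _ => h.1, ⟨2, eqf 0 1, ![Sum.inl 0, Sum.inr ⟨c, h.1⟩], fun e => by rw [Rz_eq]; rfl⟩⟩

theorem Def.sub1 {R : (ℕ → ZFSet.{u}) → ZFSet.{u} → Prop}
    (h : Def M (fun e => R (fun n => e (n+1)) (e 0))) {a : (ℕ → ZFSet.{u}) → ZFSet.{u}}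
    (ha : Tm M a) : Def M (fun e => R e (a e)) :=
  Def.congr (R := fun e => ∃ x, x ∈ M ∧ (x = a e ∧ R e x))
    (@Def.ex _ (fun e x => x = a e ∧ R e x) (@Def.and _ _ _ ha.gr h))
    (by
      intro e he
      constructor
      · intro h; exact ⟨_, ha.memM e he, rfl, h⟩
      · rintro ⟨x, _, rfl, h⟩; exact h)

theorem Def.app1 {R : ZFSet.{u} → Prop} (h : Def M (fun e => R (e 0)))
    {a : (ℕ → ZFSet.{u}) → ZFSet.{u}} (ha : Tm M a) : Def M (fun e => R (a e)) :=
  Def.sub1 (R := fun _ x => R x) h ha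

theorem Def.app2 {R : ZFSet.{u} → ZFSet.{u} → Prop} (h : Def M (fun e => R (e 0) (e 1)))
    {a b : (ℕ → ZFSet.{u}) → ZFSet.{u}} (ha : Tm M a) (hb : Tm M b) :
    Def M (fun e => R (a e) (b e)) :=
  Def.sub1 (R := fun e x => R x (b e)) (Def.sub1 (R := fun e y => R (e 0) y)
    (h.ren (fun n => Nat.casesOn n 1 (fun _ => 0))) hb.shift) ha

theorem Def.app3 {R : ZFSet.{u} → ZFSet.{u} → ZFSet.{u} → Prop}
    (h : Def M (fun e => R (e 0) (e 1) (e 2)))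
    {a b c : (ℕ → ZFSet.{u}) → ZFSet.{u}} (ha : Tm M a) (hb : Tm M b) (hc : Tm M c) :
    Def M (fun e => R (a e) (b e) (c e)) :=
  Def.sub1 (R := fun e x => R x (b e) (c e)) (Def.sub1 (R := fun e x => R (e 0) x (c (fun n => e (n+1))))
    (Def.sub1 (R := fun e x => R (e 1) (e 0) x)
    (h.ren (fun n => if n = 0 then 2 else if n = 1 then 1 else 0)) (hc.ren (fun n => n+2))) hb.shift) ha

theorem Def.app4 {R : ZFSet.{u} → ZFSet.{u} → ZFSet.{u} → ZFSet.{u} → Prop}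
    (h : Def M (fun e => R (e 0) (e 1) (e 2) (e 3)))
    {a b c d : (ℕ → ZFSet.{u}) → ZFSet.{u}} (ha : Tm M a) (hb : Tm M b) (hc : Tm M c) (hd : Tm M d) :
    Def M (fun e => R (a e) (b e) (c e) (d e)) :=
  Def.sub1 (R := fun e x => R x (b e) (c e) (d e))
    (Def.sub1 (R := fun e x => R (e 0) x (c (fun n => e (n+1))) (d (fun n => e (n+1))))
    (Def.sub1 (R := fun e x => R (e 1) (e 0) x (d (fun n => e (n+2))))
    (Def.sub1 (R := fun e x => R (e 2) (e 1) (e 0) x)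
    (h.ren (fun n => if n = 0 then 3 else if n = 1 then 2 else if n = 2 then 1 else 0))
      (hd.ren (fun n => n+3))) (hc.ren (fun n => n+2))) hb.shift) ha

instance Def.mem {a b : (ℕ → ZFSet.{u}) → ZFSet.{u}} [ha : Tm M a] [hb : Tm M b] :
    Def M (fun e => a e ∈ b e) := Def.app2 (R := fun x y => x ∈ y) (Def.mem0 0 1) ha hb

instance Def.eq {a b : (ℕ → ZFSet.{u}) → ZFSet.{u}} [ha : Tm M a] [hb : Tm M b] :
    Def M (fun e => a e = b e) := Def.app2 (Def.eq0 0 1) ha hb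

instance Def.ne {a b : (ℕ → ZFSet.{u}) → ZFSet.{u}} [Tm M a] [Tm M b] :
    Def M (fun e => a e ≠ b e) := Def.not (A := fun e => a e = b e)

/-- transitive class -/
class Trans (M : ZFSet.{u}) : Prop where
  tr : ∀ x y : ZFSet.{u}, x ∈ y → y ∈ M → x ∈ M

variable [Trans M]

instance Def.ball {a : (ℕ → ZFSet.{u}) → ZFSet.{u}} {R : (ℕ → ZFSet.{u}) → ZFSet.{u} → Prop}
    [ha : Tm M a] [h : Def M (fun e => R (fun n => e (n+1)) (e 0))] :
    Def M (fun e => ∀ x, x ∈ a e → R e x) :=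
  Def.congr (R := fun e => ∀ x, x ∈ M → (x ∈ a e → R e x))
    (@Def.all _ (fun e x => x ∈ a e → R e x)
      (@Def.imp _ _ _ (@Def.mem _ _ _ inferInstance ha.shift) h))
    (by
      intro e he
      refine forall_congr' fun x => ⟨fun hh _ => hh, fun hh hx => hh ?_ hx⟩
      exact Trans.tr _ _ hx (ha.mem (fun i => ⟨e i, he i⟩)))

instance Def.bex {a : (ℕ → ZFSet.{u}) → ZFSet.{u}} {R : (ℕ → ZFSet.{u}) → ZFSet.{u} → Prop}
    [ha : Tm M a] [h : Def M (fun e => R (fun n => e (n+1)) (e 0))] :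
    Def M (fun e => ∃ x, x ∈ a e ∧ R e x) :=
  Def.congr (R := fun e => ¬ ∀ x, x ∈ a e → ¬ R e x)
    (@Def.not _ _ (@Def.ball _ _ _ (fun e x => ¬ R e x) ha (@Def.not _ _ h)))
    (by intro e _; push Not; rfl)

instance Def.sub {a b : (ℕ → ZFSet.{u}) → ZFSet.{u}} [ha : Tm M a] [hb : Tm M b] :
    Def M (fun e => a e ⊆ b e) :=
  @Def.ball _ _ a (fun e x => x ∈ b e) ha (@Def.mem _ _ _ inferInstance hb.shift)

end defs

/-- test -/
theorem testDef (M : ZFSet.{u}) [Trans M] (c : ZFSet.{u}) [Fact (c ∈ M)] :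
    Def M (fun e => ∀ x ∈ e 0, ∃ y ∈ M, x ∈ y ∧ ∀ z ∈ c, z ∈ y ∧ z ⊆ e 1 → ∃ w ∈ z, w = e 2) :=
  inferInstance

end CtmForcing

namespace CtmForcing

open FirstOrder FirstOrder.Language


/-- von Neumann naturals -/
noncomputable def nat : ℕ → ZFSet.{u}
  | 0 => ∅
  | n+1 => insert (nat n) (nat n)

noncomputable def om : ZFSet.{u} := ZFSet.range (fun n : ℕ => nat.{u} n)

theorem mem_om {x : ZFSet.{u}} : x ∈ om ↔ ∃ n, nat n = x := by
  simp [om]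

theorem nat_mem_om (n : ℕ) : nat.{u} n ∈ om := mem_om.2 ⟨n, rfl⟩

def IsSurj (a b f : ZFSet.{u}) : Prop :=
  ((∀ u ∈ f, ∃ x ∈ a, ∃ y ∈ b, u = ZFSet.pair x y) ∧ (∀ x ∈ a, ∃ y ∈ b, ZFSet.pair x y ∈ f)) ∧
  (∀ x y y', ZFSet.pair x y ∈ f → ZFSet.pair x y' ∈ f → y = y') ∧
  (∀ y ∈ b, ∃ x ∈ a, ZFSet.pair x y ∈ f)

/-- transitive sets closed under pairing -/
class TP (M : ZFSet.{u}) : Prop extends Trans M where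
  pr : ∀ x y : ZFSet.{u}, x ∈ M → y ∈ M → ({x, y} : ZFSet.{u}) ∈ M

section base
variable {M : ZFSet.{u}} [Trans M]

theorem Trans.fst {x y z : ZFSet.{u}} (h : ZFSet.pair x y ∈ z) (hz : z ∈ M) : x ∈ M := by
  have h1 : ZFSet.pair x y ∈ M := Trans.tr _ _ h hz
  have h2 : ({x} : ZFSet.{u}) ∈ M := Trans.tr _ _ (by simp [ZFSet.pair]) h1
  exact Trans.tr _ _ (by simp) h2

theorem Trans.snd {x y z : ZFSet.{u}} (h : ZFSet.pair x y ∈ z) (hz : z ∈ M) : y ∈ M := by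
  have h1 : ZFSet.pair x y ∈ M := Trans.tr _ _ h hz
  have h2 : ({x, y} : ZFSet.{u}) ∈ M := Trans.tr _ _ (by simp [ZFSet.pair]) h1
  exact Trans.tr _ _ (by simp) h2

theorem Rz_sub (v : Fin 2 → El M) : Rz M subF v ↔ (v 0).1 ⊆ (v 1).1 := by
  unfold subF
  simp only [Rz_all, Rz_imp, Rz_mem]
  exact ⟨fun h z hz => h z (Trans.tr _ _ hz (v 0).2) hz, fun h z _ hz => h hz⟩

theorem Rz_empty (v : Fin 1 → El M) : Rz M emptyF v ↔ (v 0).1 = ∅ := by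
  unfold emptyF
  simp only [Rz_all, Rz_not, Rz_mem]
  rw [ZFSet.eq_empty]
  exact ⟨fun h z hz => h z (Trans.tr _ _ hz (v 0).2) hz, fun h z _ hz => h z hz⟩

theorem Rz_pairSet (v : Fin 3 → El M) : Rz M pairSetF v ↔ (v 2).1 = {(v 0).1, (v 1).1} := by
  unfold pairSetF
  simp only [Rz_all, Rz_iff, Rz_or, Rz_eq, Rz_mem]
  constructor
  · intro h
    ext z
    rw [ZFSet.mem_pair]
    constructor
    · intro hz; exact (h z (Trans.tr _ _ hz (v 2).2)).1 hz
    · intro hz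
      have : z ∈ M := by rcases hz with rfl | rfl; exacts [(v 0).2, (v 1).2]
      exact (h z this).2 hz
  · intro h z hz
    change z ∈ (v 2).1 ↔ z = _ ∨ z = _
    rw [h, ZFSet.mem_pair]; rfl

theorem Rz_sing (v : Fin 2 → El M) : Rz M singF v ↔ (v 1).1 = {(v 0).1} := by
  unfold singF
  rw [Rz_reindex, Rz_pairSet]
  change (v 1).1 = {(v 0).1, (v 0).1} ↔ _
  rw [ZFSet.pair_eq_singleton]

theorem Rz_succ (v : Fin 2 → El M) : Rz M succF v ↔ (v 1).1 = insert (v 0).1 (v 0).1 := by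
  unfold succF
  simp only [Rz_all, Rz_iff, Rz_or, Rz_eq, Rz_mem]
  constructor
  · intro h
    ext z
    rw [ZFSet.mem_insert_iff, or_comm]
    constructor
    · intro hz; exact (h z (Trans.tr _ _ hz (v 1).2)).1 hz
    · intro hz
      have : z ∈ M := by
        rcases hz with hz | rfl; exacts [Trans.tr _ _ hz (v 0).2, (v 0).2]
      exact (h z this).2 hz
  · intro h z hz
    change z ∈ (v 1).1 ↔ z ∈ (v 0).1 ∨ z = (v 0).1
    rw [h, ZFSet.mem_insert_iff, or_comm]

theorem Rz_trans (v : Fin 1 → El M) : Rz M transF v ↔ (v 0).1.IsTransitive := by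
  unfold transF
  simp only [Rz_all, Rz_imp, Rz_mem, Rz_reindex, Rz_sub]
  exact ⟨fun h z hz => h z (Trans.tr _ _ hz (v 0).2) hz, fun h z _ hz => h z hz⟩

theorem Rz_ord (v : Fin 1 → El M) : Rz M ordF v ↔ IsOrd (v 0).1 := by
  unfold ordF
  simp only [Rz_and, Rz_all, Rz_imp, Rz_mem, Rz_reindex, Rz_trans]
  refine and_congr Iff.rfl ?_
  exact ⟨fun h z hz => h z (Trans.tr _ _ hz (v 0).2) hz, fun h z _ hz => h z hz⟩

theorem Rz_pow (v : Fin 2 → El M) :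
    Rz M powF v ↔ (v 1).1 = (ZFSet.powerset (v 0).1).sep (· ∈ M) := by
  unfold powF
  simp only [Rz_all, Rz_iff, Rz_mem, Rz_reindex, Rz_sub]
  constructor
  · intro h
    ext z
    rw [ZFSet.mem_sep, ZFSet.mem_powerset]
    constructor
    · intro hz
      have := (Trans.tr _ _ hz (v 1).2)
      exact ⟨(h z this).1 hz, this⟩
    · intro hz
      exact (h z hz.2).2 hz.1
  · intro h z hz
    change z ∈ (v 1).1 ↔ z ⊆ (v 0).1
    rw [h, ZFSet.mem_sep, ZFSet.mem_powerset, and_iff_left hz]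

theorem om_char (x : ZFSet.{u}) : x = om ↔ (IsOrd x ∧ ∅ ∈ x) ∧ (∀ y ∈ x, insert y y ∈ x) ∧
    ∀ y ∈ x, y = ∅ ∨ ∃ z ∈ y, y = insert z z := by
  have nt : ∀ n, (nat.{u} n).IsTransitive := by
    intro n
    induction n with
    | zero => exact ZFSet.isTransitive_empty
    | succ n ih =>
      intro y hy z hz
      rw [nat, ZFSet.mem_insert_iff] at *
      rcases hy with rfl | hy
      · exact Or.inr hz
      · exact Or.inr (ih y hy hz)
  have nm : ∀ n, ∀ y ∈ nat.{u} n, ∃ m, nat m = y := by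
    intro n
    induction n with
    | zero => intro y hy; exact absurd hy (ZFSet.notMem_empty _)
    | succ n ih =>
      intro y hy
      rw [nat, ZFSet.mem_insert_iff] at hy
      rcases hy with rfl | hy
      · exact ⟨n, rfl⟩
      · exact ih y hy
  constructor
  · rintro rfl
    refine ⟨⟨⟨?_, ?_⟩, nat_mem_om 0⟩, ?_, ?_⟩
    · intro y hy z hz
      obtain ⟨n, rfl⟩ := mem_om.1 hy
      exact mem_om.2 (nm n z hz)
    · intro y hy
      obtain ⟨n, rfl⟩ := mem_om.1 hy
      exact nt n
    · intro y hy
      obtain ⟨n, rfl⟩ := mem_om.1 hy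
      exact nat_mem_om (n+1)
    · intro y hy
      obtain ⟨n, rfl⟩ := mem_om.1 hy
      cases n with
      | zero => exact Or.inl rfl
      | succ n => exact Or.inr ⟨nat n, by simp [nat], rfl⟩
  · rintro ⟨⟨⟨ht, _⟩, h0⟩, hs, hp⟩
    ext y
    constructor
    · intro hy
      induction y using ZFSet.inductionOn with
      | h y ih =>
      rcases hp y hy with rfl | ⟨z, hz, rfl⟩
      · exact nat_mem_om 0
      · obtain ⟨n, hn⟩ := mem_om.1 (ih z hz (ht _ hy hz))
        rw [← hn]; exact nat_mem_om (n+1)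
    · intro hy
      obtain ⟨n, rfl⟩ := mem_om.1 hy
      induction n with
      | zero => exact h0
      | succ n ih => exact hs _ (ih (nat_mem_om n))

theorem Rz_omega (v : Fin 1 → El M) : Rz M omegaF v ↔ (v 0).1 = om := by
  rw [om_char]
  unfold omegaF
  simp only [Rz_and, Rz_or, Rz_ex, Rz_all, Rz_imp, Rz_mem, Rz_reindex, Rz_ord, Rz_empty, Rz_succ]
  refine and_congr (and_congr Iff.rfl ?_) (and_congr ?_ ?_)
  · constructor
    · rintro ⟨x, hx, h1, h2⟩
      change x ∈ (v 0).1 at h1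
      change x = _ at h2
      rwa [h2] at h1
    · intro h
      exact ⟨∅, Trans.tr _ _ h (v 0).2, h, rfl⟩
  · constructor
    · intro h y hy
      obtain ⟨z, hz, h1, h2⟩ := h y (Trans.tr _ _ hy (v 0).2) hy
      change z ∈ (v 0).1 at h1
      change z = insert y y at h2
      rwa [h2] at h1
    · intro h y _ hy
      exact ⟨insert y y, Trans.tr _ _ (h y hy) (v 0).2, h y hy, rfl⟩
  · constructor
    · intro h y hy
      refine (h y (Trans.tr _ _ hy (v 0).2) hy).imp id ?_
      rintro ⟨z, hz, h1, h2⟩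
      exact ⟨z, h1, h2⟩
    · intro h y hyM hy
      refine (h y hy).imp id ?_
      rintro ⟨z, h1, h2⟩
      exact ⟨z, Trans.tr _ _ h1 hyM, h1, h2⟩

end base

section tp
variable {M : ZFSet.{u}} [TP M]

theorem TP.single {x : ZFSet.{u}} (hx : x ∈ M) : ({x} : ZFSet.{u}) ∈ M := by
  have := TP.pr x x hx hx
  rwa [ZFSet.pair_eq_singleton] at this

theorem TP.pair {x y : ZFSet.{u}} (hx : x ∈ M) (hy : y ∈ M) : ZFSet.pair x y ∈ M :=
  TP.pr _ _ (TP.single hx) (TP.pr _ _ hx hy)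

theorem Rz_op (v : Fin 3 → El M) : Rz M opF v ↔ (v 2).1 = ZFSet.pair (v 0).1 (v 1).1 := by
  unfold opF
  simp only [Rz_all, Rz_iff, Rz_or, Rz_mem, Rz_reindex, Rz_sing, Rz_pairSet]
  constructor
  · intro h
    ext z
    rw [ZFSet.pair, ZFSet.mem_pair]
    constructor
    · intro hz; exact (h z (Trans.tr _ _ hz (v 2).2)).1 hz
    · intro hz
      have : z ∈ M := by
        rcases hz with rfl | rfl
        exacts [TP.single (v 0).2, TP.pr _ _ (v 0).2 (v 1).2]
      exact (h z this).2 hz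
  · intro h z hz
    change z ∈ (v 2).1 ↔ z = {(v 0).1} ∨ z = {(v 0).1, (v 1).1}
    rw [h, ZFSet.pair, ZFSet.mem_pair]

theorem Rz_relMem (v : Fin 3 → El M) :
    Rz M relMemF v ↔ ZFSet.pair (v 0).1 (v 1).1 ∈ (v 2).1 := by
  unfold relMemF
  simp only [Rz_ex, Rz_and, Rz_mem, Rz_reindex, Rz_op]
  constructor
  · rintro ⟨x, hx, h1, h2⟩
    change x = ZFSet.pair (v 0).1 (v 1).1 at h1
    rw [← h1]; exact h2
  · intro h
    exact ⟨_, Trans.tr _ _ h (v 2).2, rfl, h⟩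

theorem Rz_total (v : Fin 3 → El M) :
    Rz M (((memf 3 0).imp ((andF (memf 4 1) (reindex ![3, 4, 2] relMemF)).ex)).all) v ↔
      ∀ x ∈ (v 0).1, ∃ y ∈ (v 1).1, ZFSet.pair x y ∈ (v 2).1 := by
  simp only [Rz_ex, Rz_all, Rz_imp, Rz_and, Rz_mem, Rz_reindex, Rz_relMem]
  constructor
  · intro h x hx
    obtain ⟨y, hy, h1, h2⟩ := h x (Trans.tr _ _ hx (v 0).2) hx
    exact ⟨y, h1, h2⟩
  · intro h x _ hx
    obtain ⟨y, h1, h2⟩ := h x hx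
    exact ⟨y, Trans.tr _ _ h1 (v 1).2, h1, h2⟩

theorem Rz_isFunc (v : Fin 3 → El M) :
    Rz M isFuncF v ↔ IsSurj (v 0).1 (v 1).1 (v 2).1 := by
  unfold isFuncF IsSurj
  rw [Rz_and, Rz_and, Rz_total]
  simp only [Rz_ex, Rz_all, Rz_imp, Rz_and, Rz_mem, Rz_eq, Rz_reindex, Rz_op, Rz_relMem]
  refine and_congr (and_congr ?_ Iff.rfl) (and_congr ?_ ?_)
  · constructor
    · intro h u hu
      obtain ⟨x, hx, y, hy, ⟨h1, h2⟩, h3⟩ := h u (Trans.tr _ _ hu (v 2).2) hu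
      exact ⟨x, h1, y, h2, h3⟩
    · intro h u _ hu
      obtain ⟨x, h1, y, h2, h3⟩ := h u hu
      exact ⟨x, Trans.tr _ _ h1 (v 0).2, y, Trans.tr _ _ h2 (v 1).2, ⟨h1, h2⟩, h3⟩
  · constructor
    · intro h x y y' h1 h2
      exact h x (Trans.fst h1 (v 2).2) y (Trans.snd h1 (v 2).2) y' (Trans.snd h2 (v 2).2) ⟨h1, h2⟩
    · rintro h x _ y _ y' _ ⟨h1, h2⟩
      exact h x y y' h1 h2
  · constructor
    · intro h x hx
      obtain ⟨y, hy, h1, h2⟩ := h x (Trans.tr _ _ hx (v 1).2) hx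
      exact ⟨y, h1, h2⟩
    · intro h x _ hx
      obtain ⟨y, h1, h2⟩ := h x hx
      exact ⟨y, Trans.tr _ _ h1 (v 0).2, h1, h2⟩

theorem Rz_inj (v : Fin 3 → El M) :
    Rz M injF v ↔ ∀ x x' y, ZFSet.pair x y ∈ (v 2).1 → ZFSet.pair x' y ∈ (v 2).1 → x = x' := by
  unfold injF
  simp only [Rz_all, Rz_imp, Rz_and, Rz_eq, Rz_reindex, Rz_relMem]
  constructor
  · intro h x x' y h1 h2
    exact h x (Trans.fst h1 (v 2).2) x' (Trans.fst h2 (v 2).2) y (Trans.snd h1 (v 2).2) ⟨h1, h2⟩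
  · rintro h x _ x' _ y _ ⟨h1, h2⟩
    exact h x x' y h1 h2

theorem Rz_alephOne (v : Fin 2 → El M) : Rz M alephOneF v ↔
    (IsOrd (v 1).1 ∧ ¬ ∃ f ∈ M, IsSurj (v 0).1 (v 1).1 f) ∧
      ∀ x ∈ (v 1).1, x = ∅ ∨ ∃ f ∈ M, IsSurj (v 0).1 x f := by
  unfold alephOneF
  simp only [Rz_ex, Rz_all, Rz_imp, Rz_and, Rz_or, Rz_not, Rz_mem, Rz_reindex, Rz_ord, Rz_isFunc,
    Rz_empty]
  refine and_congr (and_congr Iff.rfl ?_) ?_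
  · refine not_congr ⟨?_, ?_⟩
    · rintro ⟨f, hf, h⟩
      exact ⟨f, hf, h⟩
    · rintro ⟨f, hf, h⟩
      exact ⟨f, hf, h⟩
  · constructor
    · intro h x hx
      refine (h x (Trans.tr _ _ hx (v 1).2) hx).imp id ?_
      rintro ⟨f, hf, h⟩
      exact ⟨f, hf, h⟩
    · intro h x hxM hx
      refine (h x hx).imp id ?_
      rintro ⟨f, hf, h⟩
      exact ⟨f, hf, h⟩

end tp

end CtmForcing

namespace CtmForcing

open FirstOrder FirstOrder.Language


section schemes
variable {M : ZFSet.{u}}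

theorem Rz_sepAx {n : ℕ} (φ : BF (n+1)) : Rz M (sepAx φ : BF 0) Fin.elim0 ↔
    ∀ (v : Fin n → El M), ∀ A ∈ M, ∃ B ∈ M, ∀ x, ∀ hx : x ∈ M,
      (x ∈ B ↔ x ∈ A ∧ Rz M φ (Fin.snoc v ⟨x, hx⟩)) := by
  unfold sepAx
  rw [Rz_alls]
  refine forall_congr' fun v => ?_
  rw [Rz_all]
  refine forall_congr' fun A => forall_congr' fun hA => ?_
  rw [Rz_ex]
  have key : ∀ B, ∀ hB : B ∈ M, (Rz M (iffF (memf ⟨n + 2, by omega⟩ ⟨n + 1, by omega⟩)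
      (andF (memf ⟨n + 2, by omega⟩ ⟨n, by omega⟩)
        (reindex (fun i : Fin (n+1) => if h : (i : ℕ) < n then ⟨i, by omega⟩ else ⟨n + 2, by omega⟩) φ))).all
      (Fin.snoc (Fin.snoc v ⟨A, hA⟩ : Fin (n+1) → El M) ⟨B, hB⟩ : Fin (n+2) → El M) ↔ ∀ x, ∀ hx : x ∈ M,
      (x ∈ B ↔ x ∈ A ∧ Rz M φ (Fin.snoc v ⟨x, hx⟩))) := by
    intro B hB
    rw [Rz_all]
    refine forall_congr' fun x => forall_congr' fun hx => ?_
    rw [Rz_iff, Rz_and, Rz_mem, Rz_mem, Rz_reindex]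
    have e : (fun i => (Fin.snoc (Fin.snoc (Fin.snoc v ⟨A, hA⟩ : Fin (n+1) → El M) ⟨B, hB⟩ : Fin (n+2) → El M)
        ⟨x, hx⟩ : Fin (n+3) → El M)
        ((fun i : Fin (n+1) => if h : (i : ℕ) < n then ⟨i, by omega⟩ else ⟨n + 2, by omega⟩) i)) =
        (Fin.snoc v ⟨x, hx⟩ : Fin (n+1) → El M) := by
      funext i
      by_cases h : (i : ℕ) < n
      · have h1 : (i : ℕ) < n + 1 + 1 := by omega
        have h2 : (i : ℕ) ≤ n := by omega
        simp [Fin.snoc, h, h1, h2]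
      · simp [Fin.snoc, h]
    rw [e]
    simp [Fin.snoc]
  constructor
  · rintro ⟨B, hB, h⟩
    exact ⟨B, hB, (key B hB).1 h⟩
  · rintro ⟨B, hB, h⟩
    exact ⟨B, hB, (key B hB).2 h⟩

theorem Rz_replAx {n : ℕ} (φ : BF (n+2)) : Rz M (replAx φ : BF 0) Fin.elim0 ↔
    ∀ (v : Fin n → El M), ∀ A ∈ M,
      (∀ x, ∀ hx : x ∈ M, ∀ y, ∀ hy : y ∈ M, ∀ y', ∀ hy' : y' ∈ M, x ∈ A →
        Rz M φ (Fin.snoc (Fin.snoc v ⟨x, hx⟩ : Fin (n+1) → El M) ⟨y, hy⟩) →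
        Rz M φ (Fin.snoc (Fin.snoc v ⟨x, hx⟩ : Fin (n+1) → El M) ⟨y', hy'⟩) → y = y') →
      ∃ B ∈ M, ∀ y, ∀ hy : y ∈ M,
      (y ∈ B ↔ ∃ x, ∃ hx : x ∈ M, x ∈ A ∧
        Rz M φ (Fin.snoc (Fin.snoc v ⟨x, hx⟩ : Fin (n+1) → El M) ⟨y, hy⟩)) := by
  unfold replAx
  simp only []
  rw [Rz_alls]
  refine forall_congr' fun v => ?_
  rw [Rz_all]
  refine forall_congr' fun A => forall_congr' fun hA => ?_
  rw [Rz_imp]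
  have key : ∀ (w : Fin (n+4) → El M) (a b : Fin (n+4)), (∀ i : Fin n, w ⟨i, by omega⟩ = v i) →
      (fun i => w ((fun i : Fin (n+2) => if h : (i : ℕ) < n then ⟨i, by omega⟩ else
        if (i : ℕ) = n then a else b) i)) =
      (Fin.snoc (Fin.snoc v (w a) : Fin (n+1) → El M) (w b) : Fin (n+2) → El M) := by
    intro w a b hw
    funext i
    by_cases h : (i : ℕ) < n
    · have h1 : (i : ℕ) < n + 1 := by omega
      simp [Fin.snoc, h, h1]
      exact hw ⟨i, h⟩
    · by_cases h2 : (i : ℕ) = n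
      · simp [Fin.snoc, h2]
      · have : (i : ℕ) = n + 1 := by omega
        simp [Fin.snoc, this]
  refine imp_congr ?_ ?_
  · simp only [Rz_all, Rz_imp, Rz_and, Rz_mem, Rz_eq, Rz_reindex]
    refine forall_congr' fun x => forall_congr' fun hx => forall_congr' fun y =>
      forall_congr' fun hy => forall_congr' fun y' => forall_congr' fun hy' => ?_
    rw [key _ _ _ (by intro i; have : (i:ℕ) < n+1+1+1 := by omega
                      have : (i:ℕ) < n+1+1 := by omega
                      have : (i:ℕ) < n+1 := by omega
                      simp [Fin.snoc, *]),
      key _ _ _ (by intro i; have : (i:ℕ) < n+1+1+1 := by omega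
                    have : (i:ℕ) < n+1+1 := by omega
                    have : (i:ℕ) < n+1 := by omega
                    simp [Fin.snoc, *])]
    have : n ≤ n + 1 + 1 := by omega
    simp [Fin.snoc, this]
  · rw [Rz_ex]
    have key2 : ∀ B, ∀ hB : B ∈ M, (Rz M (iffF (memf ⟨n + 2, by omega⟩ ⟨n + 1, by omega⟩)
        ((andF (memf ⟨n + 3, by omega⟩ ⟨n, by omega⟩)
        (reindex (fun i : Fin (n+2) => if h : (i : ℕ) < n then ⟨i, by omega⟩ else
        if (i : ℕ) = n then ⟨n+3, by omega⟩ else ⟨n+2, by omega⟩) φ)).ex)).all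
        (Fin.snoc (Fin.snoc v ⟨A, hA⟩ : Fin (n+1) → El M) ⟨B, hB⟩ : Fin (n+2) → El M) ↔
        ∀ y, ∀ hy : y ∈ M, (y ∈ B ↔ ∃ x, ∃ hx : x ∈ M, x ∈ A ∧
        Rz M φ (Fin.snoc (Fin.snoc v ⟨x, hx⟩ : Fin (n+1) → El M) ⟨y, hy⟩))) := by
      intro B hB
      rw [Rz_all]
      refine forall_congr' fun y => forall_congr' fun hy => ?_
      rw [Rz_iff, Rz_ex, Rz_mem]
      refine iff_congr (by simp [Fin.snoc]) (exists_congr fun x => exists_congr fun hx => ?_)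
      rw [Rz_and, Rz_mem, Rz_reindex]
      have := key (Fin.snoc (Fin.snoc (Fin.snoc (Fin.snoc v ⟨A, hA⟩ : Fin (n+1) → El M) ⟨B, hB⟩ : Fin (n+2) → El M)
        ⟨y, hy⟩ : Fin (n+3) → El M) ⟨x, hx⟩) ⟨n+3, by omega⟩ ⟨n+2, by omega⟩ (by
        intro i
        have : (i:ℕ) < n+1+1+1 := by omega
        have : (i:ℕ) < n+1+1 := by omega
        have : (i:ℕ) < n+1 := by omega
        simp [Fin.snoc, *])
      simp only [] at this
      rw [this]
      have : n ≤ n + 1 + 1 := by omega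
      simp [Fin.snoc, this]
    constructor
    · rintro ⟨B, hB, h⟩
      exact ⟨B, hB, (key2 B hB).1 h⟩
    · rintro ⟨B, hB, h⟩
      exact ⟨B, hB, (key2 B hB).2 h⟩
end schemes

class ZFM (M : ZFSet.{u}) : Prop extends TP M where
  un : ∀ x ∈ M, ZFSet.sUnion x ∈ M
  pw : ∀ x ∈ M, (ZFSet.powerset x).sep (· ∈ M) ∈ M
  omM : om ∈ M
  sp : ∀ (P : ZFSet.{u} → Prop) (A : ZFSet.{u}), Def M (fun e => P (e 0)) → A ∈ M → ZFSet.sep P A ∈ M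
  rp : ∀ (R : ZFSet.{u} → ZFSet.{u} → Prop) (A : ZFSet.{u}), Def M (fun e => R (e 0) (e 1)) → A ∈ M →
    (∀ x ∈ A, ∀ y ∈ M, ∀ y' ∈ M, R x y → R x y' → y = y') →
    ∃ B ∈ M, ∀ y, y ∈ B ↔ y ∈ M ∧ ∃ x ∈ A, R x y

def ACM (M : ZFSet.{u}) : Prop := ∀ x ∈ M, ∃ α ∈ M, ∃ f ∈ M, IsOrd α ∧ IsSurj α x f

theorem sep_of_models {M : ZFSet.{u}} [Trans M] (h : ZModels M sepScheme) 
    (P : ZFSet.{u} → Prop) (A : ZFSet.{u}) (hP : Def M (fun e => P (e 0))) (hA : A ∈ M) :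
    ZFSet.sep P A ∈ M := by
  obtain ⟨n, φ, t, ht⟩ := hP
  have := h (sepAx (n := n) (reindex (fun i => if (t i).isLeft then Fin.last n else Fin.castSucc i) φ))
    ⟨⟨n, _⟩, rfl⟩
  rw [Rz_sent, Rz_sepAx] at this
  obtain ⟨B, hB, h2⟩ := this (fun i => Sum.elim (fun _ => ⟨A, hA⟩) id (t i)) A hA
  have : ZFSet.sep P A = B := by
    ext x
    have : x ∈ M → (x ∈ B ↔ x ∈ A ∧ P x) := by
      intro hx
      rw [h2 x hx, Rz_reindex]
      have := ht (fun _ => ⟨x, hx⟩)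
      have e : (fun i => (Fin.snoc (fun i => Sum.elim (fun _ => (⟨A, hA⟩ : El M)) id (t i)) ⟨x, hx⟩ : Fin (n+1) → El M)
        (if (t i).isLeft then Fin.last n else Fin.castSucc i)) =
        fun i => Sum.elim (fun _ => ⟨x, hx⟩) id (t i) := by
        funext i
        rcases hti : t i with j | c
        · simp
        · simp [hti]
      rw [e, ← this]
    rw [ZFSet.mem_sep]
    constructor
    · rintro ⟨h3, h4⟩
      exact (this (Trans.tr _ _ h3 hA)).2 ⟨h3, h4⟩
    · intro h3
      exact (this (Trans.tr _ _ h3 hB)).1 h3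
  rw [this]; exact hB

theorem repl_of_models {M : ZFSet.{u}} [Trans M] (h : ZModels M replScheme) 
    (R : ZFSet.{u} → ZFSet.{u} → Prop) (A : ZFSet.{u}) (hR : Def M (fun e => R (e 0) (e 1))) (hA : A ∈ M)
    (hf : ∀ x ∈ A, ∀ y ∈ M, ∀ y' ∈ M, R x y → R x y' → y = y') :
    ∃ B ∈ M, ∀ y, y ∈ B ↔ y ∈ M ∧ ∃ x ∈ A, R x y := by
  obtain ⟨n, φ, t, ht⟩ := hR
  have := h (replAx (n := n) (reindex (fun i => Sum.elim (fun j => if j = 0 then (Fin.last n).castSucc else Fin.last (n+1))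
      (fun _ => i.castSucc.castSucc) (t i)) φ))
    ⟨⟨n, _⟩, rfl⟩
  rw [Rz_sent, Rz_replAx] at this
  have key : ∀ x, ∀ hx : x ∈ M, ∀ y, ∀ hy : y ∈ M, (Rz M (reindex (fun i => Sum.elim (fun j => if j = 0 then (Fin.last n).castSucc else Fin.last (n+1))
      (fun _ => i.castSucc.castSucc) (t i)) φ) 
        (Fin.snoc (Fin.snoc (fun i => Sum.elim (fun _ => ⟨A, hA⟩) id (t i)) ⟨x, hx⟩ : Fin (n+1) → El M) ⟨y, hy⟩) ↔ R x y) := by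
    intro x hx y hy
    rw [Rz_reindex]
    refine Iff.trans ?_ (ht (fun j => if j = 0 then ⟨x, hx⟩ else ⟨y, hy⟩)).symm
    rw [iff_eq_eq]; congr 1
    funext i
    rcases hti : t i with j | c
    · by_cases hj : j = 0
      · simp [hj]
      · simp [hj]
    · simp [hti]
  obtain ⟨B, hB, h2⟩ := this (fun i => Sum.elim (fun _ => ⟨A, hA⟩) id (t i)) A hA (by
    intro x hx y hy y' hy' hxA h1 h2
    rw [key] at h1 h2
    exact hf x hxA y hy y' hy' h1 h2)
  refine ⟨B, hB, fun y => ⟨fun hy => ?_, ?_⟩⟩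
  · have hyM := Trans.tr _ _ hy hB
    obtain ⟨x, hx, h3, h4⟩ := (h2 y hyM).1 hy
    exact ⟨hyM, x, h3, (key _ _ _ _).1 h4⟩
  · rintro ⟨hy, x, hx, h4⟩
    exact (h2 y hy).2 ⟨x, Trans.tr _ _ hx hA, hx, (key _ _ _ _).2 h4⟩

theorem Rz_pairAx {M : ZFSet.{u}} [Trans M] : Rz M (pairAx : BF 0) Fin.elim0 ↔
    ∀ x ∈ M, ∀ y ∈ M, ({x, y} : ZFSet.{u}) ∈ M := by
  unfold pairAx
  simp only [Rz_all, Rz_ex, Rz_pairSet]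
  refine forall_congr' fun x => forall_congr' fun hx => forall_congr' fun y => forall_congr' fun hy => ?_
  constructor
  · rintro ⟨z, hz, h⟩
    change z = {x, y} at h
    rwa [← h]
  · intro h
    exact ⟨_, h, rfl⟩

theorem Rz_powAx {M : ZFSet.{u}} [Trans M] : Rz M (powAx : BF 0) Fin.elim0 ↔
    ∀ x ∈ M, (ZFSet.powerset x).sep (· ∈ M) ∈ M := by
  unfold powAx
  simp only [Rz_all, Rz_ex, Rz_pow]
  refine forall_congr' fun x => forall_congr' fun hx => ?_
  constructor
  · rintro ⟨z, hz, h⟩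
    change z = (ZFSet.powerset x).sep (· ∈ M) at h
    rwa [← h]
  · intro h
    exact ⟨_, h, rfl⟩

theorem Rz_unionAx {M : ZFSet.{u}} [Trans M] : Rz M (unionAx : BF 0) Fin.elim0 ↔
    ∀ x ∈ M, ZFSet.sUnion x ∈ M := by
  unfold unionAx
  simp only [Rz_all, Rz_ex, Rz_iff, Rz_and, Rz_mem]
  refine forall_congr' fun x => forall_congr' fun hx => ?_
  constructor
  · rintro ⟨z, hz, h⟩
    have h : ∀ a ∈ M, (a ∈ z ↔ ∃ b, ∃ _ : b ∈ M, b ∈ x ∧ a ∈ b) := h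
    have : ZFSet.sUnion x = z := by
      ext a
      rw [ZFSet.mem_sUnion]
      constructor
      · rintro ⟨b, hb, ha⟩
        have hbM := Trans.tr _ _ hb hx
        exact (h a (Trans.tr _ _ ha hbM)).2 ⟨b, hbM, hb, ha⟩
      · intro ha
        obtain ⟨b, _, hb, hab⟩ := (h a (Trans.tr _ _ ha hz)).1 ha
        exact ⟨b, hb, hab⟩
    rwa [this]
  · intro h
    refine ⟨_, h, ?_⟩
    show ∀ a ∈ M, (a ∈ ZFSet.sUnion x ↔ ∃ b, ∃ _ : b ∈ M, b ∈ x ∧ a ∈ b)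
    intro a _
    rw [ZFSet.mem_sUnion]
    constructor
    · rintro ⟨b, hb, ha⟩
      have hbM := Trans.tr _ _ hb hx
      exact ⟨b, hbM, hb, ha⟩
    · rintro ⟨b, _, hb, ha⟩
      exact ⟨b, hb, ha⟩

theorem Rz_infAx {M : ZFSet.{u}} [Trans M] : Rz M (infAx : BF 0) Fin.elim0 ↔
    ∃ I ∈ M, ∅ ∈ I ∧ ∀ x ∈ I, insert x x ∈ I := by
  unfold infAx
  simp only [Rz_all, Rz_ex, Rz_imp, Rz_and, Rz_mem, Rz_reindex, Rz_empty, Rz_succ]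
  constructor
  · rintro ⟨I, hI, ⟨x, hx, h1, h2⟩, h3⟩
    refine ⟨I, hI, ?_, ?_⟩
    · change x ∈ I at h1
      change x = ∅ at h2
      rwa [h2] at h1
    · intro x hx
      obtain ⟨y, hy, h1, h2⟩ := h3 x (Trans.tr _ _ hx hI) hx
      change y ∈ I at h1
      change y = insert x x at h2
      rwa [h2] at h1
  · rintro ⟨I, hI, h1, h2⟩
    refine ⟨I, hI, ⟨∅, Trans.tr _ _ h1 hI, h1, rfl⟩, fun x hx hxI => ?_⟩
    exact ⟨_, Trans.tr _ _ (h2 x hxI) hI, h2 x hxI, rfl⟩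

theorem Rz_acAx {M : ZFSet.{u}} [TP M] : Rz M (acAx : BF 0) Fin.elim0 ↔ ACM M := by
  unfold acAx ACM
  simp only [Rz_all, Rz_ex, Rz_and, Rz_reindex, Rz_ord, Rz_isFunc]
  refine forall_congr' fun x => forall_congr' fun hx => ?_
  constructor
  · rintro ⟨a, ha, f, hf, h1, h2⟩
    exact ⟨a, ha, f, hf, h1, h2⟩
  · rintro ⟨a, ha, f, hf, h1, h2⟩
    exact ⟨a, ha, f, hf, h1, h2⟩

instance Def.ord {M : ZFSet.{u}} [Trans M] {a : (ℕ → ZFSet.{u}) → ZFSet.{u}} [ha : Tm M a] :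
    Def M (fun e => IsOrd (a e)) :=
  Def.app1 (Def.ofRz ordF (fun e => by rw [Rz_ord]; rfl)) ha

instance Def.isSurj {M : ZFSet.{u}} [TP M] {a b c : (ℕ → ZFSet.{u}) → ZFSet.{u}} [ha : Tm M a]
    [hb : Tm M b] [hc : Tm M c] : Def M (fun e => IsSurj (a e) (b e) (c e)) :=
  Def.app3 (Def.ofRz isFuncF (fun e => by rw [Rz_isFunc]; rfl)) ha hb hc

theorem Def.eqSucc {M : ZFSet.{u}} [Trans M] : Def M (fun e => e 0 = insert (e 1) (e 1)) :=
  Def.app2 (R := fun b a => a = insert b b) (Def.ofRz succF (fun e => by rw [Rz_succ]; rfl))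
    (tmVar 1) (tmVar 0)

instance Def.eqSucc' {M : ZFSet.{u}} [Trans M] {a b : (ℕ → ZFSet.{u}) → ZFSet.{u}} [ha : Tm M a]
    [hb : Tm M b] : Def M (fun e => b e = insert (a e) (a e)) :=
  Def.app2 (R := fun b a => b = insert a a) Def.eqSucc hb ha

instance Def.eqEmpty {M : ZFSet.{u}} [Trans M] {a : (ℕ → ZFSet.{u}) → ZFSet.{u}} [ha : Tm M a] :
    Def M (fun e => a e = ∅) :=
  Def.app1 (R := fun a => a = ∅) (Def.ofRz emptyF (fun e => by rw [Rz_empty]; rfl)) ha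

theorem Tm.congr {M : ZFSet.{u}} {f g : (ℕ → ZFSet.{u}) → ZFSet.{u}} (h : Tm M f)
    (hh : ∀ e : ℕ → ZFSet.{u}, (∀ i, e i ∈ M) → g e = f e) : Tm M g :=
  ⟨fun e he => by rw [hh e he]; exact h.memM e he,
    h.gr.congr (fun e he => by rw [hh _ (fun i => he (i+1))])⟩

theorem Tm.sub1 {M : ZFSet.{u}} {F : (ℕ → ZFSet.{u}) → ZFSet.{u} → ZFSet.{u}}
    (h : Tm M (fun e => F (fun n => e (n+1)) (e 0))) {a : (ℕ → ZFSet.{u}) → ZFSet.{u}}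
    (ha : Tm M a) : Tm M (fun e => F e (a e)) :=
  ⟨fun e he => h.memM (fun n => Nat.casesOn n (a e) e) (fun n => by
      cases n with
      | zero => exact ha.memM e he
      | succ n => exact he n),
    Def.sub1 (R := fun e x => e 0 = F (fun n => e (n+1)) x) (h.gr.ren (fun n => Nat.casesOn n 1
      (fun n => Nat.casesOn n 0 (fun n => n + 2)))) ha.shift⟩

theorem Tm.app1 {M : ZFSet.{u}} {F : ZFSet.{u} → ZFSet.{u}} (h : Tm M (fun e => F (e 0)))
    {a : (ℕ → ZFSet.{u}) → ZFSet.{u}} (ha : Tm M a) : Tm M (fun e => F (a e)) :=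
  Tm.sub1 (F := fun _ x => F x) h ha

theorem Tm.app2 {M : ZFSet.{u}} {F : ZFSet.{u} → ZFSet.{u} → ZFSet.{u}} (h : Tm M (fun e => F (e 0) (e 1)))
    {a b : (ℕ → ZFSet.{u}) → ZFSet.{u}} (ha : Tm M a) (hb : Tm M b) : Tm M (fun e => F (a e) (b e)) :=
  Tm.sub1 (F := fun e x => F x (b e)) (Tm.sub1 (F := fun e y => F (e 0) y)
    (h.ren (fun n => Nat.casesOn n 1 (fun _ => 0))) hb.shift) ha

instance tmPair {M : ZFSet.{u}} [TP M] {a b : (ℕ → ZFSet.{u}) → ZFSet.{u}} [ha : Tm M a]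
    [hb : Tm M b] : Tm M (fun e => ZFSet.pair (a e) (b e)) :=
  Tm.app2 ⟨fun e he => TP.pair (he 0) (he 1), Def.app3 (R := fun x y z => z = ZFSet.pair x y)
    (Def.ofRz opF (fun e => by rw [Rz_op]; rfl)) (tmVar 1) (tmVar 2) (tmVar 0)⟩ ha hb

instance tmUpair {M : ZFSet.{u}} [TP M] {a b : (ℕ → ZFSet.{u}) → ZFSet.{u}} [ha : Tm M a]
    [hb : Tm M b] : Tm M (fun e => {a e, b e}) :=
  Tm.app2 (F := fun x y => {x, y}) ⟨fun e he => TP.pr _ _ (he 0) (he 1), Def.app3 (R := fun x y z => z = {x, y})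
    (Def.ofRz pairSetF (fun e => by rw [Rz_pairSet]; rfl)) (tmVar 1) (tmVar 2) (tmVar 0)⟩ ha hb

instance tmSing {M : ZFSet.{u}} [TP M] {a : (ℕ → ZFSet.{u}) → ZFSet.{u}} [ha : Tm M a]
    : Tm M (fun e => {a e}) :=
  Tm.app1 (F := fun x => {x}) ⟨fun e he => TP.single (he 0), Def.app2 (R := fun x z => z = {x})
    (Def.ofRz singF (fun e => by rw [Rz_sing]; rfl)) (tmVar 1) (tmVar 0)⟩ ha

theorem ZFM.of_models {M : ZFSet.{u}} (ht : M.IsTransitive) (h : ZModels M ZFC) : ZFM M ∧ ACM M := by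
  have : Trans M := ⟨fun x y hx hy => ht y hy hx⟩
  have hfin : ∀ φ ∈ zfFin, Rz M (φ : BF 0) Fin.elim0 := fun φ hφ =>
    (Rz_sent φ).1 (h φ (Or.inl (Or.inl (Or.inl hφ))))
  have hpair := Rz_pairAx.1 (hfin pairAx (by simp [zfFin]))
  have : TP M := ⟨fun x y hx hy => hpair x hx y hy⟩
  have hsp := sep_of_models (M := M) (fun φ hφ => h φ (Or.inl (Or.inl (Or.inr hφ))))
  have hrp := repl_of_models (M := M) (fun φ hφ => h φ (Or.inl (Or.inr hφ)))
  refine ⟨⟨Rz_unionAx.1 (hfin unionAx (by simp [zfFin])), Rz_powAx.1 (hfin powAx (by simp [zfFin])),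
    ?_, hsp, hrp⟩, Rz_acAx.1 ((Rz_sent _).1 (h _ (Or.inr rfl)))⟩
  obtain ⟨I, hI, h0, hs⟩ := Rz_infAx.1 (hfin infAx (by simp [zfFin]))
  have hsub : ∀ n, nat n ∈ I := by
    intro n
    induction n with
    | zero => exact h0
    | succ n ih => exact hs _ ih
  have hc : om = ZFSet.sep (fun x => IsOrd x ∧ (x = ∅ ∨ ∃ z ∈ x, x = insert z z) ∧
      ∀ y ∈ x, (y = ∅ ∨ ∃ z ∈ y, y = insert z z)) I := by
    ext x
    rw [ZFSet.mem_sep]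
    obtain ⟨⟨⟨ho1, ho2⟩, _⟩, _, ho3⟩ := (om_char om).1 rfl
    constructor
    · intro hx
      refine ⟨?_, ⟨ho2 x hx, fun y hy => ho2 y (ho1 x hx hy)⟩, ho3 x hx, fun y hy => ho3 y (ho1 x hx hy)⟩
      obtain ⟨n, rfl⟩ := mem_om.1 hx
      exact hsub n
    · rintro ⟨-, h⟩
      induction x using ZFSet.inductionOn with
      | h x ih =>
      obtain ⟨h1, h2, h3⟩ := h
      rcases h2 with rfl | ⟨z, hz, hx⟩
      · exact nat_mem_om 0
      · have : z ∈ om := ih z hz ⟨⟨h1.2 z hz, fun y hy => h1.2 y (h1.1 z hz hy)⟩, h3 z hz,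
          fun y hy => h3 y (h1.1 z hz hy)⟩
        obtain ⟨n, rfl⟩ := mem_om.1 this
        rw [hx]; exact nat_mem_om (n+1)
  rw [hc]
  exact hsp _ _ inferInstance hI

theorem ZFM.models {N : ZFSet.{u}} [ZFM N] (hac : ACM N) : ZModels N ZFC := by
  rintro φ (((hφ | ⟨⟨n, ψ⟩, rfl⟩) | ⟨⟨n, ψ⟩, rfl⟩) | rfl)
  · rw [Rz_sent]
    rcases hφ with rfl | rfl | rfl | rfl | rfl | rfl
    · unfold extAx
      simp only [Rz_all, Rz_imp, Rz_and, Rz_eq, Rz_reindex, Rz_sub]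
      intro x _ y _ h
      exact ZFSet.ext fun z => ⟨fun hz => h.1 hz, fun hz => h.2 hz⟩
    · unfold foundAx
      simp only [Rz_all, Rz_imp, Rz_and, Rz_mem, Rz_ex, Rz_not]
      rintro x hx ⟨y, _, hy⟩
      have : x ≠ ∅ := by rintro rfl; exact ZFSet.notMem_empty _ hy
      obtain ⟨z, hz, h⟩ := ZFSet.regularity x this
      refine ⟨z, Trans.tr _ _ hz hx, hz, fun w _ hw hwz => ?_⟩
      have : w ∈ x ∩ z := ZFSet.mem_inter.2 ⟨hw, hwz⟩
      rw [h] at this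
      exact ZFSet.notMem_empty _ this
    · exact Rz_pairAx.2 fun x hx y hy => TP.pr x y hx hy
    · exact Rz_unionAx.2 ZFM.un
    · exact Rz_powAx.2 ZFM.pw
    · obtain ⟨⟨_, h1⟩, h2, _⟩ := (om_char om).1 rfl
      exact Rz_infAx.2 ⟨om, ZFM.omM, h1, h2⟩
  · rw [Rz_sent, Rz_sepAx]
    intro v A hA
    refine ⟨ZFSet.sep (fun x => ∃ hx : x ∈ N, Rz N ψ (Fin.snoc v ⟨x, hx⟩)) A, ZFM.sp _ _ ?_ hA, ?_⟩
    · refine ⟨n+1, ψ, Fin.snoc (fun i => Sum.inr (v i)) (Sum.inl 0), fun e => ?_⟩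
      have : (fun i => Sum.elim e id ((Fin.snoc (fun i => Sum.inr (v i)) (Sum.inl 0) : Fin (n+1) → ℕ ⊕ El N) i)) =
        (Fin.snoc v (e 0) : Fin (n+1) → El N) := by
        funext i
        refine Fin.lastCases ?_ (fun i => ?_) i <;> simp
      rw [this]
      exact ⟨fun ⟨_, h⟩ => h, fun h => ⟨(e 0).2, h⟩⟩
    · intro x hx
      rw [ZFSet.mem_sep]
      exact and_congr Iff.rfl ⟨fun ⟨_, h⟩ => h, fun h => ⟨_, h⟩⟩
  · rw [Rz_sent, Rz_replAx]
    intro v A hA hf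
    obtain ⟨B, hB, h⟩ := ZFM.rp (M := N) (fun x y => ∃ hx : x ∈ N, ∃ hy : y ∈ N, 
      Rz N ψ (Fin.snoc (Fin.snoc v ⟨x, hx⟩ : Fin (n+1) → El N) ⟨y, hy⟩)) A (by
        refine ⟨n+2, ψ, Fin.snoc (Fin.snoc (fun i => Sum.inr (v i)) (Sum.inl 0) : Fin (n+1) → ℕ ⊕ El N) (Sum.inl 1), fun e => ?_⟩
        have : (fun i => Sum.elim e id ((Fin.snoc (Fin.snoc (fun i => Sum.inr (v i)) (Sum.inl 0) : Fin (n+1) → ℕ ⊕ El N) (Sum.inl 1)  : Fin (n+2) → ℕ ⊕ El N) i)) =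
          (Fin.snoc (Fin.snoc v (e 0) : Fin (n+1) → El N) (e 1) : Fin (n+2) → El N) := by
          funext i
          refine Fin.lastCases ?_ (fun i => ?_) i
          · simp
          · refine Fin.lastCases ?_ (fun i => ?_) i <;> simp
        rw [this]
        exact ⟨fun ⟨_, _, h⟩ => h, fun h => ⟨(e 0).2, (e 1).2, h⟩⟩) hA (by
        rintro x hx y _ y' _ ⟨_, _, h1⟩ ⟨_, _, h2⟩
        exact hf x _ y _ y' _ hx h1 h2)
    refine ⟨B, hB, fun y hy => ?_⟩
    rw [h]
    constructor
    · rintro ⟨_, x, hx, hxN, _, h⟩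
      exact ⟨x, hxN, hx, h⟩
    · rintro ⟨x, hxN, hx, h⟩
      exact ⟨hy, x, hx, hxN, hy, h⟩
  · rw [Rz_sent]; exact Rz_acAx.2 hac

end CtmForcing

namespace CtmForcing

open FirstOrder FirstOrder.Language


/-- image of a set under a class function -/
noncomputable def im (F : ZFSet.{u} → ZFSet.{u}) (A : ZFSet.{u}) : ZFSet.{u} :=
  @ZFSet.image F (Classical.allZFSetDefinable _) A

theorem mem_im {F : ZFSet.{u} → ZFSet.{u}} {A y : ZFSet.{u}} : y ∈ im F A ↔ ∃ x ∈ A, F x = y := by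
  unfold im
  rw [@ZFSet.mem_image F (Classical.allZFSetDefinable _)]

theorem im_congr {F G : ZFSet.{u} → ZFSet.{u}} {A : ZFSet.{u}} (h : ∀ x ∈ A, F x = G x) :
    im F A = im G A := by
  ext y
  rw [mem_im, mem_im]
  exact exists_congr fun x => and_congr_right fun hx => by rw [h x hx]

noncomputable def powM (M x : ZFSet.{u}) : ZFSet.{u} := (ZFSet.powerset x).sep (· ∈ M)

section
variable {M : ZFSet.{u}}

theorem Tm.mem1 {F : ZFSet.{u} → ZFSet.{u}} (h : Tm M (fun e => F (e 0))) {x : ZFSet.{u}} (hx : x ∈ M) :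
    F x ∈ M := h.memM (fun _ => x) (fun _ => hx)

theorem Def.freeze {R : (ℕ → ZFSet.{u}) → Prop} (h : Def M R) (s : ℕ → ℕ ⊕ El M) :
    Def M (fun e => R (fun n => Sum.elim e Subtype.val (s n))) := by
  obtain ⟨n, φ, t, h⟩ := h
  refine ⟨n, φ, fun i => Sum.elim s Sum.inr (t i), fun e => ?_⟩
  have := h (fun n => Sum.elim e id (s n))
  have e1 : (fun n => Sum.elim (fun i => (e i).1) Subtype.val (s n)) = fun n => (Sum.elim e id (s n)).1 := by
    funext n; rcases s n with j | c <;> rfl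
  simp only [] at this ⊢
  rw [e1, this]
  rw [iff_eq_eq]; congr 1; funext i
  rcases hti : t i with j | c <;> simp [hti]

theorem Def.fix1 {R : (ℕ → ZFSet.{u}) → ZFSet.{u} → Prop}
    (h : Def M (fun e => R (fun n => e (n+1)) (e 0))) (e : ℕ → ZFSet.{u}) (he : ∀ i, e i ∈ M) :
    Def M (fun e' => R e (e' 0)) :=
  h.freeze (fun n => match n with | 0 => Sum.inl 0 | (n+1) => Sum.inr ⟨e n, he n⟩)

theorem Def.fix2 {R : (ℕ → ZFSet.{u}) → ZFSet.{u} → ZFSet.{u} → Prop}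
    (h : Def M (fun e => R (fun n => e (n+2)) (e 1) (e 0))) (e : ℕ → ZFSet.{u}) (he : ∀ i, e i ∈ M) :
    Def M (fun e' => R e (e' 0) (e' 1)) :=
  h.freeze (fun n => match n with | 0 => Sum.inl 1 | 1 => Sum.inl 0 | (n+2) => Sum.inr ⟨e n, he n⟩)

theorem Tm.ofMem [Trans M] {f : (ℕ → ZFSet.{u}) → ZFSet.{u}}
    (hm : ∀ e : ℕ → ZFSet.{u}, (∀ i, e i ∈ M) → f e ∈ M)
    (hd : Def M (fun e => e 0 ∈ f (fun n => e (n+1)))) : Tm M f := by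
  refine ⟨hm, Def.congr (R := fun e => ∀ z, z ∈ M → (z ∈ e 0 ↔ z ∈ f (fun n => e (n+1)))) ?_ ?_⟩
  · exact @Def.all _ (fun e z => z ∈ e 0 ↔ z ∈ f (fun n => e (n+1)))
      (@Def.iff _ _ _ (Def.mem0 0 1) (hd.ren (fun n => Nat.casesOn n 0 (fun n => n + 2))))
  · intro e he
    refine ⟨fun h z _ => by rw [h], fun h => ZFSet.ext fun z => ⟨fun hz => ?_, fun hz => ?_⟩⟩
    · exact (h z (Trans.tr _ _ hz (he 0))).1 hz
    · exact (h z (Trans.tr _ _ hz (hm _ (fun i => he (i+1))))).2 hz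

variable [ZFM M]

instance factOm : Fact (om ∈ M) := ⟨ZFM.omM⟩
theorem empty_mem : (∅ : ZFSet.{u}) ∈ M := Trans.tr _ _ (nat_mem_om 0) ZFM.omM
instance factEmpty : Fact ((∅ : ZFSet.{u}) ∈ M) := ⟨empty_mem⟩
theorem nat_mem (n : ℕ) : nat n ∈ M := Trans.tr _ _ (nat_mem_om n) ZFM.omM
instance factNat (n : ℕ) : Fact (nat n ∈ M) := ⟨nat_mem n⟩

instance tmSep {a : (ℕ → ZFSet.{u}) → ZFSet.{u}} {P : (ℕ → ZFSet.{u}) → ZFSet.{u} → Prop} [ha : Tm M a]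
    [hP : Def M (fun e => P (fun n => e (n+1)) (e 0))] : Tm M (fun e => ZFSet.sep (P e) (a e)) := by
  refine Tm.ofMem (fun e he => ZFM.sp _ _ (Def.fix1 hP e he) (ha.memM e he)) ?_
  simp only [ZFSet.mem_sep]
  have := ha.shift
  infer_instance

instance tmSUnion {a : (ℕ → ZFSet.{u}) → ZFSet.{u}} [ha : Tm M a] :
    Tm M (fun e => ZFSet.sUnion (a e)) := by
  refine Tm.app1 (Tm.ofMem (fun e he => ZFM.un _ (he 0)) ?_) ha
  simp only [ZFSet.mem_sUnion]
  infer_instance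

instance tmPowM {a : (ℕ → ZFSet.{u}) → ZFSet.{u}} [ha : Tm M a] :
    Tm M (fun e => powM M (a e)) := by
  refine Tm.app1 (Tm.ofMem (fun e he => ZFM.pw _ (he 0)) ?_) ha
  refine Def.congr (R := fun e => e 0 ⊆ e 1) inferInstance ?_
  intro e he
  rw [powM, ZFSet.mem_sep, ZFSet.mem_powerset, and_iff_left (he 0)]

instance tmUnion {a b : (ℕ → ZFSet.{u}) → ZFSet.{u}} [ha : Tm M a] [hb : Tm M b] :
    Tm M (fun e => a e ∪ b e) :=
  Tm.congr (f := fun e => ZFSet.sUnion {a e, b e}) inferInstance (by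
    intro e he; rw [ZFSet.sUnion_pair])

instance tmInsert {a b : (ℕ → ZFSet.{u}) → ZFSet.{u}} [ha : Tm M a] [hb : Tm M b] :
    Tm M (fun e => insert (a e) (b e)) :=
  Tm.congr (f := fun e => {a e} ∪ b e) inferInstance (by
    intro e he; ext; simp)

instance tmInter {a b : (ℕ → ZFSet.{u}) → ZFSet.{u}} [ha : Tm M a] [hb : Tm M b] :
    Tm M (fun e => a e ∩ b e) := by
  refine Tm.app2 (F := fun x y => x ∩ y) (Tm.congr (f := fun e => ZFSet.sep (fun x => x ∈ e 1) (e 0)) inferInstance (by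
    intro e he; ext; simp)) ha hb

instance tmIm {a : (ℕ → ZFSet.{u}) → ZFSet.{u}} {F : (ℕ → ZFSet.{u}) → ZFSet.{u} → ZFSet.{u}} [ha : Tm M a]
    [hF : Tm M (fun e => F (fun n => e (n+1)) (e 0))] : Tm M (fun e => im (F e) (a e)) := by
  have hFm : ∀ e : ℕ → ZFSet.{u}, (∀ i, e i ∈ M) → ∀ x ∈ a e, F e x ∈ M := by
    intro e he x hx
    exact hF.memM (fun n => Nat.casesOn n x e) (fun n => by
      cases n with
      | zero => exact Trans.tr _ _ hx (ha.memM e he)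
      | succ n => exact he n)
  refine Tm.ofMem (fun e he => ?_) ?_
  · obtain ⟨B, hB, h⟩ := ZFM.rp (M := M) (fun x y => y = F e x) (a e)
      (Def.fix2 (R := fun e x y => y = F e x) hF.gr e he) (ha.memM e he) (by
        rintro x _ y _ y' _ rfl rfl; rfl)
    have : im (F e) (a e) = B := by
      ext y
      rw [mem_im, h]
      constructor
      · rintro ⟨x, hx, rfl⟩
        exact ⟨hFm e he x hx, x, hx, rfl⟩
      · rintro ⟨_, x, hx, rfl⟩
        exact ⟨x, hx, rfl⟩
    rwa [this]
  · simp only [mem_im]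
    have h1 := ha.shift
    have : Def M (fun e => e 1 = F (fun n => e (n+2)) (e 0)) :=
      hF.gr.ren (fun n => Nat.casesOn n 1 (fun n => Nat.casesOn n 0 (fun n => n + 2)))
    exact @Def.bex _ _ _ (fun e x => F (fun n => e (n+1)) x = e 0) h1
      (this.congr (fun e _ => eq_comm))

noncomputable def prodZ (a b : ZFSet.{u}) : ZFSet.{u} :=
  ZFSet.sUnion (im (fun x => im (fun y => ZFSet.pair x y) b) a)

theorem mem_prodZ {a b z : ZFSet.{u}} : z ∈ prodZ a b ↔ ∃ x ∈ a, ∃ y ∈ b, z = ZFSet.pair x y := by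
  unfold prodZ
  simp only [ZFSet.mem_sUnion, mem_im]
  constructor
  · rintro ⟨w, ⟨x, hx, rfl⟩, h⟩
    rw [mem_im] at h
    obtain ⟨y, hy, rfl⟩ := h
    exact ⟨x, hx, y, hy, rfl⟩
  · rintro ⟨x, hx, y, hy, rfl⟩
    exact ⟨_, ⟨x, hx, rfl⟩, mem_im.2 ⟨y, hy, rfl⟩⟩

theorem pair_mem_prodZ {a b x y : ZFSet.{u}} : ZFSet.pair x y ∈ prodZ a b ↔ x ∈ a ∧ y ∈ b := by
  rw [mem_prodZ]
  constructor
  · rintro ⟨x', hx, y', hy, h⟩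
    obtain ⟨rfl, rfl⟩ := ZFSet.pair_injective h
    exact ⟨hx, hy⟩
  · rintro ⟨hx, hy⟩; exact ⟨x, hx, y, hy, rfl⟩

instance tmProd {a b : (ℕ → ZFSet.{u}) → ZFSet.{u}} [ha : Tm M a] [hb : Tm M b] :
    Tm M (fun e => prodZ (a e) (b e)) :=
  Tm.app2 (F := prodZ) (by unfold prodZ; infer_instance) ha hb

end

end CtmForcing

namespace CtmForcing

open FirstOrder FirstOrder.Language


section
variable {M : ZFSet.{u}} [ZFM M]

/-- membership of closed terms -/
theorem tmem {c : ZFSet.{u}} (h : Tm M (fun _ => c)) : c ∈ M := h.memM (fun _ => ∅) (fun _ => empty_mem)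

noncomputable def tc (M x : ZFSet.{u}) : ZFSet.{u} :=
  ZFSet.sep (fun z => ∀ T ∈ M, (∀ y ∈ T, y ⊆ T) → x ⊆ T → z ∈ T) M

theorem mem_tc {x z : ZFSet.{u}} : z ∈ tc M x ↔ z ∈ M ∧ ∀ T ∈ M, (∀ y ∈ T, y ⊆ T) → x ⊆ T → z ∈ T := by
  simp [tc]

theorem sub_tc {x : ZFSet.{u}} (hx : x ∈ M) : x ⊆ tc M x := fun z hz =>
  mem_tc.2 ⟨Trans.tr _ _ hz hx, fun _ _ _ h => h hz⟩

theorem tc_trans {x y z : ZFSet.{u}} (hy : y ∈ tc M x) (hz : z ∈ y) : z ∈ tc M x := by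
  rw [mem_tc] at *
  exact ⟨Trans.tr _ _ hz hy.1, fun T hT h1 h2 => h1 y (hy.2 T hT h1 h2) hz⟩

theorem tc_sub {x y : ZFSet.{u}} (hy : y ∈ tc M x) : tc M y ⊆ tc M x := by
  intro z hz
  rw [mem_tc] at *
  exact ⟨hz.1, fun T hT h1 h2 => hz.2 T hT h1 (h1 y (hy.2 T hT h1 h2))⟩

theorem tc_defMem : Def M (fun e => e 0 ∈ tc M (e 1)) := by
  refine Def.congr (R := fun e => ∀ T ∈ M, (∀ y ∈ T, y ⊆ T) → e 1 ⊆ T → e 0 ∈ T) inferInstance ?_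
  intro e he
  rw [mem_tc, and_iff_right (he 0)]

theorem tc_gr : Def M (fun e => e 1 = tc M (e 0)) := by
  refine Def.congr (R := fun e => ∀ z ∈ M, (z ∈ e 1 ↔ z ∈ tc M (e 0))) ?_ ?_
  · have : Def M (fun e => e 0 ∈ tc M (e 1)) := tc_defMem
    exact @Def.all _ (fun e z => z ∈ e 1 ↔ z ∈ tc M (e 0))
      (@Def.iff _ _ _ (Def.mem0 0 2) tc_defMem)
  · intro e he
    refine ⟨fun h z _ => by rw [h], fun h => ZFSet.ext fun z => ⟨fun hz => ?_, fun hz => ?_⟩⟩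
    · exact (h z (Trans.tr _ _ hz (he 1))).1 hz
    · exact (h z (mem_tc.1 hz).1).2 hz

theorem tc_mem {x : ZFSet.{u}} (hx : x ∈ M) : tc M x ∈ M := by
  induction x using ZFSet.inductionOn with
  | h x ih =>
  have hf : Fact (x ∈ M) := ⟨hx⟩
  obtain ⟨B, hB, h⟩ := ZFM.rp (M := M) (fun x y => y = tc M x) x tc_gr hx (by
    rintro x _ y _ y' _ rfl rfl; rfl)
  have hf : Fact (B ∈ M) := ⟨hB⟩
  have hT : x ∪ ZFSet.sUnion B ∈ M := tmem inferInstance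
  have : tc M x = ZFSet.sep (fun z => z ∈ tc M x) (x ∪ ZFSet.sUnion B) := by
    ext z
    rw [ZFSet.mem_sep]
    refine ⟨fun hz => ⟨(mem_tc.1 hz).2 _ hT ?_ ?_, hz⟩, fun hz => hz.2⟩
    · intro y hy w hw
      rw [ZFSet.mem_union, ZFSet.mem_sUnion] at *
      right
      rcases hy with hy | ⟨b, hb, hy⟩
      · have hyM := Trans.tr _ _ hy hx
        exact ⟨tc M y, (h _).2 ⟨ih y hy hyM, y, hy, rfl⟩, sub_tc hyM hw⟩
      · obtain ⟨_, a, ha, rfl⟩ := (h b).1 hb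
        exact ⟨_, hb, tc_trans hy hw⟩
    · intro w hw
      exact ZFSet.mem_union.2 (Or.inl hw)
  rw [this]
  exact ZFM.sp _ _ (Def.app2 (R := fun z x => z ∈ tc M x) tc_defMem (tmVar 0) (tmConst x)) hT

instance tmTc {a : (ℕ → ZFSet.{u}) → ZFSet.{u}} [ha : Tm M a] : Tm M (fun e => tc M (a e)) :=
  Tm.app1 (F := tc M) ⟨fun _ he => tc_mem (he 0), tc_gr.ren (fun n => if n = 0 then 1 else 0)⟩ ha

theorem tc_rank {x y : ZFSet.{u}} (hx : x ∈ M) (hy : y ∈ tc M x) : y.rank < x.rank := by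
  induction x using ZFSet.inductionOn generalizing y with
  | h x ih =>
  have hf : Fact (x ∈ M) := ⟨hx⟩
  have hT : x ∪ ZFSet.sUnion (im (fun y => tc M y) x) ∈ M := tmem inferInstance
  have := (mem_tc.1 hy).2 _ hT ?_ ?_
  · rw [ZFSet.mem_union, ZFSet.mem_sUnion] at this
    rcases this with h | ⟨b, hb, h⟩
    · exact ZFSet.rank_lt_of_mem h
    · obtain ⟨z, hz, rfl⟩ := mem_im.1 hb
      exact (ih z hz (Trans.tr _ _ hz hx) h).trans (ZFSet.rank_lt_of_mem hz)
  · intro y hy w hw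
    rw [ZFSet.mem_union, ZFSet.mem_sUnion] at *
    right
    rcases hy with hy | ⟨b, hb, hy⟩
    · have hyM := Trans.tr _ _ hy hx
      exact ⟨tc M y, mem_im.2 ⟨y, hy, rfl⟩, sub_tc hyM hw⟩
    · obtain ⟨a, ha, rfl⟩ := mem_im.1 hb
      exact ⟨_, hb, tc_trans hy hw⟩
  · intro w hw
    exact ZFSet.mem_union.2 (Or.inl hw)

/-! recursion -/

noncomputable def gph (F : ZFSet.{u} → ZFSet.{u}) (A : ZFSet.{u}) : ZFSet.{u} :=
  im (fun y => ZFSet.pair y (F y)) A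

theorem mem_gph {F : ZFSet.{u} → ZFSet.{u}} {A x y : ZFSet.{u}} :
    ZFSet.pair x y ∈ gph F A ↔ x ∈ A ∧ y = F x := by
  rw [gph, mem_im]
  constructor
  · rintro ⟨z, hz, h⟩
    obtain ⟨rfl, rfl⟩ := ZFSet.pair_injective h
    exact ⟨hz, rfl⟩
  · rintro ⟨h, rfl⟩; exact ⟨x, h, rfl⟩

theorem recn_gph (G : ZFSet.{u} → ZFSet.{u} → ZFSet.{u}) (hG : Tm M (fun e => G (e 0) (e 1)))
    (F : ZFSet.{u} → ZFSet.{u}) (hF : ∀ x ∈ M, F x = G x (gph F (tc M x))) :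
    Tm M (fun e => F (e 0)) := by
  let good : ZFSet.{u} → Prop := fun h => ∀ u ∈ h, ∃ y ∈ M, ∃ z ∈ M, u = ZFSet.pair y z ∧
    (∀ y' ∈ tc M y, ∃ z' ∈ M, ZFSet.pair y' z' ∈ h) ∧
    z = G y (ZFSet.sep (fun u => ∃ y' ∈ tc M y, ∃ z' ∈ M, u = ZFSet.pair y' z') h)
  let C : ZFSet.{u} → ZFSet.{u} → Prop := fun x z => ∃ h ∈ M, good h ∧ ZFSet.pair x z ∈ h
  have hgd : Def M (fun e => good (e 0)) := by
    have : Tm M (fun e => G (e 1) (ZFSet.sep (fun u => ∃ y' ∈ tc M (e 1), ∃ z' ∈ M, u = ZFSet.pair y' z') (e 3))) :=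
      Tm.app2 (F := G) (b := fun e => (ZFSet.sep (fun u => ∃ y' ∈ tc M (e 1), ∃ z' ∈ M, u = ZFSet.pair y' z') (e 3))) hG (tmVar 1) inferInstance
    show Def M (fun e => ∀ u ∈ e 0, ∃ y ∈ M, ∃ z ∈ M, u = ZFSet.pair y z ∧
    (∀ y' ∈ tc M y, ∃ z' ∈ M, ZFSet.pair y' z' ∈ e 0) ∧
    z = G y (ZFSet.sep (fun u => ∃ y' ∈ tc M y, ∃ z' ∈ M, u = ZFSet.pair y' z') (e 0)))
    infer_instance
  have hCd : Def M (fun e => C (e 0) (e 1)) := by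
    have : Def M (fun e => good (e 0)) := hgd
    show Def M (fun e => ∃ h ∈ M, good h ∧ ZFSet.pair (e 0) (e 1) ∈ h)
    infer_instance
  have hun : ∀ x z, C x z → z = F x := by
    rintro x z ⟨h, hh, hg, hz⟩
    have hx : x ∈ M := Trans.fst hz hh
    have key : ∀ r : Ordinal.{u}, ∀ x z, x.rank = r → ZFSet.pair x z ∈ h → z = F x := by
      intro r
      induction r using WellFoundedLT.induction with
      | ind r ih =>
      rintro x z hr hz
      obtain ⟨y, hy, z', hz', e, h1, h2⟩ := hg _ hz
      obtain ⟨rfl, rfl⟩ := ZFSet.pair_injective e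
      rw [hF x hy, h2]
      congr 1
      ext u
      rw [ZFSet.mem_sep, gph, mem_im]
      constructor
      · rintro ⟨hu, y', hy', z', _, rfl⟩
        refine ⟨y', hy', ?_⟩
        rw [ih _ (hr ▸ tc_rank hy hy') y' z' rfl hu]
      · rintro ⟨y', hy', rfl⟩
        obtain ⟨z', hz', h3⟩ := h1 y' hy'
        have := ih _ (hr ▸ tc_rank hy hy') y' z' rfl h3
        subst this
        exact ⟨h3, y', hy', _, hz', rfl⟩
    exact key _ x z rfl hz
  have hex : ∀ x ∈ M, C x (F x) := by
    have key : ∀ r : Ordinal.{u}, ∀ x ∈ M, x.rank = r → C x (F x) := by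
      intro r
      induction r using WellFoundedLT.induction with
      | ind r ih =>
      intro x hx hr
      have hM : ∀ x z, C x z → z ∈ M := fun x z ⟨h, hh, _, hz⟩ => Trans.snd hz hh
      have ih' : ∀ y ∈ tc M x, C y (F y) := fun y hy =>
        ih _ (hr ▸ tc_rank hx hy) y (mem_tc.1 hy).1 rfl
      have hgM : gph F (tc M x) ∈ M := by
        obtain ⟨B, hB, h⟩ := ZFM.rp (M := M) (fun y u => ∃ z ∈ M, u = ZFSet.pair y z ∧ C y z) (tc M x)
          (by
            have : Def M (fun e => C (e 1) (e 0)) := hCd.ren (fun n => if n = 0 then 1 else 0)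
            exact @Def.ex _ (fun e z => e 1 = ZFSet.pair (e 0) z ∧ C (e 0) z) inferInstance)
          (tc_mem hx) (by
            rintro x _ y _ y' _ ⟨z, _, rfl, hz⟩ ⟨z', _, rfl, hz'⟩
            rw [hun _ _ hz, hun _ _ hz'])
        have : gph F (tc M x) = B := by
          ext u
          rw [h, gph, mem_im]
          constructor
          · rintro ⟨y, hy, rfl⟩
            have := hM _ _ (ih' y hy)
            exact ⟨TP.pair (mem_tc.1 hy).1 this, y, hy, F y, this, rfl, ih' y hy⟩
          · rintro ⟨_, y, hy, z, _, rfl, hC⟩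
            exact ⟨y, hy, by rw [hun _ _ hC]⟩
        rwa [this]
      have hFx : F x ∈ M := by
        rw [hF x hx]
        exact hG.memM (fun n => Nat.casesOn n x (fun _ => gph F (tc M x))) (fun n => by cases n <;> assumption)
      have f1 : Fact (x ∈ M) := ⟨hx⟩
      have f2 : Fact (F x ∈ M) := ⟨hFx⟩
      have f3 : Fact (gph F (tc M x) ∈ M) := ⟨hgM⟩
      have hself : x ∉ tc M x := fun h => lt_irrefl _ (tc_rank hx h)
      refine ⟨insert (ZFSet.pair x (F x)) (gph F (tc M x)), tmem inferInstance, ?_, by simp⟩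
      have key2 : ∀ y, (y = x ∨ y ∈ tc M x) → 
          (∀ y' ∈ tc M y, ∃ z' ∈ M, ZFSet.pair y' z' ∈ insert (ZFSet.pair x (F x)) (gph F (tc M x))) ∧
          F y = G y (ZFSet.sep (fun u => ∃ y' ∈ tc M y, ∃ z' ∈ M, u = ZFSet.pair y' z')
            (insert (ZFSet.pair x (F x)) (gph F (tc M x)))) := by
        intro y hy
        have hyM : y ∈ M := by
          rcases hy with rfl | hy
          · exact hx
          · exact (mem_tc.1 hy).1
        have hs : tc M y ⊆ tc M x := by
          rcases hy with rfl | hy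
          · exact fun _ h => h
          · exact tc_sub hy
        refine ⟨fun y' hy' => ⟨F y', hM _ _ (ih' y' (hs hy')), ?_⟩, ?_⟩
        · rw [ZFSet.mem_insert_iff, mem_gph]; exact Or.inr ⟨hs hy', rfl⟩
        · rw [hF y hyM]
          congr 1
          ext u
          rw [ZFSet.mem_sep, gph, mem_im, ZFSet.mem_insert_iff]
          constructor
          · rintro ⟨y', hy', rfl⟩
            refine ⟨Or.inr (mem_gph.2 ⟨hs hy', rfl⟩), y', hy', _, hM _ _ (ih' y' (hs hy')), rfl⟩
          · rintro ⟨h, y', hy', z', _, rfl⟩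
            refine ⟨y', hy', ?_⟩
            rcases h with h | h
            · obtain ⟨rfl, rfl⟩ := ZFSet.pair_injective h
              exact absurd (hs hy') hself
            · rw [(mem_gph.1 h).2]
      intro u hu
      rw [ZFSet.mem_insert_iff, gph, mem_im] at hu
      rcases hu with rfl | ⟨y, hy, rfl⟩
      · exact ⟨x, hx, F x, hFx, rfl, key2 x (Or.inl rfl)⟩
      · exact ⟨y, (mem_tc.1 hy).1, F y, hM _ _ (ih' y hy), rfl, key2 y (Or.inr hy)⟩
    exact fun x hx => key _ x hx rfl
  refine ⟨fun e he => ?_, ?_⟩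
  · obtain ⟨h, hh, _, hz⟩ := hex _ (he 0)
    exact Trans.snd hz hh
  · refine (hCd.ren (fun n => if n = 0 then 1 else 0)).congr (fun e he => ?_)
    exact ⟨fun h => by simp only [] at h ⊢; rw [show e (if 1 = 0 then 1 else 0) = _ from h]; exact hex _ (he 1), fun h => hun _ _ h⟩

theorem recn (G : ZFSet.{u} → ZFSet.{u}) (hG : Tm M (fun e => G (e 0)))
    (F : ZFSet.{u} → ZFSet.{u}) (hF : ∀ x ∈ M, F x = G (im F x)) : Tm M (fun e => F (e 0)) := by
  refine recn_gph (fun x g => G (ZFSet.sep (fun z => ∃ y ∈ x, ZFSet.pair y z ∈ g)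
    (ZFSet.sUnion (ZFSet.sUnion g)))) ?_ F ?_
  · exact Tm.app1 (F := G) (a := fun e => (ZFSet.sep (fun z => ∃ y ∈ e 0, ZFSet.pair y z ∈ e 1)
      (ZFSet.sUnion (ZFSet.sUnion (e 1))))) hG inferInstance
  · intro x hx
    rw [hF x hx]
    congr 1
    ext z
    rw [ZFSet.mem_sep, mem_im]
    constructor
    · rintro ⟨y, hy, rfl⟩
      have : ZFSet.pair y (F y) ∈ gph F (tc M x) := mem_gph.2 ⟨sub_tc hx hy, rfl⟩
      refine ⟨?_, y, hy, this⟩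
      rw [ZFSet.mem_sUnion]
      refine ⟨{y, F y}, ?_, by simp⟩
      rw [ZFSet.mem_sUnion]
      exact ⟨_, this, by simp [ZFSet.pair]⟩
    · rintro ⟨_, y, hy, h⟩
      exact ⟨y, hy, (mem_gph.1 h).2.symm⟩

end
end CtmForcing

namespace CtmForcing

open FirstOrder FirstOrder.Language


section
variable {M : ZFSet.{u}}

theorem nat_inj : Function.Injective nat.{u} := by
  have key : ∀ n m : ℕ, n < m → nat.{u} n ∈ nat m := by
    intro n m h
    induction m with
    | zero => omega
    | succ m ih =>
      rw [nat, ZFSet.mem_insert_iff]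
      rcases Nat.lt_succ_iff_lt_or_eq.1 h with h | rfl
      · exact Or.inr (ih h)
      · exact Or.inl rfl
  intro n m h
  rcases lt_trichotomy n m with h1 | h1 | h1
  · have := key _ _ h1
    rw [h] at this; exact absurd this (ZFSet.mem_irrefl _)
  · exact h1
  · have := key _ _ h1
    rw [h] at this; exact absurd this (ZFSet.mem_irrefl _)

noncomputable def seqZ (s : ℕ → ZFSet.{u}) : ZFSet.{u} :=
  ZFSet.range (fun n : ℕ => ZFSet.pair (nat n) (s n))

theorem mem_seqZ {s : ℕ → ZFSet.{u}} {x : ZFSet.{u}} : x ∈ seqZ s ↔ ∃ n, ZFSet.pair (nat n) (s n) = x := by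
  simp [seqZ]

theorem pair_mem_seqZ {s : ℕ → ZFSet.{u}} {n : ℕ} {y : ZFSet.{u}} :
    ZFSet.pair (nat n) y ∈ seqZ s ↔ y = s n := by
  rw [mem_seqZ]
  constructor
  · rintro ⟨m, h⟩
    obtain ⟨h1, h2⟩ := ZFSet.pair_injective h
    rw [← h2, nat_inj h1]
  · rintro rfl; exact ⟨n, rfl⟩

variable [ZFM M]

theorem iter_mem (s : ℕ → ZFSet.{u}) (hs : ∀ n, s n ∈ M) (St : ZFSet.{u} → ZFSet.{u} → ZFSet.{u} → Prop)
    (hd : Def M (fun e => St (e 0) (e 1) (e 2)))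
    (h : ∀ n z, z ∈ M → (St (nat n) (s n) z ↔ z = s (n+1))) : seqZ s ∈ M := by
  have f0 : Fact (s 0 ∈ M) := ⟨hs 0⟩
  let good : ZFSet.{u} → Prop := fun h => ∀ u ∈ h, u = ZFSet.pair ∅ (s 0) ∨ ∃ n ∈ M, ∃ z ∈ M, ∃ z' ∈ M,
    ZFSet.pair n z ∈ h ∧ u = ZFSet.pair (insert n n) z' ∧ St n z z'
  have hgd : Def M (fun e => good (e 0)) := by
    have : Def M (fun e => St (e 2) (e 1) (e 0)) := Def.app3 (R := St) hd (tmVar 2) (tmVar 1) (tmVar 0)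
    show Def M (fun e => ∀ u ∈ e 0, u = ZFSet.pair ∅ (s 0) ∨ ∃ n ∈ M, ∃ z ∈ M, ∃ z' ∈ M,
      ZFSet.pair n z ∈ e 0 ∧ u = ZFSet.pair (insert n n) z' ∧ St n z z')
    infer_instance
  have hCd : Def M (fun e => ∃ h ∈ M, good h ∧ ZFSet.pair (e 0) (e 1) ∈ h) := inferInstance
  have hun : ∀ f ∈ M, good f → ∀ n z, ZFSet.pair (nat n) z ∈ f → z = s n := by
    intro f hf hg n
    induction n with
    | zero =>
      intro z hz
      rcases hg _ hz with h1 | ⟨n, _, z', _, z'', _, _, h1, _⟩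
      · exact (ZFSet.pair_injective h1).2
      · have := (ZFSet.pair_injective h1).1
        have h2 : n ∈ nat 0 := by rw [this]; simp
        exact absurd h2 (ZFSet.notMem_empty _)
    | succ n ih =>
      intro z hz
      rcases hg _ hz with h1 | ⟨m, _, z', _, z'', hz', h0, h1, h2⟩
      · have := (ZFSet.pair_injective h1).1
        have h2 : nat n ∈ nat (n+1) := by simp [nat]
        rw [this] at h2
        exact absurd h2 (ZFSet.notMem_empty _)
      · obtain ⟨h3, rfl⟩ := ZFSet.pair_injective h1
        have : m = nat n := by
          have h4 : m ∈ nat (n+1) := by rw [h3]; simp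
          have h5 : nat n ∈ insert m m := by rw [← h3]; simp [nat]
          rw [nat, ZFSet.mem_insert_iff] at h4
          rw [ZFSet.mem_insert_iff] at h5
          rcases h4 with h4 | h4
          · exact h4
          · rcases h5 with h5 | h5
            · exact h5.symm
            · exact absurd h5 (ZFSet.mem_asymm h4)
        subst this
        have := ih _ h0
        subst this
        exact (h n z hz').1 h2
  have hex : ∀ n, ∃ f ∈ M, good f ∧ ZFSet.pair (nat n) (s n) ∈ f := by
    intro n
    induction n with
    | zero =>
      refine ⟨{ZFSet.pair ∅ (s 0)}, tmem inferInstance, ?_, by simp [nat]⟩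
      intro u hu
      exact Or.inl (by simpa using hu)
    | succ n ih =>
      obtain ⟨f, hf, hg, hn⟩ := ih
      have f1 : Fact (f ∈ M) := ⟨hf⟩
      have f2 : Fact (s (n+1) ∈ M) := ⟨hs _⟩
      refine ⟨insert (ZFSet.pair (nat (n+1)) (s (n+1))) f, tmem inferInstance, ?_, by simp⟩
      intro u hu
      rw [ZFSet.mem_insert_iff] at hu
      rcases hu with rfl | hu
      · exact Or.inr ⟨nat n, nat_mem n, s n, hs n, s (n+1), hs _, ZFSet.mem_insert_of_mem _ hn, rfl,
          (h _ _ (hs _)).2 rfl⟩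
      · refine (hg u hu).imp id ?_
        rintro ⟨n, hn, z, hz, z', hz', h1, h2⟩
        exact ⟨n, hn, z, hz, z', hz', ZFSet.mem_insert_of_mem _ h1, h2⟩
  obtain ⟨B, hB, hh⟩ := ZFM.rp (M := M) (fun n u => ∃ z ∈ M, u = ZFSet.pair n z ∧
      ∃ h ∈ M, good h ∧ ZFSet.pair n z ∈ h) om inferInstance ZFM.omM (by
    rintro x hx y _ y' _ ⟨z, _, rfl, f, hf, hg, h1⟩ ⟨z', _, rfl, f', hf', hg', h2⟩
    obtain ⟨n, rfl⟩ := mem_om.1 hx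
    rw [hun f hf hg _ _ h1, hun f' hf' hg' _ _ h2])
  have : seqZ s = B := by
    ext u
    rw [mem_seqZ, hh]
    constructor
    · rintro ⟨n, rfl⟩
      exact ⟨TP.pair (nat_mem n) (hs n), nat n, nat_mem_om n, s n, hs n, rfl, hex n⟩
    · rintro ⟨_, x, hx, z, _, rfl, f, hf, hg, h1⟩
      obtain ⟨n, rfl⟩ := mem_om.1 hx
      exact ⟨n, by rw [hun f hf hg _ _ h1]⟩
  rwa [this]

/-- `V`-initial segments: elements of `M` of rank at most that of `x` -/
noncomputable def Sg (M x : ZFSet.{u}) : ZFSet.{u} := ZFSet.sep (fun z => z.rank ≤ x.rank) M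

theorem mem_Sg {x z : ZFSet.{u}} : z ∈ Sg M x ↔ z ∈ M ∧ z.rank ≤ x.rank := by simp [Sg]

theorem Sg_rec (x : ZFSet.{u}) (hx : x ∈ M) : Sg M x = powM M (ZFSet.sUnion (im (Sg M) x)) := by
  ext z
  rw [mem_Sg, powM, ZFSet.mem_sep, and_comm, ZFSet.mem_powerset]
  refine and_congr_left fun hz => ?_
  constructor
  · intro h w hw
    have h1 := (ZFSet.rank_lt_of_mem hw).trans_le h
    rw [ZFSet.lt_rank_iff] at h1
    obtain ⟨y, hy, h2⟩ := h1
    rw [ZFSet.mem_sUnion]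
    exact ⟨Sg M y, mem_im.2 ⟨y, hy, rfl⟩, mem_Sg.2 ⟨Trans.tr _ _ hw hz, h2⟩⟩
  · intro h
    rw [ZFSet.rank_le_iff]
    intro w hw
    have := h hw
    rw [ZFSet.mem_sUnion] at this
    obtain ⟨b, hb, hw2⟩ := this
    obtain ⟨y, hy, rfl⟩ := mem_im.1 hb
    exact (mem_Sg.1 hw2).2.trans_lt (ZFSet.rank_lt_of_mem hy)

instance tmSg {a : (ℕ → ZFSet.{u}) → ZFSet.{u}} [ha : Tm M a] : Tm M (fun e => Sg M (a e)) :=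
  Tm.app1 (F := Sg M) (recn (fun y => powM M (ZFSet.sUnion y)) inferInstance (Sg M) Sg_rec) ha

theorem collection (R : ZFSet.{u} → ZFSet.{u} → Prop) (A : ZFSet.{u}) (hR : Def M (fun e => R (e 0) (e 1)))
    (hA : A ∈ M) : ∃ B ∈ M, ∀ x ∈ A, (∃ y ∈ M, R x y) → ∃ y ∈ B, R x y := by
  have h1 : Def M (fun e => R (e 2) (e 0)) := Def.app2 hR (tmVar 2) (tmVar 0)
  have h2 : Def M (fun e => R (e 1) (e 0)) := Def.app2 hR (tmVar 1) (tmVar 0)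
  obtain ⟨B, hB, h⟩ := ZFM.rp (M := M) (fun x W => ∃ y ∈ M, R x y ∧ W = Sg M y ∧ 
    ∀ y' ∈ M, R x y' → Sg M y ⊆ Sg M y') A inferInstance hA (by
      rintro x hx W _ W' _ ⟨y, hy, h1, rfl, h2⟩ ⟨y', hy', h1', rfl, h2'⟩
      exact ZFSet.ext fun z => ⟨fun hz => h2 _ hy' h1' hz, fun hz => h2' _ hy h1 hz⟩)
  refine ⟨ZFSet.sUnion B, ZFM.un _ hB, ?_⟩
  rintro x hx ⟨y, hy, hxy⟩
  let S : Set ZFSet.{u} := {y | y ∈ M ∧ R x y}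
  obtain ⟨y0, hy0, hmin⟩ := (InvImage.wf ZFSet.rank (wellFounded_lt (α := Ordinal.{u}))).has_min S ⟨y, hy, hxy⟩
  refine ⟨y0, ?_, hy0.2⟩
  rw [ZFSet.mem_sUnion]
  refine ⟨Sg M y0, (h _).2 ⟨Tm.mem1 (F := Sg M) inferInstance hy0.1, x, hx, y0, hy0.1, hy0.2, rfl, ?_⟩,
    mem_Sg.2 ⟨hy0.1, le_refl _⟩⟩
  intro y' hy' h' z hz
  rw [mem_Sg] at *
  exact ⟨hz.1, hz.2.trans (not_lt.1 (hmin y' ⟨hy', h'⟩))⟩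

end
end CtmForcing

namespace CtmForcing

open FirstOrder FirstOrder.Language


set_option synthInstance.maxSize 4000
set_option synthInstance.maxHeartbeats 200000

section
variable (M P : ZFSet.{u})

/-- one step of the forcing relation for equality -/
def Step (R : ZFSet.{u} → ZFSet.{u} → ZFSet.{u} → Prop) (x y p : ZFSet.{u}) : Prop :=
  (∀ z ∈ M, ∀ r ∈ P, ZFSet.pair z r ∈ x → ∀ q ∈ P, p ⊆ q → r ⊆ q →
    ∃ s ∈ P, q ⊆ s ∧ ∃ w ∈ M, ∃ t ∈ P, ZFSet.pair w t ∈ y ∧ t ⊆ s ∧ R z w s) ∧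
  (∀ w ∈ M, ∀ t ∈ P, ZFSet.pair w t ∈ y → ∀ q ∈ P, p ⊆ q → t ⊆ q →
    ∃ s ∈ P, q ⊆ s ∧ ∃ z ∈ M, ∃ r ∈ P, ZFSet.pair z r ∈ x ∧ r ⊆ s ∧ R z w s)

def E (x y p : ZFSet.{u}) : Prop :=
  ∃ R ∈ M, ZFSet.pair (ZFSet.pair x y) p ∈ R ∧
    ∀ x' ∈ M, ∀ y' ∈ M, ∀ p' ∈ M, ZFSet.pair (ZFSet.pair x' y') p' ∈ R →
      Step M P (fun a b c => ZFSet.pair (ZFSet.pair a b) c ∈ R) x' y' p'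

variable {M P}

theorem Step.mono {R R' : ZFSet.{u} → ZFSet.{u} → ZFSet.{u} → Prop} {x y p : ZFSet.{u}}
    (h : Step M P R x y p)
    (hR : ∀ z r w t s, z ∈ M → w ∈ M → s ∈ P → ZFSet.pair z r ∈ x → ZFSet.pair w t ∈ y → R z w s → R' z w s) :
    Step M P R' x y p := by
  constructor
  · intro z hz r hr h1 q hq h2 h3
    obtain ⟨s, hs, h4, w, hw, t, ht, h5, h6, h7⟩ := h.1 z hz r hr h1 q hq h2 h3
    exact ⟨s, hs, h4, w, hw, t, ht, h5, h6, hR _ _ _ _ _ hz hw hs h1 h5 h7⟩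
  · intro w hw t ht h1 q hq h2 h3
    obtain ⟨s, hs, h4, z, hz, r, hr, h5, h6, h7⟩ := h.2 w hw t ht h1 q hq h2 h3
    exact ⟨s, hs, h4, z, hz, r, hr, h5, h6, hR _ _ _ _ _ hz hw hs h5 h1 h7⟩

variable [ZFM M]

theorem Step.def {R : (ℕ → ZFSet.{u}) → ZFSet.{u} → ZFSet.{u} → ZFSet.{u} → Prop} [Fact (P ∈ M)]
    (hR : Def M (fun e => R (fun n => e (n+3)) (e 0) (e 1) (e 2)))
    {a b c : (ℕ → ZFSet.{u}) → ZFSet.{u}} (ha : Tm M a) (hb : Tm M b) (hc : Tm M c) :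
    Def M (fun e => Step M P (R e) (a e) (b e) (c e)) := by
  unfold Step
  have h1 : Def M (fun e : ℕ → ZFSet.{u} => R (fun n => e (n+1+1+1+1+1+1)) (e 5) (e 1) (e 2)) :=
    hR.ren (fun n => match n with | 0 => 5 | 1 => 1 | 2 => 2 | (n+3) => n + 6)
  have h2 : Def M (fun e : ℕ → ZFSet.{u} => R (fun n => e (n+1+1+1+1+1+1)) (e 1) (e 5) (e 2)) :=
    hR.ren (fun n => match n with | 0 => 1 | 1 => 5 | 2 => 2 | (n+3) => n + 6)
  have := ha.ren (fun n => n+1+1)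
  have := hb.ren (fun n => n+1+1)
  have := hc.ren (fun n => n+1+1+1)
  have := ha.ren (fun n => n+1+1+1+1+1+1)
  have := hb.ren (fun n => n+1+1+1+1+1+1)
  infer_instance

theorem E.def0 [Fact (P ∈ M)] : Def M (fun e => E M P (e 0) (e 1) (e 2)) := by
  unfold E
  have : Def M (fun e => Step M P (fun a b c => ZFSet.pair (ZFSet.pair a b) c ∈ e 3) (e 2) (e 1) (e 0)) :=
    Step.def (R := fun e a b c => ZFSet.pair (ZFSet.pair a b) c ∈ e 3) inferInstance inferInstance inferInstance inferInstance
  infer_instance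

instance E.def [Fact (P ∈ M)] {a b c : (ℕ → ZFSet.{u}) → ZFSet.{u}} [ha : Tm M a] [hb : Tm M b]
    [hc : Tm M c] : Def M (fun e => E M P (a e) (b e) (c e)) := Def.app3 E.def0 ha hb hc

theorem pair_tc {x y p : ZFSet.{u}} (h : ZFSet.pair y p ∈ tc M x) : y ∈ tc M x := by
  have h1 : ({y} : ZFSet.{u}) ∈ ZFSet.pair y p := by simp [ZFSet.pair]
  exact tc_trans (tc_trans h h1) (by simp)

theorem E_iff [hP : Fact (P ∈ M)] {x y p : ZFSet.{u}} (hx : x ∈ M) (hy : y ∈ M) (hp : p ∈ P) :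
    E M P x y p ↔ Step M P (E M P) x y p := by
  have hfw : ∀ x ∈ M, ∀ y ∈ M, ∀ p ∈ P, E M P x y p → Step M P (E M P) x y p := by
    rintro x hx y hy p hp ⟨R, hR, h1, h2⟩
    refine (h2 x hx y hy p (Trans.tr _ _ hp hP.1) h1).mono ?_
    intro z r w t s hz hw hs _ _ h3
    exact ⟨R, hR, h3, h2⟩
  refine ⟨hfw x hx y hy p hp, fun h => ?_⟩
  have fx : Fact (x ∈ M) := ⟨hx⟩
  have fy : Fact (y ∈ M) := ⟨hy⟩
  let T := tc M {x, y}
  have hT : T ∈ M := tmem inferInstance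
  have fT : Fact (T ∈ M) := ⟨hT⟩
  have hxy : ({x, y} : ZFSet.{u}) ∈ M := tmem inferInstance
  have hxT : x ∈ T := sub_tc hxy (by simp)
  have hyT : y ∈ T := sub_tc hxy (by simp)
  let R := ZFSet.sep (fun u => ∃ x ∈ M, ∃ y ∈ M, ∃ p ∈ M, u = ZFSet.pair (ZFSet.pair x y) p ∧
    Step M P (E M P) x y p) (prodZ (prodZ T T) P)
  have hd : Def M (fun e => Step M P (E M P) (e 2) (e 1) (e 0)) :=
    Step.def (R := fun e => E M P) E.def0 (tmVar _) (tmVar _) (tmVar _)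
  have hR : R ∈ M := ZFM.sp _ _ inferInstance (tmem inferInstance)
  have hmem : ∀ x y p, ZFSet.pair (ZFSet.pair x y) p ∈ R ↔ x ∈ T ∧ y ∈ T ∧ p ∈ P ∧ Step M P (E M P) x y p := by
    intro x y p
    simp only [R, ZFSet.mem_sep, pair_mem_prodZ]
    constructor
    · rintro ⟨⟨⟨h1, h2⟩, h3⟩, x', _, y', _, p', _, h4, h5⟩
      obtain ⟨h6, rfl⟩ := ZFSet.pair_injective h4
      obtain ⟨rfl, rfl⟩ := ZFSet.pair_injective h6
      exact ⟨h1, h2, h3, h5⟩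
    · rintro ⟨h1, h2, h3, h5⟩
      exact ⟨⟨⟨h1, h2⟩, h3⟩, x, Trans.tr _ _ h1 hT, y, Trans.tr _ _ h2 hT, p, Trans.tr _ _ h3 hP.1, rfl, h5⟩
  refine ⟨R, hR, (hmem _ _ _).2 ⟨hxT, hyT, hp, h⟩, ?_⟩
  intro x' hx' y' hy' p' hp' h'
  obtain ⟨h1, h2, h3, h4⟩ := (hmem _ _ _).1 h'
  refine h4.mono ?_
  intro z r w t s hz hw hs hzx hwy hE
  exact (hmem _ _ _).2 ⟨pair_tc (tc_trans h1 hzx), pair_tc (tc_trans h2 hwy), hs, hfw _ hz _ hw _ hs hE⟩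

theorem E_mono [hP : Fact (P ∈ M)] {x y p q : ZFSet.{u}} (hx : x ∈ M) (hy : y ∈ M) (hp : p ∈ P)
    (hq : q ∈ P) (hpq : p ⊆ q) (h : E M P x y p) : E M P x y q := by
  rw [E_iff hx hy hp] at h
  rw [E_iff hx hy hq]
  exact ⟨fun z hz r hr h1 q' hq' h2 h3 => h.1 z hz r hr h1 q' hq' (fun _ hh => h2 (hpq hh)) h3,
    fun z hz r hr h1 q' hq' h2 h3 => h.2 z hz r hr h1 q' hq' (fun _ hh => h2 (hpq hh)) h3⟩

theorem E_reg [hP : Fact (P ∈ M)] {x y p : ZFSet.{u}} (hx : x ∈ M) (hy : y ∈ M) (hp : p ∈ P)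
    (h : ∀ q ∈ P, p ⊆ q → ∃ s ∈ P, q ⊆ s ∧ E M P x y s) : E M P x y p := by
  rw [E_iff hx hy hp]
  constructor
  · intro z hz r hr h1 q hq h2 h3
    obtain ⟨s, hs, h4, h5⟩ := h q hq h2
    rw [E_iff hx hy hs] at h5
    obtain ⟨s', hs', h6, h7⟩ := h5.1 z hz r hr h1 s hs (fun _ h => h) (fun _ hh => h4 (h3 hh))
    exact ⟨s', hs', fun _ hh => h6 (h4 hh), h7⟩
  · intro z hz r hr h1 q hq h2 h3
    obtain ⟨s, hs, h4, h5⟩ := h q hq h2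
    rw [E_iff hx hy hs] at h5
    obtain ⟨s', hs', h6, h7⟩ := h5.2 z hz r hr h1 s hs (fun _ h => h) (fun _ hh => h4 (h3 hh))
    exact ⟨s', hs', fun _ hh => h6 (h4 hh), h7⟩

end

/-- `G` is an `M`-generic filter on `P` -/
structure Gen (M P : ZFSet.{u}) (G : Set ZFSet.{u}) : Prop where
  sub : ∀ p ∈ G, p ∈ P
  emp : ∅ ∈ G
  up : ∀ p ∈ G, ∀ q ∈ P, q ⊆ p → q ∈ G
  dir : ∀ p ∈ G, ∀ q ∈ G, ∃ r ∈ G, p ⊆ r ∧ q ⊆ r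
  gen : ∀ A ∈ M, (∀ p ∈ P, ∃ q ∈ P, p ⊆ q ∧ q ∈ A) → ∃ s ∈ G, s ∈ A

section
variable {M P : ZFSet.{u}} {G : Set ZFSet.{u}}

theorem exists_gen [Trans M] (hc : (M : Set ZFSet.{u}).Countable) (hP : P ∈ M) (h0 : ∅ ∈ P) {p : ZFSet.{u}} (hp : p ∈ P) :
    ∃ G, Gen M P G ∧ p ∈ G := by
  obtain ⟨f, hf⟩ := hc.exists_eq_range ⟨P, hP⟩
  classical
  let nx : ℕ → El P → El P := fun n x => if h : ∃ q ∈ P, x.1 ⊆ q ∧ q ∈ f n then ⟨h.choose, h.choose_spec.1⟩ else x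
  let s : ℕ → El P := fun n => Nat.rec ⟨p, hp⟩ nx n
  have hs : ∀ n, (s n).1 ⊆ (s (n+1)).1 := by
    intro n
    show (s n).1 ⊆ (nx n (s n)).1
    simp only [nx]
    split_ifs with h
    · exact h.choose_spec.2.1
    · exact fun _ h => h
  have hm : ∀ n m, n ≤ m → (s n).1 ⊆ (s m).1 := by
    intro n m h
    induction h with
    | refl => exact fun _ h => h
    | step _ ih => exact fun _ h => hs _ (ih h)
  refine ⟨{q | q ∈ P ∧ ∃ n, q ⊆ (s n).1}, ⟨fun p hp => hp.1, ⟨h0, 0, ZFSet.empty_subset _⟩, ?_, ?_, ?_⟩, hp, 0, fun _ h => h⟩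
  · rintro p ⟨_, n, hn⟩ q hq h
    exact ⟨hq, n, fun _ hh => hn (h hh)⟩
  · rintro p ⟨_, n, hn⟩ q ⟨_, m, hm'⟩
    exact ⟨(s (max n m)).1, ⟨(s _).2, _, fun _ h => h⟩, fun _ hh => hm _ _ (le_max_left _ _) (hn hh),
      fun _ hh => hm _ _ (le_max_right _ _) (hm' hh)⟩
  · intro A hA h
    have : A ∈ Set.range f := by rw [← hf]; exact hA
    obtain ⟨n, rfl⟩ := this
    refine ⟨(s (n+1)).1, ⟨(s (n+1)).2, n+1, fun _ h => h⟩, ?_⟩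
    show (nx n (s n)).1 ∈ f n
    have h1 := h (s n).1 (s n).2
    simp only [nx]
    rw [dif_pos h1]
    exact h1.choose_spec.2.2

variable [ZFM M]

theorem Gen.dense [hP : Fact (P ∈ M)] (hG : Gen M P G) (D : ZFSet.{u} → Prop) (hD : Def M (fun e => D (e 0)))
    {p : ZFSet.{u}} (hp : p ∈ G) (h : ∀ q ∈ P, p ⊆ q → ∃ s ∈ P, q ⊆ s ∧ D s) : ∃ s ∈ G, D s := by
  have fp : Fact (p ∈ M) := ⟨Trans.tr _ _ (hG.sub p hp) hP.1⟩
  obtain ⟨s, hs, h1⟩ := hG.gen (ZFSet.sep (fun s => D s ∨ ¬ ∃ q ∈ P, s ⊆ q ∧ p ⊆ q) P)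
    (ZFM.sp _ _ inferInstance hP.1) (by
      intro q hq
      by_cases hc : ∃ r ∈ P, q ⊆ r ∧ p ⊆ r
      · obtain ⟨r, hr, h1, h2⟩ := hc
        obtain ⟨s, hs, h3, h4⟩ := h r hr h2
        exact ⟨s, hs, fun _ hh => h3 (h1 hh), ZFSet.mem_sep.2 ⟨hs, Or.inl h4⟩⟩
      · exact ⟨q, hq, fun _ h => h, ZFSet.mem_sep.2 ⟨hq, Or.inr hc⟩⟩)
  rcases (ZFSet.mem_sep.1 h1).2 with h2 | h2
  · exact ⟨s, hs, h2⟩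
  · obtain ⟨r, hr, h3, h4⟩ := hG.dir s hs p hp
    exact absurd ⟨r, hG.sub r hr, h3, h4⟩ h2

theorem Gen.dense0 [hP : Fact (P ∈ M)] (hG : Gen M P G) (D : ZFSet.{u} → Prop) (hD : Def M (fun e => D (e 0)))
    (h : ∀ q ∈ P, ∃ s ∈ P, q ⊆ s ∧ D s) : ∃ s ∈ G, D s :=
  hG.dense D hD hG.emp (fun q hq _ => h q hq)

end

theorem fst_rank {x y p : ZFSet.{u}} (h : ZFSet.pair y p ∈ x) : y.rank < x.rank := by
  have h1 : ({y} : ZFSet.{u}) ∈ ZFSet.pair y p := by simp [ZFSet.pair]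
  have h2 : y ∈ ({y} : ZFSet.{u}) := by simp
  exact (ZFSet.rank_lt_of_mem h2).trans ((ZFSet.rank_lt_of_mem h1).trans (ZFSet.rank_lt_of_mem h))

/-- valuation of names -/
noncomputable def val (G : Set ZFSet.{u}) (x : ZFSet.{u}) : ZFSet.{u} :=
  ZFSet.range (fun i : {i : x // ∃ y, ∃ p ∈ G, ZFSet.pair y p = i.1} =>
    have : (i.2.choose).rank < x.rank := fst_rank (p := i.2.choose_spec.choose) (by
      rw [i.2.choose_spec.choose_spec.2]; exact i.1.2)
    val G i.2.choose)
termination_by x.rank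

theorem mem_val {G : Set ZFSet.{u}} {x u : ZFSet.{u}} :
    u ∈ val G x ↔ ∃ y, ∃ p ∈ G, ZFSet.pair y p ∈ x ∧ u = val G y := by
  rw [val, ZFSet.mem_range]
  constructor
  · rintro ⟨i, rfl⟩
    refine ⟨i.2.choose, i.2.choose_spec.choose, i.2.choose_spec.choose_spec.1, ?_, rfl⟩
    rw [i.2.choose_spec.choose_spec.2]; exact i.1.2
  · rintro ⟨y, p, hp, h, rfl⟩
    have h0 : ∃ y', ∃ p' ∈ G, ZFSet.pair y' p' = ZFSet.pair y p := ⟨y, p, hp, rfl⟩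
    refine ⟨⟨⟨_, h⟩, h0⟩, ?_⟩
    have : h0.choose = y := (ZFSet.pair_injective h0.choose_spec.choose_spec.2).1
    show val G h0.choose = _
    rw [this]

theorem val_rank {G : Set ZFSet.{u}} (x : ZFSet.{u}) : (val G x).rank ≤ x.rank := by
  induction h : x.rank using WellFoundedLT.induction generalizing x with
  | ind o ih =>
  rw [ZFSet.rank_le_iff]
  intro u hu
  obtain ⟨y, p, hp, hy, rfl⟩ := mem_val.1 hu
  have := fst_rank hy
  rw [h] at this
  exact (ih _ this y rfl).trans_lt this

section
variable {M P : ZFSet.{u}} {G : Set ZFSet.{u}} [ZFM M] [hP : Fact (P ∈ M)]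

theorem truth_E (hG : Gen M P G) {x : ZFSet.{u}} (hx : x ∈ M) : ∀ y ∈ M, (val G x = val G y ↔ ∃ p ∈ G, E M P x y p) := by
  induction h : x.rank using WellFoundedLT.induction generalizing x with
  | ind o ih =>
  subst h
  intro y hy
  have ih' : ∀ z r, ZFSet.pair z r ∈ x → ∀ w ∈ M, (val G z = val G w ↔ ∃ p ∈ G, E M P z w p) :=
    fun z r hz => ih _ (fst_rank hz) (Trans.fst hz hx) rfl
  have fx : Fact (x ∈ M) := ⟨hx⟩
  have fy : Fact (y ∈ M) := ⟨hy⟩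
  constructor
  · intro he
    obtain ⟨p, hp, h⟩ := hG.dense0 (fun p => E M P x y p ∨
      (∃ z ∈ M, ∃ r ∈ P, ZFSet.pair z r ∈ x ∧ r ⊆ p ∧ ∀ s ∈ P, p ⊆ s →
        ¬ ∃ w ∈ M, ∃ t ∈ P, ZFSet.pair w t ∈ y ∧ t ⊆ s ∧ E M P z w s) ∨
      (∃ w ∈ M, ∃ t ∈ P, ZFSet.pair w t ∈ y ∧ t ⊆ p ∧ ∀ s ∈ P, p ⊆ s →
        ¬ ∃ z ∈ M, ∃ r ∈ P, ZFSet.pair z r ∈ x ∧ r ⊆ s ∧ E M P z w s)) inferInstance (by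
      intro p hp
      by_cases hE : E M P x y p
      · exact ⟨p, hp, fun _ h => h, Or.inl hE⟩
      rw [E_iff hx hy hp, Step, not_and_or] at hE
      push Not at hE
      rcases hE with ⟨z, hz, r, hr, h1, q, hq, h2, h3, h4⟩ | ⟨z, hz, r, hr, h1, q, hq, h2, h3, h4⟩
      · refine ⟨q, hq, h2, Or.inr (Or.inl ⟨z, hz, r, hr, h1, h3, ?_⟩)⟩
        push Not; exact h4
      · refine ⟨q, hq, h2, Or.inr (Or.inr ⟨z, hz, r, hr, h1, h3, ?_⟩)⟩
        push Not; exact h4)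
    rcases h with h | ⟨z, hz, r, hr, h1, h2, h3⟩ | ⟨w, hw, t, ht, h1, h2, h3⟩
    · exact ⟨p, hp, h⟩
    · have : val G z ∈ val G y := by
        rw [← he]; exact mem_val.2 ⟨z, r, hG.up p hp r hr h2, h1, rfl⟩
      obtain ⟨w, t, ht, h4, h5⟩ := mem_val.1 this
      have hw := Trans.fst h4 hy
      obtain ⟨s, hs, h6⟩ := (ih' z r h1 w hw).1 h5
      obtain ⟨a, ha, h7, h8⟩ := hG.dir s hs t ht
      obtain ⟨b, hb, h9, h10⟩ := hG.dir a ha p hp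
      exact absurd ⟨w, hw, t, hG.sub _ ht, h4, fun _ hh => h9 (h8 hh),
        E_mono hz hw (hG.sub _ hs) (hG.sub _ hb) (fun _ hh => h9 (h7 hh)) h6⟩ (h3 b (hG.sub _ hb) h10)
    · have : val G w ∈ val G x := by
        rw [he]; exact mem_val.2 ⟨w, t, hG.up p hp t ht h2, h1, rfl⟩
      obtain ⟨z, r, hr, h4, h5⟩ := mem_val.1 this
      have hz := Trans.fst h4 hx
      obtain ⟨s, hs, h6⟩ := (ih' z r h4 w hw).1 h5.symm
      obtain ⟨a, ha, h7, h8⟩ := hG.dir s hs r hr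
      obtain ⟨b, hb, h9, h10⟩ := hG.dir a ha p hp
      exact absurd ⟨z, hz, r, hG.sub _ hr, h4, fun _ hh => h9 (h8 hh),
        E_mono hz hw (hG.sub _ hs) (hG.sub _ hb) (fun _ hh => h9 (h7 hh)) h6⟩ (h3 b (hG.sub _ hb) h10)
  · rintro ⟨p, hp, h⟩
    rw [E_iff hx hy (hG.sub _ hp)] at h
    ext u
    constructor
    · intro hu
      obtain ⟨z, r, hr, hz, rfl⟩ := mem_val.1 hu
      obtain ⟨q, hq, h1, h2⟩ := hG.dir p hp r hr
      have fz : Fact (z ∈ M) := ⟨Trans.fst hz hx⟩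
      obtain ⟨s, hs, w, hw, t, ht, h3, h4, h5⟩ := hG.dense (fun s => ∃ w ∈ M, ∃ t ∈ P, ZFSet.pair w t ∈ y ∧ t ⊆ s ∧ E M P z w s)
        inferInstance hq (fun q' hq' h3 => h.1 z fz.1 r (hG.sub _ hr) hz q' hq' (fun _ hh => h3 (h1 hh)) (fun _ hh => h3 (h2 hh)))
      exact mem_val.2 ⟨w, t, hG.up s hs t ht h4, h3, (ih' z r hz w hw).2 ⟨s, hs, h5⟩⟩
    · intro hu
      obtain ⟨w, t, ht, hw, rfl⟩ := mem_val.1 hu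
      obtain ⟨q, hq, h1, h2⟩ := hG.dir p hp t ht
      have fw : Fact (w ∈ M) := ⟨Trans.fst hw hy⟩
      obtain ⟨s, hs, z, hz, r, hr, h3, h4, h5⟩ := hG.dense (fun s => ∃ z ∈ M, ∃ r ∈ P, ZFSet.pair z r ∈ x ∧ r ⊆ s ∧ E M P z w s)
        inferInstance hq (fun q' hq' h3 => h.2 w fw.1 t (hG.sub _ ht) hw q' hq' (fun _ hh => h3 (h1 hh)) (fun _ hh => h3 (h2 hh)))
      exact mem_val.2 ⟨z, r, hG.up s hs r hr h4, h3, ((ih' z r h3 w fw.1).2 ⟨s, hs, h5⟩).symm⟩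

end
end CtmForcing

namespace CtmForcing

open FirstOrder FirstOrder.Language


set_option synthInstance.maxSize 4000
set_option synthInstance.maxHeartbeats 200000

theorem term_var {n : ℕ} (t : SetLang.Term (Empty ⊕ Fin n)) : ∃ i, t = Term.var (Sum.inr i) := by
  cases t with
  | var x =>
    rcases x with x | i
    · exact x.elim
    · exact ⟨i, rfl⟩
  | func f _ => exact Empty.elim f

theorem BF_ind {C : ∀ n, BF n → Prop} (hf : ∀ n, C n BoundedFormula.falsum)
    (he : ∀ n i j, C n (eqf i j)) (hm : ∀ n i j, C n (memf i j))
    (hi : ∀ n (φ ψ : BF n), C n φ → C n ψ → C n (φ.imp ψ))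
    (ha : ∀ n (φ : BF (n+1)), C (n+1) φ → C n φ.all) {n : ℕ} (φ : BF n) : C n φ := by
  induction φ with
  | falsum => exact hf _
  | equal t s =>
    obtain ⟨i, rfl⟩ := term_var t
    obtain ⟨j, rfl⟩ := term_var s
    exact he _ i j
  | rel R ts =>
    cases R
    obtain ⟨i, hi⟩ := term_var (ts 0)
    obtain ⟨j, hj⟩ := term_var (ts 1)
    have : ts = ![Term.var (Sum.inr i), Term.var (Sum.inr j)] := by
      funext k
      fin_cases k
      · exact hi
      · exact hj
    subst this
    exact hm _ i j
  | imp _ _ h1 h2 => exact hi _ _ _ h1 h2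
  | all _ h => exact ha _ _ h

/-- the generic extension -/
noncomputable def NN (M : ZFSet.{u}) (G : Set ZFSet.{u}) : ZFSet.{u} := im (val G) M

theorem mem_NN {M u : ZFSet.{u}} {G : Set ZFSet.{u}} : u ∈ NN M G ↔ ∃ x ∈ M, val G x = u := mem_im

theorem val_mem {M x : ZFSet.{u}} (G : Set ZFSet.{u}) (h : x ∈ M) : val G x ∈ NN M G := mem_NN.2 ⟨x, h, rfl⟩

noncomputable def valE {M : ZFSet.{u}} (G : Set ZFSet.{u}) (x : El M) : El (NN M G) := ⟨val G x.1, val_mem G x.2⟩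

structure FR (M P : ZFSet.{u}) {n : ℕ} (φ : BF n) (F : (Fin n → ZFSet.{u}) → ZFSet.{u} → Prop) : Prop where
  defn : Def M (fun e => F (fun i => e (i.1+1)) (e 0))
  mono : ∀ v, (∀ i, v i ∈ M) → ∀ p ∈ P, ∀ q ∈ P, p ⊆ q → F v p → F v q
  reg : ∀ v, (∀ i, v i ∈ M) → ∀ p ∈ P, (∀ q ∈ P, p ⊆ q → ∃ s ∈ P, q ⊆ s ∧ F v s) → F v p
  truth : ∀ G, Gen M P G → ∀ v : Fin n → El M,
    Rz (NN M G) φ (fun i => valE G (v i)) ↔ ∃ p ∈ G, F (fun i => (v i).1) p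

section
variable {M P : ZFSet.{u}} [ZFM M] [hP : Fact (P ∈ M)]

theorem FR.defv {n : ℕ} {φ : BF n} {F : (Fin n → ZFSet.{u}) → ZFSet.{u} → Prop} (h : FR M P φ F)
    (v : Fin n → El M) : Def M (fun e => F (fun i => (v i).1) (e 0)) := by
  have := h.defn.freeze (fun k => if k = 0 then Sum.inl 0 else if hk : k - 1 < n then Sum.inr (v ⟨k-1, hk⟩) else Sum.inl 0)
  simpa using this

theorem forcing {n : ℕ} (φ : BF n) : ∃ F, FR M P φ F := by
  refine BF_ind (C := fun n φ => ∃ F, FR M P φ F) ?_ ?_ ?_ ?_ ?_ φ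
  · intro n
    refine ⟨fun _ _ => False, inferInstance, fun _ _ _ _ _ _ _ h => h, ?_, ?_⟩
    · intro v hv p hp h
      obtain ⟨_, _, _, h⟩ := h p hp (fun _ h => h)
      exact h
    · intro G hG v
      rw [Rz_fls]; simp
  · intro n i j
    refine ⟨fun v p => E M P (v i) (v j) p, inferInstance, ?_, ?_, ?_⟩
    · intro v hv p hp q hq h
      exact E_mono (hv i) (hv j) hp hq h
    · intro v hv p hp h
      exact E_reg (hv i) (hv j) hp h
    · intro G hG v
      rw [Rz_eq]
      exact truth_E hG (v i).2 _ (v j).2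
  · intro n i j
    refine ⟨fun v p => ∀ q ∈ P, p ⊆ q → ∃ s ∈ P, q ⊆ s ∧ ∃ w ∈ M, ∃ t ∈ P, ZFSet.pair w t ∈ v j ∧ t ⊆ s ∧
      E M P (v i) w s, inferInstance, ?_, ?_, ?_⟩
    · intro v hv p hp q hq h h1 q' hq' h2
      exact h1 q' hq' (fun _ hh => h2 (h hh))
    · intro v hv p hp h q hq hpq
      obtain ⟨s, hs, h1, h2⟩ := h q hq hpq
      obtain ⟨s', hs', h3, h4⟩ := h2 s hs (fun _ h => h)
      exact ⟨s', hs', fun _ hh => h3 (h1 hh), h4⟩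
    · intro G hG v
      rw [Rz_mem]
      constructor
      · intro h
        obtain ⟨w, t, ht, h1, h2⟩ := mem_val.1 h
        have hw := Trans.fst h1 (v j).2
        obtain ⟨p, hp, h3⟩ := (truth_E hG (v i).2 _ hw).1 h2
        obtain ⟨r, hr, h4, h5⟩ := hG.dir p hp t ht
        refine ⟨r, hr, fun q hq hrq => ⟨q, hq, fun _ h => h, w, hw, t, hG.sub _ ht, h1, fun _ hh => hrq (h5 hh), ?_⟩⟩
        exact E_mono (v i).2 hw (hG.sub _ hp) hq (fun _ hh => hrq (h4 hh)) h3
      · rintro ⟨p, hp, h⟩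
        have f1 : Fact ((v i).1 ∈ M) := ⟨(v i).2⟩
        have f2 : Fact ((v j).1 ∈ M) := ⟨(v j).2⟩
        obtain ⟨s, hs, w, hw, t, ht, h1, h2, h3⟩ := hG.dense (fun s => ∃ w ∈ M, ∃ t ∈ P, ZFSet.pair w t ∈ (v j).1 ∧ t ⊆ s ∧
          E M P (v i).1 w s) inferInstance hp h
        exact mem_val.2 ⟨w, t, hG.up s hs t ht h2, h1, (truth_E hG (v i).2 _ hw).2 ⟨s, hs, h3⟩⟩
  · rintro n φ ψ ⟨F, hF⟩ ⟨K, hK⟩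
    have hreg : ∀ v, (∀ i, v i ∈ M) → ∀ p ∈ P, (∀ q ∈ P, p ⊆ q → ∃ s ∈ P, q ⊆ s ∧ (∀ q ∈ P, s ⊆ q → F v q → K v q)) →
        (∀ q ∈ P, p ⊆ q → F v q → K v q) := by
      intro v hv p hp h q hq hpq h1
      refine hK.reg v hv q hq ?_
      intro q' hq' hqq
      obtain ⟨s, hs, h2, h3⟩ := h q' hq' (fun _ hh => hqq (hpq hh))
      exact ⟨s, hs, h2, h3 s hs (fun _ h => h) (hF.mono v hv q hq s hs (fun _ hh => h2 (hqq hh)) h1)⟩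
    refine ⟨fun v p => ∀ q ∈ P, p ⊆ q → F v q → K v q, ?_, ?_, hreg, ?_⟩
    · have h1 : Def M (fun e => F (fun i => e (i.1+1+1)) (e 0)) := hF.defn.ren (fun n => if n = 0 then 0 else n + 1)
      have h2 : Def M (fun e => K (fun i => e (i.1+1+1)) (e 0)) := hK.defn.ren (fun n => if n = 0 then 0 else n + 1)
      infer_instance
    · intro v hv p hp q hq h h1 q' hq' h2
      exact h1 q' hq' (fun _ hh => h2 (h hh))
    · intro G hG v
      have d1 := hF.defv v
      have d2 := hK.defv v
      rw [Rz_imp, hF.truth G hG v, hK.truth G hG v]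
      constructor
      · intro h
        have d3 : Def M (fun e => F (fun i => (v i).1) (e 0)) := d1
        have d4 : Def M (fun e => K (fun i => (v i).1) (e 0)) := d2
        obtain ⟨p, hp, h1⟩ := hG.dense0 (fun p => (∀ q ∈ P, p ⊆ q → F (fun i => (v i).1) q → K (fun i => (v i).1) q) ∨
            (F (fun i => (v i).1) p ∧ ∀ q ∈ P, p ⊆ q → ¬ K (fun i => (v i).1) q)) inferInstance (by
          intro p hp
          by_cases h2 : ∀ q ∈ P, p ⊆ q → F (fun i => (v i).1) q → K (fun i => (v i).1) q
          · exact ⟨p, hp, fun _ h => h, Or.inl h2⟩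
          push Not at h2
          obtain ⟨q, hq, h3, h4, h5⟩ := h2
          have h6 := mt (hK.reg (fun i => (v i).1) (fun i => (v i).2) q hq) h5
          push Not at h6
          obtain ⟨s, hs, h7, h8⟩ := h6
          exact ⟨s, hs, fun _ hh => h7 (h3 hh), Or.inr ⟨hF.mono _ (fun i => (v i).2) q hq s hs h7 h4, h8⟩⟩)
        rcases h1 with h1 | ⟨h1, h2⟩
        · exact ⟨p, hp, h1⟩
        · obtain ⟨q, hq, h3⟩ := h ⟨p, hp, h1⟩
          obtain ⟨r, hr, h4, h5⟩ := hG.dir p hp q hq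
          exact absurd (hK.mono _ (fun i => (v i).2) q (hG.sub _ hq) r (hG.sub _ hr) h5 h3) (h2 r (hG.sub _ hr) h4)
      · rintro ⟨p, hp, h⟩ ⟨q, hq, h1⟩
        obtain ⟨r, hr, h4, h5⟩ := hG.dir p hp q hq
        exact ⟨r, hr, h r (hG.sub _ hr) h4 (hF.mono _ (fun i => (v i).2) q (hG.sub _ hq) r (hG.sub _ hr) h5 h1)⟩
  · rintro n φ ⟨F, hF⟩
    have hsn : ∀ (v : Fin n → ZFSet.{u}) x, (∀ i, v i ∈ M) → x ∈ M → ∀ i, (Fin.snoc v x : Fin (n+1) → ZFSet.{u}) i ∈ M := by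
      intro v x hv hx i
      induction i using Fin.lastCases with
      | last => simpa using hx
      | cast i => simpa using hv i
    have hsv : ∀ (G : Set ZFSet.{u}) (v : Fin n → El M) (x : El M),
        (Fin.snoc (fun i => valE G (v i)) (valE G x) : Fin (n+1) → El (NN M G)) =
          fun i => valE G ((Fin.snoc v x : Fin (n+1) → El M) i) := by
      intro G v x
      funext i
      induction i using Fin.lastCases with
      | last => simp
      | cast i => simp
    have hsv' : ∀ (v : Fin n → El M) (x : El M),
        (Fin.snoc (fun i => (v i).1) x.1 : Fin (n+1) → ZFSet.{u}) =
          fun i => ((Fin.snoc v x : Fin (n+1) → El M) i).1 := by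
      intro v x
      funext i
      induction i using Fin.lastCases with
      | last => simp
      | cast i => simp
    refine ⟨fun v p => ∀ x ∈ M, F (Fin.snoc v x) p, ?_, ?_, ?_, ?_⟩
    · have h1 : Def M (fun e => F (Fin.snoc (fun i => e (i.1+1+1)) (e 0)) (e 1)) := by
        have := hF.defn.ren (fun k => if k = 0 then 1 else if k = n + 1 then 0 else k + 1)
        refine Def.congr this (fun e _ => Eq.to_iff ?_)
        refine congrArg₂ F ?_ (by simp)
        · funext i
          induction i using Fin.lastCases with
          | last => simp
          | cast i =>
            have : i.1 ≠ n := by omega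
            simp [this]
      infer_instance
    · intro v hv p hp q hq h h1 x hx
      exact hF.mono _ (hsn v x hv hx) p hp q hq h (h1 x hx)
    · intro v hv p hp h x hx
      refine hF.reg _ (hsn v x hv hx) p hp ?_
      intro q hq hpq
      obtain ⟨s, hs, h1, h2⟩ := h q hq hpq
      exact ⟨s, hs, h1, h2 x hx⟩
    · intro G hG v
      rw [Rz_all]
      have key : ∀ x (hx : x ∈ M), Rz (NN M G) φ (Fin.snoc (fun i => valE G (v i)) (valE G ⟨x, hx⟩)) ↔
          ∃ p ∈ G, F (Fin.snoc (fun i => (v i).1) x) p := by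
        intro x hx
        rw [hsv, hF.truth G hG, ← hsv']
      constructor
      · intro h
        have d1 : Def M (fun e => F (Fin.snoc (fun i => (v i).1) (e 0)) (e 1)) := by
          have := hF.defn.freeze (fun k => if k = 0 then Sum.inl 1 else if k = n + 1 then Sum.inl 0 else
            if hk : k - 1 < n then Sum.inr (v ⟨k-1, hk⟩) else Sum.inl 0)
          refine Def.congr this (fun e _ => Eq.to_iff ?_)
          refine congrArg₂ F ?_ (by simp)
          · funext i
            induction i using Fin.lastCases with
            | last => simp
            | cast i =>
              have : i.1 ≠ n := by omega
              simp [this]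
        have d2 : Def M (fun e => F (Fin.snoc (fun i => (v i).1) (e 1)) (e 0)) :=
          Def.app2 (R := fun a b => F (Fin.snoc (fun i => (v i).1) a) b) d1 (tmVar 1) (tmVar 0)
        obtain ⟨p, hp, h1⟩ := hG.dense0 (fun p => (∀ x ∈ M, F (Fin.snoc (fun i => (v i).1) x) p) ∨
          ∃ x ∈ M, ∀ q ∈ P, p ⊆ q → ¬ F (Fin.snoc (fun i => (v i).1) x) q) inferInstance (by
          intro p hp
          by_cases h2 : ∀ x ∈ M, F (Fin.snoc (fun i => (v i).1) x) p
          · exact ⟨p, hp, fun _ h => h, Or.inl h2⟩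
          push Not at h2
          obtain ⟨x, hx, h2⟩ := h2
          have h6 := mt (hF.reg _ (hsn _ x (fun i => (v i).2) hx) p hp) h2
          push Not at h6
          obtain ⟨s, hs, h7, h8⟩ := h6
          exact ⟨s, hs, h7, Or.inr ⟨x, hx, h8⟩⟩)
        rcases h1 with h1 | ⟨x, hx, h1⟩
        · exact ⟨p, hp, h1⟩
        · obtain ⟨q, hq, h2⟩ := (key x hx).1 (h _ (valE G ⟨x, hx⟩).2)
          obtain ⟨r, hr, h4, h5⟩ := hG.dir p hp q hq
          exact absurd (hF.mono _ (hsn _ x (fun i => (v i).2) hx) q (hG.sub _ hq) r (hG.sub _ hr) h5 h2) (h1 r (hG.sub _ hr) h4)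
      · rintro ⟨p, hp, h⟩ y hy
        obtain ⟨x, hx, rfl⟩ := mem_NN.1 hy
        exact (key x hx).2 ⟨p, hp, h x hx⟩

/-- forcing relation for a relation definable in the extension -/
theorem forces2 {G : Set ZFSet.{u}} (hG : Gen M P G) (Q : ZFSet.{u} → ZFSet.{u} → Prop)
    (hQ : Def (NN M G) (fun e => Q (e 0) (e 1))) :
    ∃ F : ZFSet.{u} → ZFSet.{u} → ZFSet.{u} → Prop, Def M (fun e => F (e 0) (e 1) (e 2)) ∧
      ∀ x ∈ M, ∀ y ∈ M, (Q (val G x) (val G y) ↔ ∃ p ∈ G, F x y p) := by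
  obtain ⟨n, φ, t, h⟩ := hQ
  obtain ⟨F, hF⟩ := forcing (M := M) (P := P) φ
  have hc : ∀ c : El (NN M G), ∃ x : El M, valE G x = c := by
    rintro ⟨c, hc⟩
    obtain ⟨x, hx, rfl⟩ := mem_NN.1 hc
    exact ⟨⟨x, hx⟩, rfl⟩
  choose g hg using hc
  classical
  let s : ℕ → ℕ ⊕ El M := fun k => if k = 0 then Sum.inl 2 else if hk : k - 1 < n then
    (match t ⟨k-1, hk⟩ with | Sum.inl 0 => Sum.inl 0 | Sum.inl (_+1) => Sum.inl 1 | Sum.inr c => Sum.inr (g c)) else Sum.inl 0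
  let F' : ZFSet.{u} → ZFSet.{u} → ZFSet.{u} → Prop := fun x y p =>
    F (fun i => match t i with | Sum.inl 0 => x | Sum.inl (_+1) => y | Sum.inr c => (g c).1) p
  refine ⟨F', ?_, ?_⟩
  · have := hF.defn.freeze s
    refine Def.congr this (fun e _ => Eq.to_iff ?_)
    refine congrArg₂ F ?_ (by simp [s])
    · funext i
      simp only [s]
      rw [if_neg (by omega), dif_pos (by simp)]
      simp only [Nat.add_sub_cancel]
      rcases t i with (_ | j) | c <;> rfl
  · intro x hx y hy
    have h1 := h (fun k => match k with | 0 => valE G ⟨x, hx⟩ | (_+1) => valE G ⟨y, hy⟩)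
    have h2 := hF.truth G hG (fun i => match t i with | Sum.inl 0 => ⟨x, hx⟩ | Sum.inl (_+1) => ⟨y, hy⟩ | Sum.inr c => g c)
    refine h1.trans (Eq.to_iff ?_ |>.trans (h2.trans (Eq.to_iff ?_)))
    · congr 1
      funext i
      rcases t i with (_ | j) | c
      · rfl
      · rfl
      · exact (hg c).symm
    · congr 1
      funext p
      congr 2
      funext i
      rcases t i with (_ | j) | c <;> rfl

end
end CtmForcing

namespace CtmForcing

open FirstOrder FirstOrder.Language


set_option synthInstance.maxSize 4000
set_option synthInstance.maxHeartbeats 200000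

/-- canonical names -/
noncomputable def check (x : ZFSet.{u}) : ZFSet.{u} :=
  ZFSet.range (fun i : x =>
    have : i.1.rank < x.rank := ZFSet.rank_lt_of_mem i.2
    ZFSet.pair (check i.1) ∅)
termination_by x.rank

theorem mem_check {x z : ZFSet.{u}} : z ∈ check x ↔ ∃ y ∈ x, z = ZFSet.pair (check y) ∅ := by
  rw [check, ZFSet.mem_range]
  constructor
  · rintro ⟨i, rfl⟩; exact ⟨i.1, i.2, rfl⟩
  · rintro ⟨y, hy, rfl⟩; exact ⟨⟨y, hy⟩, rfl⟩

noncomputable def upn (x y : ZFSet.{u}) : ZFSet.{u} := {ZFSet.pair x ∅, ZFSet.pair y ∅}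

noncomputable def opn (x y : ZFSet.{u}) : ZFSet.{u} := upn (upn x x) (upn x y)

section
variable {M P : ZFSet.{u}} {G : Set ZFSet.{u}} [ZFM M]

theorem mk_surj {a b h : ZFSet.{u}} (ha : a ∈ M) (hb : b ∈ M) (hh : h ∈ M) (hne : ∃ d, d ∈ b)
    (hf : ∀ x y y', ZFSet.pair x y ∈ h → ZFSet.pair x y' ∈ h → y = y')
    (hc : ∀ y ∈ b, ∃ x ∈ a, ZFSet.pair x y ∈ h) : ∃ f ∈ M, IsSurj a b f := by
  obtain ⟨d, hd⟩ := hne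
  have f1 : Fact (a ∈ M) := ⟨ha⟩
  have f2 : Fact (b ∈ M) := ⟨hb⟩
  have f3 : Fact (h ∈ M) := ⟨hh⟩
  have f4 : Fact (d ∈ M) := ⟨Trans.tr _ _ hd hb⟩
  let f := ZFSet.sep (fun u => ∃ x ∈ a, ∃ y ∈ b, u = ZFSet.pair x y ∧ (ZFSet.pair x y ∈ h ∨
    (y = d ∧ ∀ y' ∈ b, ¬ ZFSet.pair x y' ∈ h))) (prodZ a b)
  have hmem : ∀ x y, ZFSet.pair x y ∈ f ↔ x ∈ a ∧ y ∈ b ∧ (ZFSet.pair x y ∈ h ∨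
    (y = d ∧ ∀ y' ∈ b, ¬ ZFSet.pair x y' ∈ h)) := by
    intro x y
    simp only [f, ZFSet.mem_sep, pair_mem_prodZ]
    constructor
    · rintro ⟨_, x', hx, y', hy, h1, h2⟩
      obtain ⟨rfl, rfl⟩ := ZFSet.pair_injective h1
      exact ⟨hx, hy, h2⟩
    · rintro ⟨hx, hy, h2⟩
      exact ⟨⟨hx, hy⟩, x, hx, y, hy, rfl, h2⟩
  refine ⟨f, ZFM.sp _ _ inferInstance (tmem inferInstance), ⟨?_, ?_⟩, ?_, ?_⟩
  · intro u hu
    obtain ⟨x, hx, y, hy, h1, _⟩ := (ZFSet.mem_sep.1 hu).2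
    exact ⟨x, hx, y, hy, h1⟩
  · intro x hx
    by_cases h1 : ∃ y ∈ b, ZFSet.pair x y ∈ h
    · obtain ⟨y, hy, h1⟩ := h1
      exact ⟨y, hy, (hmem _ _).2 ⟨hx, hy, Or.inl h1⟩⟩
    · push Not at h1
      exact ⟨d, hd, (hmem _ _).2 ⟨hx, hd, Or.inr ⟨rfl, h1⟩⟩⟩
  · intro x y y' h1 h2
    obtain ⟨_, hy, h1⟩ := (hmem _ _).1 h1
    obtain ⟨_, hy', h2⟩ := (hmem _ _).1 h2
    rcases h1 with h1 | ⟨h1, h1'⟩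
    · rcases h2 with h2 | ⟨h2, h2'⟩
      · exact hf _ _ _ h1 h2
      · exact absurd h1 (h2' _ hy)
    · rcases h2 with h2 | ⟨h2, h2'⟩
      · exact absurd h2 (h1' _ hy')
      · rw [h1, h2]
  · intro y hy
    obtain ⟨x, hx, h1⟩ := hc y hy
    exact ⟨x, hx, (hmem _ _).2 ⟨hx, hy, Or.inl h1⟩⟩

instance tmCheck {a : (ℕ → ZFSet.{u}) → ZFSet.{u}} [ha : Tm M a] : Tm M (fun e => check (a e)) := by
  refine Tm.app1 (F := check) (recn (fun A => im (fun y => ZFSet.pair y ∅) A) inferInstance check ?_) ha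
  intro x _
  ext z
  simp only [mem_check, mem_im]
  constructor
  · rintro ⟨y, hy, rfl⟩; exact ⟨_, ⟨y, hy, rfl⟩, rfl⟩
  · rintro ⟨_, ⟨y, hy, rfl⟩, rfl⟩; exact ⟨y, hy, rfl⟩

instance tmUpn {a b : (ℕ → ZFSet.{u}) → ZFSet.{u}} [ha : Tm M a] [hb : Tm M b] :
    Tm M (fun e => upn (a e) (b e)) := by unfold upn; infer_instance

instance tmOpn {a b : (ℕ → ZFSet.{u}) → ZFSet.{u}} [ha : Tm M a] [hb : Tm M b] :
    Tm M (fun e => opn (a e) (b e)) := by unfold opn; infer_instance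

theorem check_mem {x : ZFSet.{u}} (hx : x ∈ M) : check x ∈ M := by
  have : Fact (x ∈ M) := ⟨hx⟩
  exact tmem inferInstance

theorem opn_mem {x y : ZFSet.{u}} (hx : x ∈ M) (hy : y ∈ M) : opn x y ∈ M := by
  have : Fact (x ∈ M) := ⟨hx⟩
  have : Fact (y ∈ M) := ⟨hy⟩
  exact tmem inferInstance

theorem NN_trans : Trans (NN M G) := ⟨fun x y hx hy => by
  obtain ⟨y', hy', rfl⟩ := mem_NN.1 hy
  obtain ⟨z, p, _, h, rfl⟩ := mem_val.1 hx
  exact val_mem G (Trans.fst h hy')⟩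

variable [hP : Fact (P ∈ M)]

theorem im_val_mem (hG : Gen M P G) {T : ZFSet.{u}} (hT : T ∈ M) : im (val G) T ∈ NN M G := by
  have : Fact (T ∈ M) := ⟨hT⟩
  refine mem_NN.2 ⟨im (fun y => ZFSet.pair y ∅) T, tmem inferInstance, ?_⟩
  ext u
  simp only [mem_val, mem_im]
  constructor
  · rintro ⟨y, p, hp, ⟨z, hz, h⟩, rfl⟩
    rw [← (ZFSet.pair_injective h).1]
    exact ⟨z, hz, rfl⟩
  · rintro ⟨y, hy, rfl⟩
    exact ⟨y, ∅, hG.emp, ⟨y, hy, rfl⟩, rfl⟩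

theorem val_check (hG : Gen M P G) (x : ZFSet.{u}) : val G (check x) = x := by
  induction x using ZFSet.inductionOn with
  | h x ih =>
  ext u
  simp only [mem_val, mem_check]
  constructor
  · rintro ⟨y, p, hp, ⟨z, hz, h⟩, rfl⟩
    rw [(ZFSet.pair_injective h).1, ih z hz]
    exact hz
  · intro hu
    exact ⟨check u, ∅, hG.emp, ⟨u, hu, rfl⟩, (ih u hu).symm⟩

theorem val_upn (hG : Gen M P G) (x y : ZFSet.{u}) : val G (upn x y) = {val G x, val G y} := by
  ext u
  simp only [mem_val, upn, ZFSet.mem_pair]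
  constructor
  · rintro ⟨z, p, hp, h | h, rfl⟩
    · rw [(ZFSet.pair_injective h).1]; exact Or.inl rfl
    · rw [(ZFSet.pair_injective h).1]; exact Or.inr rfl
  · rintro (rfl | rfl)
    · exact ⟨x, ∅, hG.emp, Or.inl rfl, rfl⟩
    · exact ⟨y, ∅, hG.emp, Or.inr rfl, rfl⟩

theorem val_opn (hG : Gen M P G) (x y : ZFSet.{u}) : val G (opn x y) = ZFSet.pair (val G x) (val G y) := by
  rw [opn, val_upn hG, val_upn hG, val_upn hG, ZFSet.pair, ZFSet.pair_eq_singleton]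

theorem sub_NN (hG : Gen M P G) : M ⊆ NN M G := fun x hx => mem_NN.2 ⟨check x, check_mem hx, val_check hG x⟩

theorem NN_TP (hG : Gen M P G) : TP (NN M G) :=
  { NN_trans (M := M) (G := G) with
    pr := by
      intro x y hx hy
      obtain ⟨x, hx1, rfl⟩ := mem_NN.1 hx
      obtain ⟨y, hy1, rfl⟩ := mem_NN.1 hy
      have : Fact (x ∈ M) := ⟨hx1⟩
      have : Fact (y ∈ M) := ⟨hy1⟩
      exact mem_NN.2 ⟨upn x y, tmem inferInstance, val_upn hG x y⟩ }

theorem fst_tc {a y p : ZFSet.{u}} (ha : a ∈ M) (h : ZFSet.pair y p ∈ a) : y ∈ tc M a := pair_tc (sub_tc ha h)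

/-- nice names for subsets: separation in the extension -/
theorem NN_sep (hG : Gen M P G) (Q : ZFSet.{u} → Prop) {a : ZFSet.{u}} (ha : a ∈ M)
    (hQ : Def (NN M G) (fun e => Q (e 0))) :
    ∃ b ∈ M, b ⊆ prodZ (tc M a) P ∧ val G b = ZFSet.sep Q (val G a) := by
  have := NN_TP hG
  have fa : Fact (a ∈ M) := ⟨ha⟩
  obtain ⟨F, hF, h⟩ := forces2 hG (fun x y => x ∈ y ∧ Q x) (@Def.and _ _ _ inferInstance hQ)
  have hF' : Def M (fun e => F (e 1) a (e 0)) := Def.app3 hF (tmVar 1) inferInstance (tmVar 0)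
  have hmem : ∀ y p, ZFSet.pair y p ∈ ZFSet.sep (fun u => ∃ y ∈ M, ∃ p ∈ M, u = ZFSet.pair y p ∧ F y a p)
      (prodZ (tc M a) P) ↔ y ∈ tc M a ∧ p ∈ P ∧ F y a p := by
    intro y p
    simp only [ZFSet.mem_sep, pair_mem_prodZ]
    constructor
    · rintro ⟨⟨h1, h2⟩, y', _, p', _, h3, h4⟩
      obtain ⟨rfl, rfl⟩ := ZFSet.pair_injective h3
      exact ⟨h1, h2, h4⟩
    · rintro ⟨h1, h2, h4⟩
      exact ⟨⟨h1, h2⟩, y, Trans.tr _ _ h1 (tc_mem ha), p, Trans.tr _ _ h2 hP.1, rfl, h4⟩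
  refine ⟨_, ZFM.sp (fun u => ∃ y ∈ M, ∃ p ∈ M, u = ZFSet.pair y p ∧ F y a p) (prodZ (tc M a) P) inferInstance
    (tmem inferInstance), fun u hu => (ZFSet.mem_sep.1 hu).1, ?_⟩
  ext u
  rw [mem_val, ZFSet.mem_sep]
  constructor
  · rintro ⟨y, p, hp, h1, rfl⟩
    obtain ⟨h1, h2, h3⟩ := (hmem _ _).1 h1
    exact (h y (Trans.tr _ _ h1 (tc_mem ha)) a ha).2 ⟨p, hp, h3⟩
  · rintro ⟨h1, h2⟩
    obtain ⟨y, p, hp, h3, rfl⟩ := mem_val.1 h1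
    have hy := fst_tc ha h3
    obtain ⟨p, hp, h4⟩ := (h y (Trans.tr _ _ hy (tc_mem ha)) a ha).1 ⟨h1, h2⟩
    exact ⟨y, p, hp, (hmem _ _).2 ⟨hy, hG.sub _ hp, h4⟩, rfl⟩

theorem NN_sp (hG : Gen M P G) (Q : ZFSet.{u} → Prop) (A : ZFSet.{u})
    (hQ : Def (NN M G) (fun e => Q (e 0))) (hA : A ∈ NN M G) : ZFSet.sep Q A ∈ NN M G := by
  obtain ⟨a, ha, rfl⟩ := mem_NN.1 hA
  obtain ⟨b, hb, _, h⟩ := NN_sep hG Q ha hQ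
  rw [← h]; exact val_mem G hb

theorem NN_ZFM (hG : Gen M P G) : ZFM (NN M G) := by
  have tp := NN_TP hG
  refine { tp with un := ?_, pw := ?_, omM := sub_NN hG ZFM.omM, sp := fun Q A h1 h2 => NN_sp hG Q A h1 h2, rp := ?_ }
  · intro x hx
    have fx : Fact (x ∈ NN M G) := ⟨hx⟩
    obtain ⟨a, ha, rfl⟩ := mem_NN.1 hx
    have h1 := im_val_mem hG (tc_mem ha)
    have h2 := NN_sp hG (fun z => ∃ y ∈ val G a, z ∈ y) _ inferInstance h1
    convert h2 using 1
    ext z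
    rw [ZFSet.mem_sUnion, ZFSet.mem_sep]
    refine ⟨fun h => ⟨?_, h⟩, fun h => h.2⟩
    obtain ⟨y, hy, hz⟩ := h
    obtain ⟨b, p, hp, h3, rfl⟩ := mem_val.1 hy
    obtain ⟨c, q, hq, h4, rfl⟩ := mem_val.1 hz
    exact mem_im.2 ⟨c, pair_tc (tc_trans (fst_tc ha h3) h4), rfl⟩
  · intro x hx
    have fx : Fact (x ∈ NN M G) := ⟨hx⟩
    obtain ⟨a, ha, rfl⟩ := mem_NN.1 hx
    have fa : Fact (a ∈ M) := ⟨ha⟩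
    have h0 : powM M (prodZ (tc M a) P) ∈ M := tmem inferInstance
    have h1 := im_val_mem hG h0
    have h2 := NN_sp hG (fun z => z ⊆ val G a) _ inferInstance h1
    convert h2 using 1
    ext z
    rw [ZFSet.mem_sep, ZFSet.mem_sep, ZFSet.mem_powerset, and_comm]
    refine and_congr_left fun hz => ⟨fun h => ?_, fun h => ?_⟩
    · have fz : Fact (z ∈ NN M G) := ⟨h⟩
      obtain ⟨b, hb, h3, h4⟩ := NN_sep hG (fun w => w ∈ z) ha inferInstance
      refine mem_im.2 ⟨b, ZFSet.mem_sep.2 ⟨ZFSet.mem_powerset.2 h3, hb⟩, ?_⟩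
      rw [h4]
      ext w
      rw [ZFSet.mem_sep]
      exact ⟨fun h => h.2, fun h => ⟨hz h, h⟩⟩
    · exact Trans.tr _ _ h h1
  · intro R A hR hA hfun
    have fA : Fact (A ∈ NN M G) := ⟨hA⟩
    obtain ⟨a, ha, rfl⟩ := mem_NN.1 hA
    have fa : Fact (a ∈ M) := ⟨ha⟩
    obtain ⟨F, hF, h⟩ := forces2 hG R hR
    have hF' : Def M (fun e => F (e 1) (e 3) (e 0)) := Def.app3 hF (tmVar 1) (tmVar 3) (tmVar 0)
    obtain ⟨B, hB, hB'⟩ := collection (M := M) (fun w u => ∃ y ∈ M, ∃ p ∈ M, w = ZFSet.pair y p ∧ F y u p)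
      (prodZ (tc M a) P) inferInstance (tmem inferInstance)
    have hR' : Def (NN M G) (fun e => R (e 0) (e 1)) := hR
    refine ⟨_, NN_sp hG (fun v => ∃ x ∈ val G a, R x v) _ inferInstance (im_val_mem hG hB), ?_⟩
    intro y
    rw [ZFSet.mem_sep]
    refine and_congr_left ?_
    rintro ⟨x, hx, hxy⟩
    refine ⟨fun h => Trans.tr _ _ h (im_val_mem hG hB), fun hy => ?_⟩
    obtain ⟨x', p, hp, h1, rfl⟩ := mem_val.1 hx
    obtain ⟨y', hy', rfl⟩ := mem_NN.1 hy
    have hx' := fst_tc ha h1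
    have hx'M := Trans.tr _ _ hx' (tc_mem ha)
    obtain ⟨q, hq, h2⟩ := (h x' hx'M y' hy').1 hxy
    have hqM := Trans.tr _ _ (hG.sub _ hq) hP.1
    obtain ⟨u, hu, x'', _, q', _, h3, h4⟩ := hB' (ZFSet.pair x' q) (pair_mem_prodZ.2 ⟨hx', hG.sub _ hq⟩) ⟨y', hy', x', hx'M, q, hqM, rfl, h2⟩
    obtain ⟨rfl, rfl⟩ := ZFSet.pair_injective h3
    have huM := Trans.tr _ _ hu hB
    have := (h x' hx'M u huM).2 ⟨q, hq, h4⟩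
    rw [hfun _ hx _ hy _ (val_mem G huM) hxy this]
    exact mem_im.2 ⟨u, hu, rfl⟩

theorem NN_AC (hG : Gen M P G) (hac : ACM M) : ACM (NN M G) := by
  have := NN_ZFM hG
  intro x hx
  obtain ⟨a, ha, rfl⟩ := mem_NN.1 hx
  by_cases hne : ∃ d, d ∈ val G a
  · obtain ⟨α, hα, f, hf, hα', hs⟩ := hac _ (tc_mem ha)
    have ff : Fact (f ∈ M) := ⟨hf⟩
    obtain ⟨S, hS, hS'⟩ := ZFM.rp (M := M) (fun u s => ∃ β ∈ M, ∃ y ∈ M, u = ZFSet.pair β y ∧ s = opn (check β) y) f inferInstance hf (by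
      rintro _ _ s _ s' _ ⟨β, _, y, _, rfl, rfl⟩ ⟨β', _, y', _, h, rfl⟩
      obtain ⟨rfl, rfl⟩ := ZFSet.pair_injective h; rfl)
    have hm : ∀ β v, ZFSet.pair β v ∈ im (val G) S ↔ ∃ y, ZFSet.pair β y ∈ f ∧ v = val G y := by
      intro β v
      rw [mem_im]
      constructor
      · rintro ⟨s, hs, h⟩
        obtain ⟨_, _, h2, β', _, y, _, rfl, rfl⟩ := (hS' s).1 hs
        rw [val_opn hG, val_check hG] at h
        obtain ⟨rfl, rfl⟩ := ZFSet.pair_injective h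
        exact ⟨y, h2, rfl⟩
      · rintro ⟨y, h, rfl⟩
        have h1 := Trans.fst h hf
        have h2 := Trans.snd h hf
        refine ⟨opn (check β) y, (hS' _).2 ⟨opn_mem (check_mem h1) h2, _, h, β, h1, y, h2, rfl, rfl⟩, ?_⟩
        rw [val_opn hG, val_check hG]
    obtain ⟨g, hg, hg'⟩ := mk_surj (sub_NN hG hα) hx (im_val_mem hG hS) hne (by
      intro β v v' h1 h2
      obtain ⟨y, h3, rfl⟩ := (hm _ _).1 h1
      obtain ⟨y', h4, rfl⟩ := (hm _ _).1 h2
      rw [hs.2.1 _ _ _ h3 h4]) (by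
      intro v hv
      obtain ⟨y, p, hp, h, rfl⟩ := mem_val.1 hv
      obtain ⟨β, hβ, h1⟩ := hs.2.2 y (fst_tc ha h)
      exact ⟨β, hβ, (hm _ _).2 ⟨y, h1, rfl⟩⟩)
    exact ⟨α, sub_NN hG hα, g, hg, hα', hg'⟩
  · have : val G a = ∅ := by
      rw [ZFSet.eq_empty]; exact fun y hy => hne ⟨y, hy⟩
    rw [this]
    refine ⟨∅, empty_mem, ∅, empty_mem, ⟨ZFSet.isTransitive_empty, by simp⟩, ?_⟩
    simp [IsSurj]

theorem isOrd_iff {x : ZFSet.{u}} : IsOrd x ↔ x.IsOrdinal := ZFSet.isOrdinal_iff_forall_mem_isTransitive.symm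

theorem NN_ord (hG : Gen M P G) {α : ZFSet.{u}} (hα : IsOrd α) (h : α ∈ NN M G) : α ∈ M := by
  obtain ⟨x, hx, rfl⟩ := mem_NN.1 h
  have fx : Fact (x ∈ M) := ⟨hx⟩
  have hO : ZFSet.sep IsOrd (Sg M x) ∈ M := ZFM.sp _ _ inferInstance (tmem inferInstance)
  have hO' : (ZFSet.sep IsOrd (Sg M x)).IsOrdinal := by
    rw [ZFSet.isOrdinal_iff_forall_mem_isTransitive]
    refine ⟨?_, fun y hy => (ZFSet.mem_sep.1 hy).2.1⟩
    intro y hy z hz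
    obtain ⟨h1, h2⟩ := ZFSet.mem_sep.1 hy
    obtain ⟨h3, h4⟩ := mem_Sg.1 h1
    exact ZFSet.mem_sep.2 ⟨mem_Sg.2 ⟨Trans.tr _ _ hz h3, (ZFSet.rank_lt_of_mem hz).le.trans h4⟩,
      isOrd_iff.2 ((isOrd_iff.1 h2).mem hz)⟩
  rcases ZFSet.IsOrdinal.mem_trichotomous (isOrd_iff.1 hα) hO' with h1 | h1 | h1
  · exact Trans.tr _ _ h1 hO
  · rw [h1]; exact hO
  · exfalso
    refine ZFSet.mem_irrefl _ (ZFSet.mem_sep.2 ⟨mem_Sg.2 ⟨hO, ?_⟩, isOrd_iff.2 hO'⟩)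
    exact (ZFSet.rank_lt_of_mem h1).le.trans (val_rank x)

theorem NN_countable (hc : (M : Set ZFSet.{u}).Countable) : (NN M G : Set ZFSet.{u}).Countable := by
  have : (NN M G : Set ZFSet.{u}) = val G '' (M : Set ZFSet.{u}) := by
    ext u; exact mem_NN
  rw [this]
  exact hc.image _

end
end CtmForcing

namespace CtmForcing

open FirstOrder FirstOrder.Language


set_option synthInstance.maxSize 4000
set_option synthInstance.maxHeartbeats 200000

/-- functional relations -/
def Fn (M f : ZFSet.{u}) : Prop :=
  ∀ x ∈ M, ∀ y ∈ M, ∀ y' ∈ M, ZFSet.pair x y ∈ f → ZFSet.pair x y' ∈ f → y = y'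

/-- injective relations -/
def Ij (M f : ZFSet.{u}) : Prop :=
  ∀ x ∈ M, ∀ x' ∈ M, ∀ y ∈ M, ZFSet.pair x y ∈ f → ZFSet.pair x' y ∈ f → x = x'

/-- countability in `M` -/
def Cnt (M a : ZFSet.{u}) : Prop := ∃ f ∈ M, Fn M f ∧ ∀ u ∈ a, ∃ n ∈ om, ZFSet.pair n u ∈ f

section
variable {M : ZFSet.{u}} [ZFM M]

theorem Fn.eq {f x y y' : ZFSet.{u}} (h : Fn M f) (hf : f ∈ M) (h1 : ZFSet.pair x y ∈ f)
    (h2 : ZFSet.pair x y' ∈ f) : y = y' :=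
  h x (Trans.fst h1 hf) y (Trans.snd h1 hf) y' (Trans.snd h2 hf) h1 h2

theorem Ij.eq {f x x' y : ZFSet.{u}} (h : Ij M f) (hf : f ∈ M) (h1 : ZFSet.pair x y ∈ f)
    (h2 : ZFSet.pair x' y ∈ f) : x = x' :=
  h x (Trans.fst h1 hf) x' (Trans.fst h2 hf) y (Trans.snd h1 hf) h1 h2

instance Def.fn {a : (ℕ → ZFSet.{u}) → ZFSet.{u}} [ha : Tm M a] : Def M (fun e => Fn M (a e)) :=
  Def.app1 (R := Fn M) (by unfold Fn; infer_instance) ha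

instance Def.ij {a : (ℕ → ZFSet.{u}) → ZFSet.{u}} [ha : Tm M a] : Def M (fun e => Ij M (a e)) :=
  Def.app1 (R := Ij M) (by unfold Ij; infer_instance) ha

instance Def.cnt {a : (ℕ → ZFSet.{u}) → ZFSet.{u}} [ha : Tm M a] : Def M (fun e => Cnt M (a e)) :=
  Def.app1 (R := Cnt M) (by unfold Cnt; infer_instance) ha

theorem relM (R : ZFSet.{u} → ZFSet.{u} → Prop) (hR : Def M (fun e => R (e 0) (e 1))) {A B : ZFSet.{u}}
    (hA : A ∈ M) (hB : B ∈ M) :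
    ∃ h ∈ M, (∀ x y, ZFSet.pair x y ∈ h ↔ x ∈ A ∧ y ∈ B ∧ R x y) ∧ h ⊆ prodZ A B := by
  have fA : Fact (A ∈ M) := ⟨hA⟩
  have fB : Fact (B ∈ M) := ⟨hB⟩
  have hR' : Def M (fun e => R (e 1) (e 0)) := Def.app2 hR (tmVar 1) (tmVar 0)
  refine ⟨ZFSet.sep (fun w => ∃ x ∈ M, ∃ y ∈ M, w = ZFSet.pair x y ∧ R x y) (prodZ A B),
    ZFM.sp _ _ inferInstance (tmem inferInstance), ?_, fun w hw => (ZFSet.mem_sep.1 hw).1⟩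
  intro x y
  rw [ZFSet.mem_sep, pair_mem_prodZ]
  constructor
  · rintro ⟨⟨h1, h2⟩, x', _, y', _, h3, h4⟩
    obtain ⟨rfl, rfl⟩ := ZFSet.pair_injective h3
    exact ⟨h1, h2, h4⟩
  · rintro ⟨h1, h2, h4⟩
    exact ⟨⟨h1, h2⟩, x, Trans.tr _ _ h1 hA, y, Trans.tr _ _ h2 hB, rfl, h4⟩

theorem wf_min (C : ZFSet.{u} → Prop) (h : ∃ x, C x) : ∃ x, C x ∧ ∀ y ∈ x, ¬ C y := by
  obtain ⟨x, hx⟩ := h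
  obtain ⟨m, h1, h2⟩ := ZFSet.mem_wf.has_min {x | C x} ⟨x, hx⟩
  exact ⟨m, h1, fun y hy hc => h2 y hc hy⟩

theorem unif (hac : ACM M) {Q : ZFSet.{u}} (hQ : Q ∈ M) :
    ∃ c ∈ M, c ⊆ Q ∧ Fn M c ∧ ∀ x y, ZFSet.pair x y ∈ Q → ∃ y', ZFSet.pair x y' ∈ c := by
  obtain ⟨α, hα, f, hf, hord, hs⟩ := hac Q hQ
  have f1 : Fact (α ∈ M) := ⟨hα⟩
  have f2 : Fact (f ∈ M) := ⟨hf⟩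
  have f3 : Fact (Q ∈ M) := ⟨hQ⟩
  let c := ZFSet.sep (fun w => ∃ x ∈ M, ∃ y ∈ M, w = ZFSet.pair x y ∧ ∃ ξ ∈ α, ZFSet.pair ξ (ZFSet.pair x y) ∈ f ∧
    ∀ η ∈ ξ, ∀ y' ∈ M, ¬ ZFSet.pair η (ZFSet.pair x y') ∈ f) Q
  have hm : ∀ x y, ZFSet.pair x y ∈ c → ∃ ξ ∈ α, ZFSet.pair ξ (ZFSet.pair x y) ∈ f ∧
    ∀ η ∈ ξ, ∀ y' ∈ M, ¬ ZFSet.pair η (ZFSet.pair x y') ∈ f := by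
    intro x y h
    obtain ⟨x', _, y', _, h3, h4⟩ := (ZFSet.mem_sep.1 h).2
    obtain ⟨rfl, rfl⟩ := ZFSet.pair_injective h3
    exact h4
  refine ⟨c, ZFM.sp _ _ inferInstance hQ, fun w hw => (ZFSet.mem_sep.1 hw).1, ?_, ?_⟩
  · intro x _ y hy y' hy' h1 h2
    obtain ⟨ξ, h3, h4, h5⟩ := hm _ _ h1
    obtain ⟨η, h6, h7, h8⟩ := hm _ _ h2
    have ho := isOrd_iff.1 hord
    rcases ZFSet.IsOrdinal.mem_trichotomous (ho.mem h3) (ho.mem h6) with h | h | h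
    · exact absurd h4 (h8 _ h _ hy)
    · subst h
      exact (ZFSet.pair_injective (hs.2.1 _ _ _ h4 h7)).2
    · exact absurd h7 (h5 _ h _ hy')
  · intro x y h
    obtain ⟨ξ, ⟨y', h1⟩, h2⟩ := wf_min (fun ξ => ∃ y, ZFSet.pair ξ (ZFSet.pair x y) ∈ f) (by
      obtain ⟨ξ, _, h1⟩ := hs.2.2 _ h
      exact ⟨ξ, y, h1⟩)
    obtain ⟨ξ', h3, w, h4, h5⟩ := hs.1.1 _ h1
    obtain ⟨rfl, rfl⟩ := ZFSet.pair_injective h5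
    exact ⟨y', ZFSet.mem_sep.2 ⟨h4, x, Trans.fst h4 hQ, y', Trans.snd h4 hQ, rfl, ξ, h3, h1, fun η hη y'' _ hh => h2 η hη ⟨_, hh⟩⟩⟩

theorem choiceM (hac : ACM M) (R : ZFSet.{u} → ZFSet.{u} → Prop) (hR : Def M (fun e => R (e 0) (e 1))) {A : ZFSet.{u}}
    (hA : A ∈ M) : ∃ c ∈ M, Fn M c ∧ (∀ x y, ZFSet.pair x y ∈ c → x ∈ A ∧ R x y) ∧
      ∀ x ∈ A, (∃ y ∈ M, R x y) → ∃ y, ZFSet.pair x y ∈ c := by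
  obtain ⟨B, hB, h⟩ := collection (M := M) R A hR hA
  obtain ⟨Q, hQ, h1, _⟩ := relM R hR hA hB
  obtain ⟨c, hc, h2, h3, h4⟩ := unif hac hQ
  refine ⟨c, hc, h3, fun x y hxy => ?_, fun x hx hy => ?_⟩
  · have := (h1 _ _).1 (h2 hxy); exact ⟨this.1, this.2.2⟩
  · obtain ⟨y, hy, hr⟩ := h x hx hy
    exact h4 x y ((h1 _ _).2 ⟨hx, hy, hr⟩)

theorem dc (hac : ACM M) {P : ZFSet.{u}} (hP : P ∈ M) (R : ZFSet.{u} → ZFSet.{u} → ZFSet.{u} → Prop)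
    (hR : Def M (fun e => R (e 0) (e 1) (e 2))) (h : ∀ n, ∀ p ∈ P, ∃ q ∈ P, R (nat n) p q) {p : ZFSet.{u}} (hp : p ∈ P) :
    ∃ s : ℕ → ZFSet.{u}, seqZ s ∈ M ∧ s 0 = p ∧ ∀ n, s n ∈ P ∧ R (nat n) (s n) (s (n+1)) := by
  have f1 : Fact (P ∈ M) := ⟨hP⟩
  have hR' : Def M (fun e => R (e 1) (e 0) (e 3)) := Def.app3 hR (tmVar 1) (tmVar 0) (tmVar 3)
  obtain ⟨c, hc, h1, h2, h3⟩ := choiceM hac (fun w q => ∃ n ∈ M, ∃ p ∈ M, w = ZFSet.pair n p ∧ q ∈ P ∧ R n p q)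
    inferInstance (A := prodZ om P) (tmem inferInstance)
  have h4 : ∀ n (x : El P), ∃ y : El P, ZFSet.pair (ZFSet.pair (nat n) x.1) y.1 ∈ c ∧ R (nat n) x.1 y.1 := by
    intro n x
    obtain ⟨q, hq, hr⟩ := h n x.1 x.2
    obtain ⟨y, hy⟩ := h3 (ZFSet.pair (nat n) x.1) (pair_mem_prodZ.2 ⟨nat_mem_om n, x.2⟩)
      ⟨q, Trans.tr _ _ hq hP, nat n, nat_mem n, x.1, Trans.tr _ _ x.2 hP, rfl, hq, hr⟩
    obtain ⟨_, n', _, p', _, h5, h6, h7⟩ := h2 _ _ hy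
    obtain ⟨rfl, rfl⟩ := ZFSet.pair_injective h5
    exact ⟨⟨y, h6⟩, hy, h7⟩
  choose g hg using h4
  let s : ℕ → El P := fun n => Nat.rec ⟨p, hp⟩ (fun n x => g n x) n
  have hsn : ∀ n, s (n+1) = g n (s n) := fun n => rfl
  have fc : Fact (c ∈ M) := ⟨hc⟩
  refine ⟨fun n => (s n).1, ?_, rfl, fun n => ⟨(s n).2, ?_⟩⟩
  · refine iter_mem _ (fun n => Trans.tr _ _ (s n).2 hP) (fun n x z => ZFSet.pair (ZFSet.pair n x) z ∈ c) inferInstance ?_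
    intro n z _
    have := (hg n (s n)).1
    rw [hsn]
    exact ⟨fun h => h1.eq hc h this, fun h => h ▸ this⟩
  · exact (hg n (s n)).2

/-- the walk through `ω × ω` -/
def wk : ℕ → ℕ × ℕ
  | 0 => (0, 0)
  | n+1 => match wk n with
    | (a, 0) => (0, a+1)
    | (a, b+1) => (a+1, b)

theorem wk_surj : ∀ k a b, a + b = k → ∃ n, wk n = (a, b) := by
  intro k
  induction k with
  | zero => intro a b h; obtain ⟨rfl, rfl⟩ : a = 0 ∧ b = 0 := by omega
            exact ⟨0, rfl⟩
  | succ k ih =>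
    intro a
    induction a with
    | zero =>
      intro b h
      obtain ⟨n, hn⟩ := ih k 0 rfl
      refine ⟨n+1, ?_⟩
      rw [wk, hn]; simp; omega
    | succ a iha =>
      intro b h
      obtain ⟨n, hn⟩ := iha (b+1) (by omega)
      refine ⟨n+1, ?_⟩
      rw [wk, hn]

theorem succ_inj {a b : ℕ} : nat.{u} a = insert (nat b) (nat b) ↔ a = b + 1 :=
  ⟨fun h => nat_inj (h.trans rfl), fun h => h ▸ rfl⟩

theorem walk : ∃ W ∈ M, Fn M W ∧ ∀ a ∈ om, ∀ b ∈ om, ∃ n ∈ om, ZFSet.pair n (ZFSet.pair a b) ∈ W := by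
  let s : ℕ → ZFSet.{u} := fun n => ZFSet.pair (nat (wk n).1) (nat (wk n).2)
  have hs : seqZ s ∈ M := by
    refine iter_mem s (fun n => TP.pair (nat_mem _) (nat_mem _)) (fun _ x z => ∃ a ∈ om, ∃ b ∈ om, x = ZFSet.pair a b ∧
      ((b = ∅ ∧ z = ZFSet.pair ∅ (insert a a)) ∨ ∃ b' ∈ om, b = insert b' b' ∧ z = ZFSet.pair (insert a a) b'))
      inferInstance ?_
    intro n z _
    simp only [s]
    rw [wk]
    rcases h : wk n with ⟨a, b⟩
    have hn0 : ∀ b, nat.{u} (b+1) ≠ ∅ := fun b hb => by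
      have := nat_inj (hb.trans (show ∅ = nat.{u} 0 from rfl)); omega
    constructor
    · rintro ⟨a', ha, b', hb, h1, h2⟩
      obtain ⟨rfl, rfl⟩ := ZFSet.pair_injective h1
      rcases h2 with ⟨h2, rfl⟩ | ⟨b', hb', h2, rfl⟩
      · rcases b with _ | b
        · rfl
        · exact absurd h2 (hn0 b)
      · obtain ⟨b', rfl⟩ := mem_om.1 hb'
        have := succ_inj.1 h2
        simp only at this
        subst this
        rfl
    · rintro rfl
      refine ⟨_, nat_mem_om a, _, nat_mem_om b, rfl, ?_⟩
      rcases b with _ | b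
      · exact Or.inl ⟨rfl, rfl⟩
      · exact Or.inr ⟨nat b, nat_mem_om b, rfl, rfl⟩
  refine ⟨seqZ s, hs, ?_, ?_⟩
  · intro x _ y _ y' _ h1 h2
    obtain ⟨n, hn⟩ := mem_seqZ.1 h1
    obtain ⟨rfl, rfl⟩ := ZFSet.pair_injective hn
    exact (pair_mem_seqZ.1 h2).symm
  · intro a ha b hb
    obtain ⟨a, rfl⟩ := mem_om.1 ha
    obtain ⟨b, rfl⟩ := mem_om.1 hb
    obtain ⟨n, hn⟩ := wk_surj _ a b rfl
    exact ⟨nat n, nat_mem_om n, pair_mem_seqZ.2 (by simp only [s]; rw [hn])⟩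

theorem cnt_union (hac : ACM M) {s : ℕ → ZFSet.{u}} (hs : seqZ s ∈ M) (hc : ∀ n, Cnt M (s n)) {U : ZFSet.{u}} (hU : U ∈ M)
    (h : ∀ u ∈ U, ∃ n, u ∈ s n) : Cnt M U := by
  have f1 : Fact (seqZ s ∈ M) := ⟨hs⟩
  have f2 : Fact (U ∈ M) := ⟨hU⟩
  obtain ⟨c, hcM, h1, h2, h3⟩ := choiceM hac (fun x f => ∃ y ∈ M, ZFSet.pair x y ∈ seqZ s ∧ Fn M f ∧
    ∀ u ∈ y, ∃ n ∈ om, ZFSet.pair n u ∈ f) inferInstance (A := om) ZFM.omM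
  obtain ⟨W, hW, h4, h5⟩ := walk (M := M)
  have f3 : Fact (c ∈ M) := ⟨hcM⟩
  have f4 : Fact (W ∈ M) := ⟨hW⟩
  obtain ⟨g, hg, h6, _⟩ := relM (M := M) (fun k u => ∃ n ∈ om, ∃ m ∈ om, ZFSet.pair k (ZFSet.pair n m) ∈ W ∧
    ∃ f ∈ M, ZFSet.pair n f ∈ c ∧ ZFSet.pair m u ∈ f) inferInstance ZFM.omM hU
  refine ⟨g, hg, ?_, ?_⟩
  · intro k _ u _ u' _ hu hu'
    obtain ⟨_, _, n, _, m, _, a1, f, hf, a2, a3⟩ := (h6 _ _).1 hu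
    obtain ⟨_, _, n', _, m', _, b1, f', _, b2, b3⟩ := (h6 _ _).1 hu'
    obtain ⟨rfl, rfl⟩ := ZFSet.pair_injective (h4.eq hW a1 b1)
    obtain rfl := h1.eq hcM a2 b2
    obtain ⟨_, y, _, _, a4, _⟩ := h2 _ _ a2
    exact a4.eq hf a3 b3
  · intro u hu
    obtain ⟨n, hn⟩ := h u hu
    obtain ⟨f, hf, h7, h8⟩ := hc n
    obtain ⟨f', a2⟩ := h3 (nat n) (nat_mem_om n) ⟨f, hf, s n, Trans.snd (pair_mem_seqZ.2 rfl) hs, pair_mem_seqZ.2 rfl, h7, h8⟩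
    obtain ⟨_, y, _, a3, _, a4⟩ := h2 _ _ a2
    obtain rfl := pair_mem_seqZ.1 a3
    obtain ⟨m, hm, a5⟩ := a4 u hn
    obtain ⟨k, hk, a6⟩ := h5 _ (nat_mem_om n) m hm
    exact ⟨k, hk, (h6 _ _).2 ⟨hk, hu, nat n, nat_mem_om n, m, hm, a6, f', Trans.snd a2 hcM, a2, a5⟩⟩

theorem cnt_im {a b h : ZFSet.{u}} (ha : Cnt M a) (hb : b ∈ M) (hh : h ∈ M) (hf : Fn M h)
    (hc : ∀ v ∈ b, ∃ u ∈ a, ZFSet.pair u v ∈ h) : Cnt M b := by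
  obtain ⟨f, hfM, h1, h2⟩ := ha
  have f1 : Fact (f ∈ M) := ⟨hfM⟩
  have f2 : Fact (h ∈ M) := ⟨hh⟩
  obtain ⟨g, hg, h6, _⟩ := relM (M := M) (fun k v => ∃ u ∈ M, ZFSet.pair k u ∈ f ∧ ZFSet.pair u v ∈ h) inferInstance ZFM.omM hb
  refine ⟨g, hg, ?_, ?_⟩
  · intro k _ v _ v' _ hv hv'
    obtain ⟨_, _, u, _, a1, a2⟩ := (h6 _ _).1 hv
    obtain ⟨_, _, u', _, b1, b2⟩ := (h6 _ _).1 hv'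
    obtain rfl := h1.eq hfM a1 b1
    exact hf.eq hh a2 b2
  · intro v hv
    obtain ⟨u, hu, a1⟩ := hc v hv
    obtain ⟨n, hn, a2⟩ := h2 u hu
    exact ⟨n, hn, (h6 _ _).2 ⟨hn, hv, u, Trans.fst a1 hh, a2, a1⟩⟩

theorem cnt_empty : Cnt M ∅ := ⟨∅, empty_mem, by intro x _ y _ y' _ h; simp at h, by simp⟩

theorem cnt_insert (hac : ACM M) {x a : ZFSet.{u}} (hx : x ∈ M) (ha : a ∈ M) (h : Cnt M a) : Cnt M (insert x a) := by
  have f1 : Fact (x ∈ M) := ⟨hx⟩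
  have f2 : Fact (a ∈ M) := ⟨ha⟩
  have h0 : Cnt M {x} := by
    refine ⟨{ZFSet.pair ∅ x}, tmem inferInstance, ?_, ?_⟩
    · intro z _ y _ y' _ h1 h2
      rw [ZFSet.mem_singleton] at h1 h2
      rw [(ZFSet.pair_injective h1).2, (ZFSet.pair_injective h2).2]
    · intro u hu
      rw [ZFSet.mem_singleton] at hu
      exact ⟨∅, nat_mem_om 0, by rw [hu]; simp⟩
  let s : ℕ → ZFSet.{u} := fun n => Nat.casesOn n a (fun _ => {x})
  have hs : seqZ s ∈ M := by
    refine iter_mem s ?_ (fun _ _ z => z = {x}) inferInstance (fun n z _ => Iff.rfl)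
    rintro (_ | n)
    · exact ha
    · exact TP.single hx
  refine cnt_union hac hs ?_ (tmem inferInstance) ?_
  · rintro (_ | n)
    · exact h
    · exact h0
  · intro u hu
    rw [ZFSet.mem_insert_iff] at hu
    rcases hu with rfl | hu
    · exact ⟨1, ZFSet.mem_singleton.2 rfl⟩
    · exact ⟨0, hu⟩

theorem mem_powM {x y : ZFSet.{u}} : y ∈ powM M x ↔ y ⊆ x ∧ y ∈ M := by
  simp [powM, ZFSet.mem_sep]

theorem cantor : ¬ Cnt M (powM M om) := by
  rintro ⟨f, hf, h1, h2⟩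
  have f1 : Fact (f ∈ M) := ⟨hf⟩
  have hD : ZFSet.sep (fun n => ∀ x ∈ M, ZFSet.pair n x ∈ f → n ∉ x) om ∈ powM M om :=
    mem_powM.2 ⟨fun w hw => (ZFSet.mem_sep.1 hw).1, ZFM.sp _ _ inferInstance ZFM.omM⟩
  obtain ⟨n, hn, h3⟩ := h2 _ hD
  have key : n ∉ ZFSet.sep (fun n => ∀ x ∈ M, ZFSet.pair n x ∈ f → n ∉ x) om := fun h =>
    (ZFSet.mem_sep.1 h).2 _ (mem_powM.1 hD).2 h3 h
  refine key (ZFSet.mem_sep.2 ⟨hn, fun x _ hx => ?_⟩)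
  rw [h1.eq hf hx h3]
  exact key

theorem exists_w1 (hac : ACM M) : ∃ w ∈ M, IsOrd w ∧ ¬ Cnt M w ∧ ∀ x ∈ w, Cnt M x := by
  have hpp : powM M om ∈ M := tmem inferInstance
  obtain ⟨α, ⟨h1, h2, h3⟩, h4⟩ := wf_min (fun α => α ∈ M ∧ IsOrd α ∧ ¬ Cnt M α) (by
    obtain ⟨α, hα, f, hf, ho, hs⟩ := hac _ hpp
    refine ⟨α, hα, ho, fun hc => cantor (cnt_im hc hpp hf (fun x _ y _ y' _ a b => hs.2.1 x y y' a b) hs.2.2)⟩)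
  refine ⟨α, h1, h2, h3, fun x hx => ?_⟩
  by_contra hc
  exact h4 x hx ⟨Trans.tr _ _ hx h1, isOrd_iff.2 ((isOrd_iff.1 h2).mem hx), hc⟩

end
end CtmForcing

namespace CtmForcing

open FirstOrder FirstOrder.Language


set_option synthInstance.maxSize 4000
set_option synthInstance.maxHeartbeats 200000

/-- countable partial injections -/
noncomputable def Cd (M X w : ZFSet.{u}) : ZFSet.{u} :=
  ZFSet.sep (fun p => Fn M p ∧ Ij M p ∧ Cnt M p) (powM M (prodZ X w))

section
variable {M X w : ZFSet.{u}} [ZFM M]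

theorem mem_Cd {p : ZFSet.{u}} : p ∈ Cd M X w ↔ p ⊆ prodZ X w ∧ p ∈ M ∧ Fn M p ∧ Ij M p ∧ Cnt M p := by
  rw [Cd, ZFSet.mem_sep, mem_powM]; tauto

theorem Cd_mem (hX : X ∈ M) (hw : w ∈ M) : Cd M X w ∈ M := by
  have f1 : Fact (X ∈ M) := ⟨hX⟩
  have f2 : Fact (w ∈ M) := ⟨hw⟩
  exact ZFM.sp _ _ inferInstance (tmem inferInstance)

theorem Cd_empty : ∅ ∈ Cd M X w :=
  mem_Cd.2 ⟨by intro x hx; simp at hx, empty_mem, by intro x _ y _ y' _ h; simp at h,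
    by intro x _ y _ y' _ h; simp at h, cnt_empty⟩

theorem Cd_insert (hac : ACM M) (hX : X ∈ M) (hw : w ∈ M) {p x y : ZFSet.{u}} (hp : p ∈ Cd M X w) (hx : x ∈ X) (hy : y ∈ w)
    (h1 : ∀ y', ZFSet.pair x y' ∉ p) (h2 : ∀ x', ZFSet.pair x' y ∉ p) : insert (ZFSet.pair x y) p ∈ Cd M X w := by
  obtain ⟨a1, a2, a3, a4, a5⟩ := mem_Cd.1 hp
  have hxM := Trans.tr _ _ hx hX
  have hyM := Trans.tr _ _ hy hw
  have f1 : Fact (x ∈ M) := ⟨hxM⟩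
  have f2 : Fact (y ∈ M) := ⟨hyM⟩
  have f3 : Fact (p ∈ M) := ⟨a2⟩
  refine mem_Cd.2 ⟨?_, tmem inferInstance, ?_, ?_, cnt_insert hac (TP.pair hxM hyM) a2 a5⟩
  · intro u hu
    rcases ZFSet.mem_insert_iff.1 hu with rfl | hu
    · exact pair_mem_prodZ.2 ⟨hx, hy⟩
    · exact a1 hu
  · intro z _ v _ v' _ b1 b2
    rcases ZFSet.mem_insert_iff.1 b1 with b1 | b1 <;> rcases ZFSet.mem_insert_iff.1 b2 with b2 | b2
    · rw [(ZFSet.pair_injective b1).2, (ZFSet.pair_injective b2).2]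
    · rw [(ZFSet.pair_injective b1).1] at b2; exact absurd b2 (h1 _)
    · rw [(ZFSet.pair_injective b2).1] at b1; exact absurd b1 (h1 _)
    · exact a3.eq a2 b1 b2
  · intro z _ z' _ v _ b1 b2
    rcases ZFSet.mem_insert_iff.1 b1 with b1 | b1 <;> rcases ZFSet.mem_insert_iff.1 b2 with b2 | b2
    · rw [(ZFSet.pair_injective b1).1, (ZFSet.pair_injective b2).1]
    · rw [(ZFSet.pair_injective b1).2] at b2; exact absurd b2 (h2 _)
    · rw [(ZFSet.pair_injective b2).2] at b1; exact absurd b1 (h2 _)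
    · exact a4.eq a2 b1 b2

theorem dom_small (hX : X ∈ M) (hw : w ∈ M) (hXc : ¬ Cnt M X) {p : ZFSet.{u}} (hp : p ∈ Cd M X w) :
    ∃ x ∈ X, ∀ y, ZFSet.pair x y ∉ p := by
  obtain ⟨a1, a2, a3, a4, a5⟩ := mem_Cd.1 hp
  have f1 : Fact (X ∈ M) := ⟨hX⟩
  have f2 : Fact (w ∈ M) := ⟨hw⟩
  by_contra! hcon
  obtain ⟨h, hh, h1, _⟩ := relM (M := M) (fun u x => ∃ y ∈ M, u = ZFSet.pair x y) inferInstance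
    (A := prodZ X w) (tmem inferInstance) hX
  refine hXc (cnt_im a5 hX hh ?_ ?_)
  · intro z _ v _ v' _ b1 b2
    obtain ⟨_, _, y, _, rfl⟩ := (h1 _ _).1 b1
    obtain ⟨_, _, y', _, b3⟩ := (h1 _ _).1 b2
    exact (ZFSet.pair_injective b3).1
  · intro x hx
    obtain ⟨y, hy⟩ := hcon x hx
    exact ⟨_, hy, (h1 _ _).2 ⟨a1 hy, hx, y, Trans.snd hy a2, rfl⟩⟩

theorem ran_small (hX : X ∈ M) (hw : w ∈ M) (hwc : ¬ Cnt M w) {p : ZFSet.{u}} (hp : p ∈ Cd M X w) :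
    ∃ y ∈ w, ∀ x, ZFSet.pair x y ∉ p := by
  obtain ⟨a1, a2, a3, a4, a5⟩ := mem_Cd.1 hp
  have f1 : Fact (X ∈ M) := ⟨hX⟩
  have f2 : Fact (w ∈ M) := ⟨hw⟩
  by_contra! hcon
  obtain ⟨h, hh, h1, _⟩ := relM (M := M) (fun u y => ∃ x ∈ M, u = ZFSet.pair x y) inferInstance
    (A := prodZ X w) (tmem inferInstance) hw
  refine hwc (cnt_im a5 hw hh ?_ ?_)
  · intro z _ v _ v' _ b1 b2
    obtain ⟨_, _, y, _, rfl⟩ := (h1 _ _).1 b1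
    obtain ⟨_, _, y', _, b3⟩ := (h1 _ _).1 b2
    exact (ZFSet.pair_injective b3).2
  · intro y hy
    obtain ⟨x, hx⟩ := hcon y hy
    exact ⟨_, hx, (h1 _ _).2 ⟨a1 hx, hy, x, Trans.fst hx a2, rfl⟩⟩

theorem dense_dom (hac : ACM M) (hX : X ∈ M) (hw : w ∈ M) (hwc : ¬ Cnt M w) {p x : ZFSet.{u}} (hp : p ∈ Cd M X w)
    (hx : x ∈ X) : ∃ q ∈ Cd M X w, p ⊆ q ∧ ∃ y ∈ w, ZFSet.pair x y ∈ q := by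
  by_cases h : ∃ y, ZFSet.pair x y ∈ p
  · obtain ⟨y, hy⟩ := h
    exact ⟨p, hp, fun _ h => h, y, (pair_mem_prodZ.1 ((mem_Cd.1 hp).1 hy)).2, hy⟩
  · push Not at h
    obtain ⟨y, hy, h2⟩ := ran_small hX hw hwc hp
    exact ⟨_, Cd_insert hac hX hw hp hx hy h h2, fun _ h => ZFSet.mem_insert_of_mem _ h, y, hy, ZFSet.mem_insert _ _⟩

theorem dense_ran (hac : ACM M) (hX : X ∈ M) (hw : w ∈ M) (hXc : ¬ Cnt M X) {p y : ZFSet.{u}} (hp : p ∈ Cd M X w)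
    (hy : y ∈ w) : ∃ q ∈ Cd M X w, p ⊆ q ∧ ∃ x ∈ X, ZFSet.pair x y ∈ q := by
  by_cases h : ∃ x, ZFSet.pair x y ∈ p
  · obtain ⟨x, hx⟩ := h
    exact ⟨p, hp, fun _ h => h, x, (pair_mem_prodZ.1 ((mem_Cd.1 hp).1 hx)).1, hx⟩
  · push Not at h
    obtain ⟨x, hx, h2⟩ := dom_small hX hw hXc hp
    exact ⟨_, Cd_insert hac hX hw hp hx hy h2 h, fun _ h => ZFSet.mem_insert_of_mem _ h, x, hx, ZFSet.mem_insert _ _⟩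

theorem Cd_closed (hac : ACM M) (hX : X ∈ M) (hw : w ∈ M) {s : ℕ → ZFSet.{u}} (hs : seqZ s ∈ M)
    (h1 : ∀ n, s n ∈ Cd M X w) (h2 : ∀ n, s n ⊆ s (n+1)) : ∃ q ∈ Cd M X w, ∀ n, s n ⊆ q := by
  have f1 : Fact (X ∈ M) := ⟨hX⟩
  have f2 : Fact (w ∈ M) := ⟨hw⟩
  have f3 : Fact (seqZ s ∈ M) := ⟨hs⟩
  let U := ZFSet.sep (fun u => ∃ n ∈ om, ∃ p ∈ M, ZFSet.pair n p ∈ seqZ s ∧ u ∈ p) (prodZ X w)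
  have hUM : U ∈ M := ZFM.sp _ _ inferInstance (tmem inferInstance)
  have hU : ∀ u, u ∈ U ↔ ∃ n, u ∈ s n := by
    intro u
    simp only [U, ZFSet.mem_sep]
    constructor
    · rintro ⟨_, n, hn, p, _, h3, h4⟩
      obtain ⟨n, rfl⟩ := mem_om.1 hn
      obtain rfl := pair_mem_seqZ.1 h3
      exact ⟨n, h4⟩
    · rintro ⟨n, hn⟩
      exact ⟨(mem_Cd.1 (h1 n)).1 hn, nat n, nat_mem_om n, s n, (mem_Cd.1 (h1 n)).2.1, pair_mem_seqZ.2 rfl, hn⟩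
  have hmono : ∀ m n, m ≤ n → s m ⊆ s n := by
    intro m n h
    induction h with
    | refl => exact fun _ h => h
    | step _ ih => exact fun _ h => h2 _ (ih h)
  refine ⟨U, mem_Cd.2 ⟨fun u hu => (ZFSet.mem_sep.1 hu).1, hUM, ?_, ?_, ?_⟩, fun n u hu => (hU u).2 ⟨n, hu⟩⟩
  · intro x _ y _ y' _ b1 b2
    obtain ⟨m, b3⟩ := (hU _).1 b1
    obtain ⟨n, b4⟩ := (hU _).1 b2
    obtain ⟨_, a2, a3, a4, _⟩ := mem_Cd.1 (h1 (max m n))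
    exact a3.eq a2 (hmono _ _ (le_max_left _ _) b3) (hmono _ _ (le_max_right _ _) b4)
  · intro x _ y _ y' _ b1 b2
    obtain ⟨m, b3⟩ := (hU _).1 b1
    obtain ⟨n, b4⟩ := (hU _).1 b2
    obtain ⟨_, a2, a3, a4, _⟩ := mem_Cd.1 (h1 (max m n))
    exact a4.eq a2 (hmono _ _ (le_max_left _ _) b3) (hmono _ _ (le_max_right _ _) b4)
  · exact cnt_union hac hs (fun n => (mem_Cd.1 (h1 n)).2.2.2.2) hUM (fun u hu => (hU u).1 hu)

theorem distrib (hac : ACM M) (hX : X ∈ M) (hw : w ∈ M) (D : ZFSet.{u} → ZFSet.{u} → Prop)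
    (hD : Def M (fun e => D (e 0) (e 1))) (hm : ∀ n, ∀ p ∈ Cd M X w, ∀ q ∈ Cd M X w, p ⊆ q → D (nat n) p → D (nat n) q)
    (hd : ∀ n, ∀ p ∈ Cd M X w, ∃ q ∈ Cd M X w, p ⊆ q ∧ D (nat n) q) {p : ZFSet.{u}} (hp : p ∈ Cd M X w) :
    ∃ q ∈ Cd M X w, p ⊆ q ∧ ∀ n, D (nat n) q := by
  have hD' : Def M (fun e => D (e 0) (e 2)) := Def.app2 hD (tmVar 0) (tmVar 2)
  obtain ⟨s, h1, rfl, h2⟩ := dc hac (Cd_mem hX hw) (fun n p q => p ⊆ q ∧ D n q) inferInstance hd hp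
  obtain ⟨q, hq, h3⟩ := Cd_closed hac hX hw h1 (fun n => (h2 n).1) (fun n => (h2 n).2.1)
  exact ⟨q, hq, h3 0, fun n => hm n _ (h2 (n+1)).1 _ hq (h3 _) (h2 n).2.2⟩

theorem FR.truth3 {P : ZFSet.{u}} {φ : BF 3} {F : (Fin 3 → ZFSet.{u}) → ZFSet.{u} → Prop} (h : FR M P φ F)
    {G : Set ZFSet.{u}} (hG : Gen M P G) {a b c : ZFSet.{u}} (ha : a ∈ M) (hb : b ∈ M) (hc : c ∈ M) :
    Rz (NN M G) φ ![⟨val G a, val_mem G ha⟩, ⟨val G b, val_mem G hb⟩, ⟨val G c, val_mem G hc⟩] ↔ ∃ p ∈ G, F ![a, b, c] p := by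
  have := h.truth G hG ![⟨a, ha⟩, ⟨b, hb⟩, ⟨c, hc⟩]
  refine Iff.trans (Eq.to_iff ?_) (this.trans (Eq.to_iff ?_))
  · congr 1
    funext i
    fin_cases i <;> rfl
  · congr 1
    funext p
    congr 2
    funext i
    fin_cases i <;> rfl

theorem FR.def3 {P : ZFSet.{u}} {φ : BF 3} {F : (Fin 3 → ZFSet.{u}) → ZFSet.{u} → Prop} (h : FR M P φ F)
    {a b c d : (ℕ → ZFSet.{u}) → ZFSet.{u}} (ha : Tm M a) (hb : Tm M b) (hc : Tm M c) (hd : Tm M d) :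
    Def M (fun e => F ![a e, b e, c e] (d e)) := by
  refine Def.app4 (R := fun x y z p => F ![x, y, z] p) ?_ ha hb hc hd
  refine Def.congr (h.defn.ren (fun n => if n = 0 then 3 else n - 1)) (fun e _ => Eq.to_iff ?_)
  refine congrArg₂ F ?_ rfl
  funext i
  fin_cases i <;> rfl

theorem no_new (hac : ACM M) (hcount : (M : Set ZFSet.{u}).Countable) (hX : X ∈ M) (hw : w ∈ M) {G : Set ZFSet.{u}}
    (hG : Gen M (Cd M X w) G) {f B : ZFSet.{u}} (hf : f ∈ NN M G) (hB : B ∈ M)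
    (h1 : ∀ n ∈ om, ∃ b ∈ B, ZFSet.pair n b ∈ f) (h2 : ∀ n b b', ZFSet.pair n b ∈ f → ZFSet.pair n b' ∈ f → b = b') :
    ∃ g ∈ M, ∀ n b, ZFSet.pair n b ∈ g ↔ n ∈ om ∧ b ∈ B ∧ ZFSet.pair n b ∈ f := by
  have hP : Fact (Cd M X w ∈ M) := ⟨Cd_mem hX hw⟩
  obtain ⟨a, ha, rfl⟩ := mem_NN.1 hf
  obtain ⟨F1, hF1⟩ := forcing (M := M) (P := Cd M X w) (((memf 3 0).imp ((andF (memf 4 1) (reindex ![3, 4, 2] relMemF)).ex)).all)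
  obtain ⟨F2, hF2⟩ := forcing (M := M) (P := Cd M X w) relMemF
  have t1 : ∀ G', Gen M (Cd M X w) G' → ((∀ n ∈ om, ∃ b ∈ B, ZFSet.pair n b ∈ val G' a) ↔ ∃ p ∈ G', F1 ![check om, check B, a] p) := by
    intro G' hG'
    have := NN_TP hG'
    rw [← hF1.truth3 hG' (check_mem ZFM.omM) (check_mem hB) ha, Rz_total]
    simp [val_check hG']
  have t2 : ∀ G', Gen M (Cd M X w) G' → ∀ n ∈ M, ∀ b ∈ M, (ZFSet.pair n b ∈ val G' a ↔ ∃ p ∈ G', F2 ![check n, check b, a] p) := by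
    intro G' hG' n hn b hb
    have := NN_TP hG'
    rw [← hF2.truth3 hG' (check_mem hn) (check_mem hb) ha, Rz_relMem]
    simp [val_check hG']
  obtain ⟨p0, hp0, h3⟩ := (t1 G hG).1 h1
  have fa : Fact (a ∈ M) := ⟨ha⟩
  have fB : Fact (B ∈ M) := ⟨hB⟩
  have fp : Fact (p0 ∈ M) := ⟨Trans.tr _ _ (hG.sub _ hp0) hP.1⟩
  have d1 : Def M (fun e => F2 ![check (e 1), check (e 0), a] (e 2)) := hF2.def3 inferInstance inferInstance inferInstance inferInstance
  have mono2 : ∀ n ∈ M, ∀ b ∈ M, ∀ p ∈ Cd M X w, ∀ q ∈ Cd M X w, p ⊆ q → F2 ![check n, check b, a] p → F2 ![check n, check b, a] q := by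
    intro n hn b hb
    refine hF2.mono _ ?_
    intro i
    fin_cases i
    · exact check_mem hn
    · exact check_mem hb
    · exact ha
  have key : ∀ n, ∀ r ∈ Cd M X w, p0 ⊆ r → ∃ q ∈ Cd M X w, r ⊆ q ∧ ∃ b ∈ B, F2 ![check (nat n), check b, a] q := by
    intro n r hr hpr
    obtain ⟨G', hG', hrG⟩ := exists_gen hcount hP.1 Cd_empty hr
    obtain ⟨b, hb, h4⟩ := (t1 G' hG').2 ⟨p0, hG'.up r hrG p0 (hG.sub _ hp0) hpr, h3⟩ _ (nat_mem_om n)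
    have hbM := Trans.tr _ _ hb hB
    obtain ⟨s, hs, h5⟩ := (t2 G' hG' _ (nat_mem n) b hbM).1 h4
    obtain ⟨q, hq, h6, h7⟩ := hG'.dir r hrG s hs
    exact ⟨q, hG'.sub _ hq, h6, b, hb, mono2 _ (nat_mem n) b hbM s (hG'.sub _ hs) q (hG'.sub _ hq) h7 h5⟩
  obtain ⟨q, hq, h4⟩ := hG.dense (fun q => ∀ n ∈ om, ∃ b ∈ B, F2 ![check n, check b, a] q) inferInstance hp0 (by
    intro q hq hpq
    have d2 : Def M (fun e => F2 ![check (e 1), check (e 0), a] (e 2)) := d1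
    have d3 : Def M (fun e => ∃ b ∈ B, F2 ![check (e 0), check b, a] (e 1)) := inferInstance
    obtain ⟨s, hs, h5, h6⟩ := distrib hac hX hw (fun n r => (¬ ∃ t ∈ Cd M X w, p0 ⊆ t ∧ r ⊆ t) ∨
        ∃ b ∈ B, F2 ![check n, check b, a] r) inferInstance (by
      rintro n p hp r hr hpr (h | ⟨b, hb, h⟩)
      · exact Or.inl (fun ⟨t, ht, h5, h6⟩ => h ⟨t, ht, h5, fun _ h => h6 (hpr h)⟩)
      · exact Or.inr ⟨b, hb, mono2 _ (nat_mem n) b (Trans.tr _ _ hb hB) p hp r hr hpr h⟩) (by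
      intro n r hr
      by_cases h : ∃ t ∈ Cd M X w, p0 ⊆ t ∧ r ⊆ t
      · obtain ⟨t, ht, h5, h6⟩ := h
        obtain ⟨q, hq, h7, h8⟩ := key n t ht h5
        exact ⟨q, hq, fun _ h => h7 (h6 h), Or.inr h8⟩
      · exact ⟨r, hr, fun _ h => h, Or.inl h⟩) hq
    refine ⟨s, hs, h5, ?_⟩
    intro n hn
    obtain ⟨n, rfl⟩ := mem_om.1 hn
    exact (h6 n).resolve_left (fun h => h ⟨s, hs, fun _ h => h5 (hpq h), fun _ h => h⟩))
  have hqM := Trans.tr _ _ (hG.sub _ hq) hP.1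
  have fq : Fact (q ∈ M) := ⟨hqM⟩
  have d4 : Def M (fun e => F2 ![check (e 0), check (e 1), a] q) := hF2.def3 inferInstance inferInstance inferInstance inferInstance
  obtain ⟨g, hg, h5, _⟩ := relM (M := M) (fun n b => F2 ![check n, check b, a] q) d4 ZFM.omM hB
  refine ⟨g, hg, fun n b => (h5 n b).trans (and_congr_right fun hn => and_congr_right fun hb => ?_)⟩
  have hnM : n ∈ M := Trans.tr _ _ hn ZFM.omM
  refine ⟨fun h => (t2 G hG n hnM b (Trans.tr _ _ hb hB)).2 ⟨q, hq, h⟩, fun h => ?_⟩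
  obtain ⟨b', hb', h6⟩ := h4 n hn
  rw [h2 n b b' h ((t2 G hG n hnM b' (Trans.tr _ _ hb' hB)).2 ⟨q, hq, h6⟩)]
  exact h6

end
end CtmForcing

namespace CtmForcing

open FirstOrder FirstOrder.Language


set_option synthInstance.maxSize 4000
set_option synthInstance.maxHeartbeats 200000

section
variable {M X w : ZFSet.{u}} [ZFM M]

theorem same_reals (hac : ACM M) (hcount : (M : Set ZFSet.{u}).Countable) (hX : X ∈ M) (hw : w ∈ M) {G : Set ZFSet.{u}}
    (hG : Gen M (Cd M X w) G) {x : ZFSet.{u}} (hx : x ∈ NN M G) (hxo : x ⊆ om) : x ∈ M := by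
  have hP : Fact (Cd M X w ∈ M) := ⟨Cd_mem hX hw⟩
  have := NN_ZFM hG
  have fx : Fact (x ∈ NN M G) := ⟨hx⟩
  obtain ⟨f, hf, h1, _⟩ := relM (M := NN M G) (fun n b => (n ∈ x ∧ b = nat 1) ∨ (n ∉ x ∧ b = nat 0)) inferInstance
    ZFM.omM ZFM.omM
  obtain ⟨g, hg, h2⟩ := no_new hac hcount hX hw hG hf (ZFM.omM (M := M)) (by
    intro n hn
    by_cases h : n ∈ x
    · exact ⟨nat 1, nat_mem_om 1, (h1 _ _).2 ⟨hn, nat_mem_om 1, Or.inl ⟨h, rfl⟩⟩⟩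
    · exact ⟨nat 0, nat_mem_om 0, (h1 _ _).2 ⟨hn, nat_mem_om 0, Or.inr ⟨h, rfl⟩⟩⟩) (by
    intro n b b' a1 a2
    obtain ⟨_, _, ⟨a3, rfl⟩ | ⟨a3, rfl⟩⟩ := (h1 _ _).1 a1 <;>
      obtain ⟨_, _, ⟨a4, rfl⟩ | ⟨a4, rfl⟩⟩ := (h1 _ _).1 a2
    · rfl
    · exact absurd a3 a4
    · exact absurd a4 a3
    · rfl)
  have fg : Fact (g ∈ M) := ⟨hg⟩
  have h3 : x = ZFSet.sep (fun n => ZFSet.pair n (nat 1) ∈ g) om := by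
    ext n
    rw [ZFSet.mem_sep, h2, h1]
    constructor
    · intro hn
      exact ⟨hxo hn, hxo hn, nat_mem_om 1, hxo hn, nat_mem_om 1, Or.inl ⟨hn, rfl⟩⟩
    · rintro ⟨_, _, _, _, _, h | h⟩
      · exact h.1
      · have := nat_inj h.2; omega
  rw [h3]
  exact ZFM.sp _ _ inferInstance ZFM.omM

theorem w1_pres (hac : ACM M) (hcount : (M : Set ZFSet.{u}).Countable) (hX : X ∈ M) (hw : w ∈ M) (hwc : ¬ Cnt M w)
    {G : Set ZFSet.{u}} (hG : Gen M (Cd M X w) G) {f : ZFSet.{u}} (hf : f ∈ NN M G) (hs : IsSurj om w f) : False := by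
  obtain ⟨g, hg, h2⟩ := no_new hac hcount hX hw hG hf hw hs.1.2 hs.2.1
  refine hwc ⟨g, hg, ?_, ?_⟩
  · intro n _ b _ b' _ a1 a2
    exact hs.2.1 _ _ _ ((h2 _ _).1 a1).2.2 ((h2 _ _).1 a2).2.2
  · intro u hu
    obtain ⟨n, hn, h⟩ := hs.2.2 u hu
    exact ⟨n, hn, (h2 _ _).2 ⟨hn, hu, h⟩⟩

theorem gen_bij (hac : ACM M) (hX : X ∈ M) (hw : w ∈ M) (hXc : ¬ Cnt M X) (hwc : ¬ Cnt M w)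
    {G : Set ZFSet.{u}} (hG : Gen M (Cd M X w) G) : ∃ g ∈ NN M G, IsSurj X w g ∧
      ∀ x x' y, ZFSet.pair x y ∈ g → ZFSet.pair x' y ∈ g → x = x' := by
  have hP : Fact (Cd M X w ∈ M) := ⟨Cd_mem hX hw⟩
  have f1 : Fact (X ∈ M) := ⟨hX⟩
  have f2 : Fact (w ∈ M) := ⟨hw⟩
  obtain ⟨Q, hQ, hQ1, hQ2⟩ := relM (M := M) (fun u p => ∃ v ∈ M, u = check v ∧ v ∈ p) inferInstance
    (A := im check (prodZ X w)) (B := Cd M X w) (tmem inferInstance) hP.1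
  have hg : ∀ u, u ∈ val G Q ↔ ∃ p ∈ G, u ∈ p := by
    intro u
    rw [mem_val]
    constructor
    · rintro ⟨y, p, hp, h1, rfl⟩
      obtain ⟨_, _, v, _, rfl, hv⟩ := (hQ1 _ _).1 h1
      rw [val_check hG]; exact ⟨p, hp, hv⟩
    · rintro ⟨p, hp, hu⟩
      have hpP := hG.sub _ hp
      refine ⟨check u, p, hp, (hQ1 _ _).2 ⟨mem_im.2 ⟨u, (mem_Cd.1 hpP).1 hu, rfl⟩, hpP, u, Trans.tr _ _ hu (mem_Cd.1 hpP).2.1, rfl, hu⟩, ?_⟩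
      rw [val_check hG]
  refine ⟨val G Q, val_mem G hQ, ⟨⟨?_, ?_⟩, ?_, ?_⟩, ?_⟩
  · intro u hu
    obtain ⟨p, hp, h⟩ := (hg u).1 hu
    exact mem_prodZ.1 ((mem_Cd.1 (hG.sub _ hp)).1 h)
  · intro x hx
    have fx : Fact (x ∈ M) := ⟨Trans.tr _ _ hx hX⟩
    obtain ⟨s, hs, y, hy, h⟩ := hG.dense0 (fun q => ∃ y ∈ w, ZFSet.pair x y ∈ q) inferInstance
      (fun q hq => dense_dom hac hX hw hwc hq hx)
    exact ⟨y, hy, (hg _).2 ⟨s, hs, h⟩⟩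
  · intro x y y' h1 h2
    obtain ⟨p, hp, h3⟩ := (hg _).1 h1
    obtain ⟨q, hq, h4⟩ := (hg _).1 h2
    obtain ⟨r, hr, h5, h6⟩ := hG.dir p hp q hq
    obtain ⟨_, a2, a3, a4, _⟩ := mem_Cd.1 (hG.sub _ hr)
    exact a3.eq a2 (h5 h3) (h6 h4)
  · intro y hy
    have fx : Fact (y ∈ M) := ⟨Trans.tr _ _ hy hw⟩
    obtain ⟨s, hs, x, hx, h⟩ := hG.dense0 (fun q => ∃ x ∈ X, ZFSet.pair x y ∈ q) inferInstance
      (fun q hq => dense_ran hac hX hw hXc hq hy)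
    exact ⟨x, hx, (hg _).2 ⟨s, hs, h⟩⟩
  · intro x y y' h1 h2
    obtain ⟨p, hp, h3⟩ := (hg _).1 h1
    obtain ⟨q, hq, h4⟩ := (hg _).1 h2
    obtain ⟨r, hr, h5, h6⟩ := hG.dir p hp q hq
    obtain ⟨_, a2, a3, a4, _⟩ := mem_Cd.1 (hG.sub _ hr)
    exact a4.eq a2 (h5 h3) (h6 h4)

end

/-- a ctm of `ZFC` has a countable transitive extension with the same ordinals
that models `ZFC + CH`. -/
theorem ctm_ZFC_imp_ctm_CH (M : ZFSet) (hcount : M.toSet.Countable)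
    (htrans : M.IsTransitive) (hmodel : ZModels M ZFC) :
    ∃ N : ZFSet, M ⊆ N ∧ N.toSet.Countable ∧ N.IsTransitive ∧
      (∀ α : ZFSet, IsOrd α → (α ∈ M ↔ α ∈ N)) ∧
      ZModels N (ZFC ∪ {chSent}) := by
  obtain ⟨hM, hac⟩ := ZFM.of_models htrans hmodel
  obtain ⟨w, hw, ho, hwc, hwe⟩ := exists_w1 hac
  have hX : powM M om ∈ M := tmem inferInstance
  have hP : Fact (Cd M (powM M om) w ∈ M) := ⟨Cd_mem hX hw⟩
  obtain ⟨G, hG, _⟩ := exists_gen hcount hP.1 Cd_empty Cd_empty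
  have hN := NN_ZFM hG
  have hsub := sub_NN hG
  refine ⟨NN M G, hsub, NN_countable hcount, fun y hy z hz => Trans.tr _ _ hz hy,
    fun α hα => ⟨fun h => hsub h, fun h => NN_ord hG hα h⟩, ?_⟩
  rintro φ (hφ | hφ)
  · exact ZFM.models (NN_AC hG hac) φ hφ
  · obtain rfl := hφ
    rw [Rz_sent]
    obtain ⟨g, hg, hg1, hg2⟩ := gen_bij hac hX hw cantor hwc hG
    unfold chSent
    unfold bijF
    simp only [Rz_ex, Rz_and, Rz_reindex, Rz_omega, Rz_pow, Rz_alephOne, Rz_isFunc, Rz_inj]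
    refine ⟨om, ZFM.omM, powM M om, hsub hX, w, hsub hw, g, hg, ⟨rfl, ?_⟩, ⟨⟨ho, ?_⟩, ?_⟩, hg1, hg2⟩
    · show powM M om = ZFSet.sep (· ∈ NN M G) (ZFSet.powerset om)
      ext x
      rw [mem_powM, ZFSet.mem_sep, ZFSet.mem_powerset]
      exact and_congr_right fun h => ⟨fun hx => hsub hx, fun hx => same_reals hac hcount hX hw hG hx h⟩
    · rintro ⟨f, hf, hs⟩
      exact w1_pres hac hcount hX hw hwc hG hf hs
    · intro x hx
      have hx' : x ∈ w := hx
      obtain ⟨f, hf, h1, h2⟩ := hwe x hx'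
      by_cases h : x = ∅
      · exact Or.inl h
      · right
        obtain ⟨f', hf', h3⟩ := mk_surj ZFM.omM (Trans.tr _ _ hx' hw) hf (by by_contra! hc; exact h ((ZFSet.eq_empty _).2 hc))
          (fun a b c h3 h4 => h1.eq hf h3 h4) h2
        exact ⟨f', hsub hf', h3⟩

end CtmForcing
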